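/- arXiv:1512.03778 — 2 statements merged into one kernel-verified Lean document; each statement's English description precedes it below -/
import Mathlib

section
/- Suppose n ≥ 3, α ∈ (0,n), λ > 0, σ ≥ 0, and u is a nonnegative solution of the Choquard–Pekar inequality problem. Let v = u + 1. Then: (a) v ∈ C²(ℝⁿ\{0}) ∩ L^λ(B₂(0)); (b) there exists a constant C > 0 such that 0 ≤ −Δv(x) ≤ C·(I_{n−α}(v^λ))(x)·v(x)^σ and v(x) ≥ 1 for all x ∈ B₂(0)\{0}; (c) −Δv ∈ L¹(B₁(0)) and v^μ ∈ L¹(B₁(0)) for all μ ∈ [1, n/(n−2)); and (d) there exist constants m ≥ 0, C' > 0, and a function h harmonic and bounded in B₁(0), such that v(x) = m·|x|^{−(n−2)} + h(x) + C'·∫_{|y|<1} (−Δv(y))/|x−y|^{n−2} dy for all 0 < |x| < 1. -/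
open MeasureTheory Metric Filter Set Asymptotics Topology

/-- `ℝⁿ` as a Euclidean space. -/
abbrev Euc (n : ℕ) : Type := EuclideanSpace ℝ (Fin n)

/-- The Laplacian `Δu(x) = ∑ i ∂²u/∂xᵢ²(x)`. -/
noncomputable def lap {n : ℕ} (u : Euc n → ℝ) (x : Euc n) : ℝ :=
  ∑ i : Fin n, iteratedFDeriv ℝ 2 u x ![EuclideanSpace.single i 1, EuclideanSpace.single i 1]

/-- `u` is a nonnegative solution of the Choquard–Pekar inequality problem:
`u ∈ C²(ℝⁿ \ {0}) ∩ L^λ(ℝⁿ)` and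
`0 ≤ -Δu(x) ≤ (∫ |x-y|^(-α) u(y)^λ dy) · u(x)^σ` on `B₂(0) \ {0}`. -/
def IsCPSolution (n : ℕ) (α lam sig : ℝ) (u : Euc n → ℝ) : Prop :=
  (∀ x, 0 ≤ u x) ∧
  ContDiffOn ℝ 2 u {0}ᶜ ∧
  Integrable (fun y => u y ^ lam) ∧
  ∀ x ∈ ball (0 : Euc n) 2 \ {0},
    0 ≤ -lap u x ∧
    -lap u x ≤ (∫ y, ‖x - y‖ ^ (-α) * u y ^ lam) * u x ^ sig

/-- The partial derivative in the `i`-th coordinate direction. -/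
noncomputable def pd {n : ℕ} (i : Fin n) (u : Euc n → ℝ) (x : Euc n) : ℝ :=
  fderiv ℝ u x (EuclideanSpace.single i 1)

section Calculus

variable {n : ℕ}

lemma differentiableAt_fderiv_of_contDiffAt {u : Euc n → ℝ} {x : Euc n}
    (hu : ContDiffAt ℝ 2 u x) : DifferentiableAt ℝ (fderiv ℝ u) x :=
  (hu.fderiv_right (m := 1) (by norm_num)).differentiableAt (by norm_num)

lemma differentiableAt_pd {u : Euc n → ℝ} {x : Euc n} (i : Fin n)
    (hu : ContDiffAt ℝ 2 u x) : DifferentiableAt ℝ (pd i u) x :=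
  (differentiableAt_fderiv_of_contDiffAt hu).clm_apply (differentiableAt_const _)

lemma lap_eq_sum_pd {u : Euc n → ℝ} {x : Euc n} (hu : ContDiffAt ℝ 2 u x) :
    lap u x = ∑ i, pd i (pd i u) x := by
  unfold lap
  refine Finset.sum_congr rfl fun i _ => ?_
  rw [iteratedFDeriv_two_apply]
  unfold pd
  rw [fderiv_clm_apply (differentiableAt_fderiv_of_contDiffAt hu) (differentiableAt_const _)]
  simp

lemma Filter.EventuallyEq.pd {u w : Euc n → ℝ} {x : Euc n} (i : Fin n) (h : u =ᶠ[𝓝 x] w) :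
    pd i u =ᶠ[𝓝 x] pd i w := by
  filter_upwards [h.fderiv (𝕜 := ℝ)] with y hy
  simp [_root_.pd, hy]

lemma lap_congr {u w : Euc n → ℝ} {x : Euc n} (h : u =ᶠ[𝓝 x] w) : lap u x = lap w x := by
  unfold lap
  refine Finset.sum_congr rfl fun i _ => ?_
  rw [iteratedFDeriv_two_apply, iteratedFDeriv_two_apply, (h.fderiv (𝕜 := ℝ)).fderiv_eq]

lemma lap_const (c : ℝ) (x : Euc n) : lap (fun _ => c) x = 0 := by
  simp [lap, iteratedFDeriv_two_apply]

lemma lap_add {u w : Euc n → ℝ} {x : Euc n} (hu : ContDiffAt ℝ 2 u x)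
    (hw : ContDiffAt ℝ 2 w x) : lap (fun y => u y + w y) x = lap u x + lap w x := by
  unfold lap
  rw [← Finset.sum_add_distrib]
  refine Finset.sum_congr rfl fun i _ => ?_
  have := iteratedFDeriv_add_apply (i := 2) (x := x) (𝕜 := ℝ) (f := u) (g := w)
    (by exact_mod_cast hu) (by exact_mod_cast hw)
  change iteratedFDeriv ℝ 2 (u + w) x _ = _
  rw [this]; rfl

lemma lap_const_mul (c : ℝ) {u : Euc n → ℝ} {x : Euc n} (hu : ContDiffAt ℝ 2 u x) :
    lap (fun y => c * u y) x = c * lap u x := by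
  unfold lap
  rw [Finset.mul_sum]
  refine Finset.sum_congr rfl fun i _ => ?_
  have := iteratedFDeriv_const_smul_apply (i := 2) (x := x) (𝕜 := ℝ) (f := u) (a := c)
    (by exact_mod_cast hu)
  change iteratedFDeriv ℝ 2 (c • u) x _ = _
  rw [this]; rfl

lemma pd_add {u w : Euc n → ℝ} {x : Euc n} (i : Fin n) (hu : DifferentiableAt ℝ u x)
    (hw : DifferentiableAt ℝ w x) : pd i (fun y => u y + w y) x = pd i u x + pd i w x := by
  simp [pd, fderiv_fun_add hu hw]

lemma pd_mul {u w : Euc n → ℝ} {x : Euc n} (i : Fin n) (hu : DifferentiableAt ℝ u x)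
    (hw : DifferentiableAt ℝ w x) :
    pd i (fun y => u y * w y) x = u x * pd i w x + w x * pd i u x := by
  simp [pd, fderiv_fun_mul hu hw]

lemma lap_mul {u w : Euc n → ℝ} {x : Euc n} (hu : ContDiffAt ℝ 2 u x)
    (hw : ContDiffAt ℝ 2 w x) :
    lap (fun y => u y * w y) x
      = u x * lap w x + 2 * ∑ i, pd i u x * pd i w x + w x * lap u x := by
  rw [lap_eq_sum_pd (hu.mul hw), lap_eq_sum_pd hu, lap_eq_sum_pd hw, Finset.mul_sum,
    Finset.mul_sum, Finset.mul_sum, ← Finset.sum_add_distrib, ← Finset.sum_add_distrib]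
  refine Finset.sum_congr rfl fun i _ => ?_
  have h : pd i (fun y => u y * w y) =ᶠ[𝓝 x] fun y => u y * pd i w y + w y * pd i u y := by
    filter_upwards [hu.eventually (by simp), hw.eventually (by simp)] with y h1 h2
    exact pd_mul i (h1.differentiableAt (by norm_num)) (h2.differentiableAt (by norm_num))
  have du := hu.differentiableAt (by norm_num)
  have dw := hw.differentiableAt (by norm_num)
  have e : pd i (pd i (fun y => u y * w y)) x
      = pd i (fun y => u y * pd i w y + w y * pd i u y) x := (h.pd i).eq_of_nhds
  rw [e, pd_add (u := fun y => u y * pd i w y) (w := fun y => w y * pd i u y) i (du.mul (differentiableAt_pd i hw)) (dw.mul (differentiableAt_pd i hu)),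
    pd_mul i du (differentiableAt_pd i hw), pd_mul i dw (differentiableAt_pd i hu)]
  ring

lemma pd_comp {g : ℝ → ℝ} {a : Euc n → ℝ} {x : Euc n} (i : Fin n)
    (hg : DifferentiableAt ℝ g (a x)) (ha : DifferentiableAt ℝ a x) :
    pd i (fun y => g (a y)) x = deriv g (a x) * pd i a x := by
  have := (hg.hasDerivAt.comp_hasFDerivAt x ha.hasFDerivAt).fderiv
  simp only [Function.comp_def] at this
  simp [pd, this]

lemma lap_comp {g : ℝ → ℝ} {a : Euc n → ℝ} {x : Euc n} (hg : ContDiffAt ℝ 2 g (a x))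
    (ha : ContDiffAt ℝ 2 a x) :
    lap (fun y => g (a y)) x
      = deriv (deriv g) (a x) * ∑ i, pd i a x ^ 2 + deriv g (a x) * lap a x := by
  have hga : ContDiffAt ℝ 2 (fun y => g (a y)) x := hg.comp x ha
  rw [lap_eq_sum_pd hga, lap_eq_sum_pd ha, Finset.mul_sum, Finset.mul_sum,
    ← Finset.sum_add_distrib]
  refine Finset.sum_congr rfl fun i _ => ?_
  have da := ha.differentiableAt (by norm_num)
  have h : pd i (fun y => g (a y)) =ᶠ[𝓝 x] fun y => deriv g (a y) * pd i a y := by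
    filter_upwards [da.continuousAt.eventually (hg.eventually (by simp)),
      ha.eventually (by simp)] with y h1 h2
    exact pd_comp i (h1.differentiableAt (by norm_num)) (h2.differentiableAt (by norm_num))
  have hg' : ContDiffAt ℝ 1 (deriv g) (a x) := by
    have h2 := hg.fderiv_right (m := 1) (by norm_num)
    have : deriv g = fun t => fderiv ℝ g t 1 := by ext t; simp
    rw [this]
    exact h2.clm_apply contDiffAt_const
  have dg' := hg'.differentiableAt (by norm_num)
  have e : pd i (pd i (fun y => g (a y))) x
      = pd i (fun y => deriv g (a y) * pd i a y) x := (h.pd i).eq_of_nhds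
  rw [e, pd_mul (u := fun y => deriv g (a y)) i (dg'.comp x da) (differentiableAt_pd i ha), pd_comp i dg' da]
  ring

lemma contDiff_norm_sub_sq_add (x : Euc n) (c : ℝ) :
    ContDiff ℝ 2 (fun y : Euc n => ‖y - x‖ ^ 2 + c) :=
  ((contDiff_id.sub contDiff_const).norm_sq ℝ).add contDiff_const

lemma pd_norm_sub_sq_add (i : Fin n) (x y : Euc n) (c : ℝ) :
    pd i (fun y : Euc n => ‖y - x‖ ^ 2 + c) y = 2 * (y i - x i) := by
  have h : HasFDerivAt (fun y : Euc n => ‖y - x‖ ^ 2 + c) (2 • innerSL ℝ (y - x)) y := by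
    have := ((hasStrictFDerivAt_norm_sq (y - x)).hasFDerivAt.comp y
      ((hasFDerivAt_id y).sub_const x)).add_const c
    simpa [Function.comp_def] using this
  simp [pd, h.fderiv, EuclideanSpace.inner_single_right]

lemma sum_pd_norm_sub_sq_add (x y : Euc n) (c : ℝ) :
    ∑ i, pd i (fun y : Euc n => ‖y - x‖ ^ 2 + c) y ^ 2 = 4 * ‖y - x‖ ^ 2 := by
  rw [EuclideanSpace.norm_sq_eq, Finset.mul_sum]
  refine Finset.sum_congr rfl fun i _ => ?_
  rw [pd_norm_sub_sq_add]
  simp [PiLp.sub_apply, Real.norm_eq_abs, sq_abs]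
  ring

lemma lap_norm_sub_sq_add (x y : Euc n) (c : ℝ) :
    lap (fun y : Euc n => ‖y - x‖ ^ 2 + c) y = 2 * n := by
  rw [lap_eq_sum_pd (contDiff_norm_sub_sq_add x c).contDiffAt]
  have : ∀ i : Fin n, pd i (pd i (fun y : Euc n => ‖y - x‖ ^ 2 + c)) y = 2 := by
    intro i
    have h : pd i (fun y : Euc n => ‖y - x‖ ^ 2 + c) = fun y => 2 * (y i - x i) := by
      ext y; exact pd_norm_sub_sq_add i x y c
    have h' : HasFDerivAt (fun y : Euc n => 2 * (y i - x i))
        ((2 : ℝ) • (EuclideanSpace.proj i : Euc n →L[ℝ] ℝ)) y := by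
      have := ((EuclideanSpace.proj i : Euc n →L[ℝ] ℝ).hasFDerivAt (x := y)).sub_const (x i)
      exact this.const_mul 2
    rw [h]
    simp [pd, h'.fderiv]
  simp [this]
  ring

/-- The Laplacian of a power of a shifted squared distance. -/
lemma lap_rpow_norm_sub_sq_add (x y : Euc n) (c p : ℝ) (h : 0 < ‖y - x‖ ^ 2 + c) :
    lap (fun y : Euc n => (‖y - x‖ ^ 2 + c) ^ p) y
      = 2 * p * (‖y - x‖ ^ 2 + c) ^ (p - 2)
        * (2 * (p - 1) * ‖y - x‖ ^ 2 + n * (‖y - x‖ ^ 2 + c)) := by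
  have hd : ∀ (q t : ℝ), t ≠ 0 → deriv (fun t : ℝ => t ^ q) t = q * t ^ (q - 1) :=
    fun q t ht => (Real.hasDerivAt_rpow_const (Or.inl ht)).deriv
  have hd2 : deriv (deriv (fun t : ℝ => t ^ p)) (‖y - x‖ ^ 2 + c)
      = p * ((p - 1) * (‖y - x‖ ^ 2 + c) ^ (p - 2)) := by
    have : deriv (fun t : ℝ => t ^ p) =ᶠ[𝓝 (‖y - x‖ ^ 2 + c)] fun t => p * t ^ (p - 1) := by
      filter_upwards [eventually_ne_nhds h.ne'] with t ht using hd p t ht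
    rw [this.deriv_eq, deriv_const_mul _
      (Real.differentiableAt_rpow_const_of_ne _ h.ne'), hd _ _ h.ne']
    ring_nf
  rw [lap_comp (g := fun t : ℝ => t ^ p) (Real.contDiffAt_rpow_const_of_ne h.ne')
    (contDiff_norm_sub_sq_add x c).contDiffAt, hd2, hd _ _ h.ne', sum_pd_norm_sub_sq_add,
    lap_norm_sub_sq_add]
  have : (‖y - x‖ ^ 2 + c) ^ (p - 1) = (‖y - x‖ ^ 2 + c) ^ (p - 2) * (‖y - x‖ ^ 2 + c) := by
    rw [← Real.rpow_add_one h.ne']; ring_nf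
  rw [this]
  ring

lemma contDiffAt_rpow_norm_sub_sq_add (x y : Euc n) (c p : ℝ) (h : 0 < ‖y - x‖ ^ 2 + c) :
    ContDiffAt ℝ 2 (fun y : Euc n => (‖y - x‖ ^ 2 + c) ^ p) y :=
  (contDiff_norm_sub_sq_add x c).contDiffAt.rpow_const_of_ne h.ne'

lemma continuousAt_lap {u : Euc n → ℝ} {x : Euc n} (hu : ContDiffAt ℝ 2 u x) :
    ContinuousAt (lap u) x := by
  have h : ContinuousAt (fderiv ℝ (fderiv ℝ u)) x :=
    ((hu.fderiv_right (m := 1) (by norm_num)).fderiv_right (m := 0) (by norm_num)).continuousAt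
  have e : lap u = fun y => ∑ i : Fin n,
      fderiv ℝ (fderiv ℝ u) y (EuclideanSpace.single i 1) (EuclideanSpace.single i 1) := by
    ext y
    exact Finset.sum_congr rfl fun i _ => iteratedFDeriv_two_apply _ _ _
  rw [e]
  exact tendsto_finsetSum _ fun i _ =>
    (h.clm_apply continuousAt_const).clm_apply continuousAt_const

lemma continuousAt_pd {u : Euc n → ℝ} {x : Euc n} (i : Fin n) (hu : ContDiffAt ℝ 1 u x) :
    ContinuousAt (pd i u) x :=
  (hu.fderiv_right (m := 0) (by norm_num)).continuousAt.clm_apply continuousAt_const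

lemma contDiffAt_pd {u : Euc n → ℝ} {x : Euc n} (i : Fin n) (hu : ContDiffAt ℝ 2 u x) :
    ContDiffAt ℝ 1 (pd i u) x :=
  (hu.fderiv_right (m := 1) (by norm_num)).clm_apply contDiffAt_const

end Calculus

section Green

variable {n : ℕ}

lemma HasCompactSupport.pd {u : Euc n → ℝ} (i : Fin n) (hu : HasCompactSupport u) :
    HasCompactSupport (pd i u) :=
  hu.fderiv_apply ℝ _

lemma HasCompactSupport.lap {u : Euc n → ℝ} (hu : HasCompactSupport u) :
    HasCompactSupport (lap u) := by
  refine hu.mono' (fun x hx => ?_)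
  by_contra h
  apply hx
  have h0 : u =ᶠ[𝓝 x] fun _ => 0 := notMem_tsupport_iff_eventuallyEq.1 h
  rw [lap_congr h0, lap_const]

lemma integrable_of_continuousAt_of_eventually_zero {F : Euc n → ℝ}
    (hc : HasCompactSupport F) (hF : ∀ x, x ≠ 0 → ContinuousAt F x)
    (h0 : F =ᶠ[𝓝 0] fun _ => 0) : Integrable F := by
  refine Continuous.integrable_of_hasCompactSupport (continuous_iff_continuousAt.2 fun x => ?_) hc
  by_cases hx : x = 0
  · subst hx
    exact continuousAt_const.congr h0.symm
  · exact hF x hx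

lemma integral_mul_pd_eq_neg {f g : Euc n → ℝ} (i : Fin n)
    (hf : ∀ x, x ≠ 0 → ContDiffAt ℝ 1 f x) (hc : HasCompactSupport f)
    (hg : ContDiff ℝ 1 g) (hg0 : g =ᶠ[𝓝 0] fun _ => 0) :
    ∫ x, f x * pd i g x = - ∫ x, pd i f x * g x := by
  have hpg0 : pd i g =ᶠ[𝓝 0] fun _ => 0 := by
    filter_upwards [hg0.pd i] with y hy
    rw [hy]; simp [pd]
  refine integral_mul_fderiv_eq_neg_fderiv_mul_of_integrable (𝕜 := ℝ) ?_ ?_ ?_ ?_ ?_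
  · refine integrable_of_continuousAt_of_eventually_zero (hc.pd i).mul_right
      (fun x hx => (continuousAt_pd i (hf x hx)).mul hg.continuous.continuousAt) ?_
    filter_upwards [hg0] with y hy
    simp [hy]
  · refine integrable_of_continuousAt_of_eventually_zero hc.mul_right
      (fun x hx => (hf x hx).continuousAt.mul (continuousAt_pd i hg.contDiffAt)) ?_
    filter_upwards [hpg0] with y hy
    change f y * pd i g y = 0
    simp [hy]
  · refine integrable_of_continuousAt_of_eventually_zero hc.mul_right
      (fun x hx => (hf x hx).continuousAt.mul hg.continuous.continuousAt) ?_
    filter_upwards [hg0] with y hy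
    simp [hy]
  · intro x hx
    refine (hf x ?_).differentiableAt (by norm_num)
    rintro rfl
    exact notMem_tsupport_iff_eventuallyEq.2 hg0 hx
  · intro x _
    exact hg.differentiable (by norm_num) x

/-- Green's second identity for a compactly supported function with a singularity at the origin,
tested against a function vanishing near the origin. -/
lemma integral_mul_lap_eq {w φ : Euc n → ℝ} (hw : ∀ x, x ≠ 0 → ContDiffAt ℝ 2 w x)
    (hc : HasCompactSupport w) (hφ : ContDiff ℝ 2 φ) (hφ0 : φ =ᶠ[𝓝 0] fun _ => 0) :
    ∫ x, w x * lap φ x = ∫ x, lap w x * φ x := by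
  have hp : ∀ i : Fin n, ContDiff ℝ 1 (pd i φ) := fun i =>
    contDiff_iff_contDiffAt.2 fun x => contDiffAt_pd i hφ.contDiffAt
  have hp0 : ∀ i : Fin n, pd i φ =ᶠ[𝓝 0] fun _ => 0 := fun i => by
    filter_upwards [hφ0.pd i] with y hy
    rw [hy]; simp [pd]
  have hpp0 : ∀ i : Fin n, pd i (pd i φ) =ᶠ[𝓝 0] fun _ => 0 := fun i => by
    filter_upwards [(hp0 i).pd i] with y hy
    rw [hy]; simp [pd]
  have e1 : ∫ x, w x * lap φ x = ∑ i, ∫ x, w x * pd i (pd i φ) x := by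
    rw [← integral_finsetSum]
    · refine integral_congr_ae (ae_of_all _ fun x => ?_)
      simp only [lap_eq_sum_pd (hφ.contDiffAt (x := x)), Finset.mul_sum]
    · intro i _
      refine integrable_of_continuousAt_of_eventually_zero hc.mul_right
        (fun x hx => (hw x hx).continuousAt.mul (continuousAt_pd i (hp i).contDiffAt)) ?_
      filter_upwards [hpp0 i] with y hy
      simp [hy]
  have e2 : ∫ x, lap w x * φ x = ∑ i, ∫ x, pd i (pd i w) x * φ x := by
    rw [← integral_finsetSum]
    · refine integral_congr_ae (ae_of_all _ fun x => ?_)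
      by_cases hx : x = 0
      · subst hx
        simp [hφ0.eq_of_nhds]
      · simp only [lap_eq_sum_pd (hw x hx), Finset.sum_mul]
    · intro i _
      refine integrable_of_continuousAt_of_eventually_zero ((hc.pd i).pd i).mul_right
        (fun x hx => (continuousAt_pd i (contDiffAt_pd i (hw x hx))).mul
          hφ.continuous.continuousAt) ?_
      filter_upwards [hφ0] with y hy
      simp [hy]
  rw [e1, e2]
  refine Finset.sum_congr rfl fun i _ => ?_
  rw [integral_mul_pd_eq_neg i (fun x hx => (hw x hx).of_le (by norm_num)) hc (hp i) (hp0 i),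
    integral_mul_pd_eq_neg i (fun x hx => contDiffAt_pd i (hw x hx)) (hc.pd i)
      (hφ.of_le (by norm_num)) hφ0, neg_neg]

end Green

section SubharmonicTest

variable {n : ℕ}

/-- The cube of the positive part, a convex `C²` function. -/
noncomputable def cubePos (t : ℝ) : ℝ := max t 0 ^ 3

lemma hasDerivAt_max_zero_pow (k : ℕ) (t : ℝ) :
    HasDerivAt (fun t : ℝ => max t 0 ^ (k + 2)) ((k + 2) * max t 0 ^ (k + 1)) t := by
  rcases lt_trichotomy t 0 with h | rfl | h
  · have e : (fun t : ℝ => max t 0 ^ (k + 2)) =ᶠ[𝓝 t] fun _ => 0 := by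
      filter_upwards [eventually_lt_nhds h] with s hs
      simp [max_eq_right hs.le]
    simpa [max_eq_right h.le] using (hasDerivAt_const t (0 : ℝ)).congr_of_eventuallyEq e
  · have : HasDerivAt (fun t : ℝ => max t 0 ^ (k + 2)) 0 0 := by
      rw [hasDerivAt_iff_isLittleO]
      simp only [max_self, sub_zero, smul_zero, ne_eq, Nat.add_eq_zero_iff, OfNat.ofNat_ne_zero,
        and_false, not_false_eq_true, zero_pow]
      have h1 : (fun t : ℝ => max t 0 ^ (k + 2)) =O[𝓝 0] fun t : ℝ => t ^ (k + 2) := by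
        refine IsBigO.of_bound 1 (Eventually.of_forall fun t => ?_)
        rw [one_mul, norm_pow, norm_pow]
        gcongr
        rw [Real.norm_eq_abs, Real.norm_eq_abs, abs_of_nonneg (le_max_right t 0)]
        exact max_le (le_abs_self t) (abs_nonneg t)
      refine h1.trans_isLittleO ?_
      simpa using isLittleO_pow_pow (𝕜 := ℝ) (m := 1) (n := k + 2) (by omega)
    simpa using this
  · have e : (fun t : ℝ => max t 0 ^ (k + 2)) =ᶠ[𝓝 t] fun t => t ^ (k + 2) := by
      filter_upwards [eventually_gt_nhds h] with s hs
      simp [max_eq_left hs.le]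
    have := (hasDerivAt_pow (k + 2) t).congr_of_eventuallyEq e
    simpa [max_eq_left h.le] using this

lemma deriv_cubePos : deriv cubePos = fun t => 3 * max t 0 ^ 2 := by
  ext t
  have := (hasDerivAt_max_zero_pow 1 t).deriv
  norm_num at this
  exact this

lemma deriv_deriv_cubePos : deriv (deriv cubePos) = fun t => 6 * max t 0 := by
  rw [deriv_cubePos]
  ext t
  refine (((hasDerivAt_max_zero_pow 0 t).const_mul 3).congr_deriv ?_).deriv
  norm_num
  ring

lemma contDiff_cubePos : ContDiff ℝ 2 cubePos := by
  have d1 : Differentiable ℝ cubePos := fun t =>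
    (hasDerivAt_max_zero_pow 1 t).differentiableAt
  have d2 : Differentiable ℝ (deriv cubePos) := by
    rw [deriv_cubePos]
    exact fun t => ((hasDerivAt_max_zero_pow 0 t).const_mul 3).differentiableAt
  rw [show (2 : WithTop ℕ∞) = 1 + 1 by norm_num, contDiff_succ_iff_deriv]
  refine ⟨d1, by simp, ?_⟩
  rw [contDiff_one_iff_deriv]
  refine ⟨d2, ?_⟩
  rw [deriv_deriv_cubePos]
  fun_prop

/-- The subharmonic radial profile `1 + b |y| - ε / |y|`. -/
noncomputable def radialProfile (b ε : ℝ) (y : Euc n) : ℝ := (‖y‖ + b * ‖y‖ ^ 2 - ε) / ‖y‖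

lemma radialProfile_eventuallyEq (b ε : ℝ) {y : Euc n} (hy : y ≠ 0) :
    (radialProfile b ε : Euc n → ℝ) =ᶠ[𝓝 y] fun z => 1 + (b * (‖z - 0‖ ^ 2 + 0) ^ (1 / 2 : ℝ)
      + (-ε) * (‖z - 0‖ ^ 2 + 0) ^ (-(1 / 2) : ℝ)) := by
  filter_upwards [eventually_ne_nhds hy] with z hz
  have hz' : 0 < ‖z‖ := norm_pos_iff.2 hz
  have h1 : (‖z‖ ^ 2) ^ (1 / 2 : ℝ) = ‖z‖ := by
    rw [← Real.sqrt_eq_rpow, Real.sqrt_sq hz'.le]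
  rw [sub_zero, add_zero, Real.rpow_neg (by positivity), h1, radialProfile]
  field_simp
  ring

lemma contDiffAt_radialProfile (b ε : ℝ) {y : Euc n} (hy : y ≠ 0) :
    ContDiffAt ℝ 2 (radialProfile b ε : Euc n → ℝ) y := by
  have h : 0 < ‖y - 0‖ ^ 2 + 0 := by
    have := norm_pos_iff.2 hy
    rw [sub_zero]; positivity
  refine ContDiffAt.congr_of_eventuallyEq ?_ (radialProfile_eventuallyEq b ε hy)
  exact contDiffAt_const.add ((contDiffAt_const.mul (contDiffAt_rpow_norm_sub_sq_add _ _ _ _ h)).add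
    (contDiffAt_const.mul (contDiffAt_rpow_norm_sub_sq_add _ _ _ _ h)))

lemma mul_inv_norm_le_lap_radialProfile (hn : 3 ≤ n) {b ε : ℝ} (hb : 0 ≤ b) (hε : 0 ≤ ε) {y : Euc n} (hy : y ≠ 0) :
    b * ‖y‖⁻¹ ≤ lap (radialProfile b ε) y := by
  have hy' := norm_pos_iff.2 hy
  have h : 0 < ‖y - 0‖ ^ 2 + 0 := by rw [sub_zero]; positivity
  have hn' : (3 : ℝ) ≤ n := by exact_mod_cast hn
  have c1 := contDiffAt_rpow_norm_sub_sq_add 0 y 0 (1 / 2) h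
  have c2 := contDiffAt_rpow_norm_sub_sq_add 0 y 0 (-(1 / 2)) h
  rw [lap_congr (radialProfile_eventuallyEq b ε hy),
    lap_add (u := fun _ => 1) contDiffAt_const
      ((contDiffAt_const.mul c1).add (contDiffAt_const.mul c2)), lap_const,
    lap_add (contDiffAt_const.mul c1) (contDiffAt_const.mul c2), lap_const_mul _ c1, lap_const_mul _ c2,
    lap_rpow_norm_sub_sq_add _ _ _ _ h, lap_rpow_norm_sub_sq_add _ _ _ _ h]
  simp only [sub_zero, add_zero]
  have e1 : (‖y‖ ^ 2) ^ ((1 / 2 : ℝ) - 2) = (‖y‖ ^ 3)⁻¹ := by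
    rw [← Real.rpow_natCast, ← Real.rpow_mul hy'.le, ← Real.rpow_natCast,
      ← Real.rpow_neg hy'.le]
    norm_num
  have e2 : 0 ≤ (‖y‖ ^ 2) ^ (-(1 / 2 : ℝ) - 2) := by positivity
  rw [e1]
  have t1 : ‖y‖⁻¹ ≤ 2 * (1 / 2) * (‖y‖ ^ 3)⁻¹ * (2 * (1 / 2 - 1) * ‖y‖ ^ 2 + n * ‖y‖ ^ 2) := by
    have : 2 * (1 / 2) * (‖y‖ ^ 3)⁻¹ * (2 * (1 / 2 - 1) * ‖y‖ ^ 2 + n * ‖y‖ ^ 2)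
        = (n - 1) * ‖y‖⁻¹ := by
      field_simp
      ring
    rw [this]
    have := inv_pos.2 hy'
    nlinarith
  have t2 : 0 ≤ -ε * (2 * -(1 / 2) * (‖y‖ ^ 2) ^ (-(1 / 2 : ℝ) - 2)
      * (2 * (-(1 / 2) - 1) * ‖y‖ ^ 2 + n * ‖y‖ ^ 2)) := by
    have : -ε * (2 * -(1 / 2) * (‖y‖ ^ 2) ^ (-(1 / 2 : ℝ) - 2)
      * (2 * (-(1 / 2) - 1) * ‖y‖ ^ 2 + n * ‖y‖ ^ 2))
      = ε * (‖y‖ ^ 2) ^ (-(1 / 2 : ℝ) - 2) * ((n - 3) * ‖y‖ ^ 2) := by ring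
    rw [this]
    have : (0 : ℝ) ≤ n - 3 := by linarith
    positivity
  nlinarith

/-- A subharmonic test function vanishing near the origin. -/
noncomputable def subTest (b ε : ℝ) (y : Euc n) : ℝ := cubePos (radialProfile b ε y)

lemma subTest_eventually_zero (b : ℝ) {ε : ℝ} (hε : 0 < ε) :
    (subTest b ε : Euc n → ℝ) =ᶠ[𝓝 0] fun _ => 0 := by
  have h : Tendsto (fun y : Euc n => ‖y‖ + b * ‖y‖ ^ 2 - ε) (𝓝 0) (𝓝 (-ε)) := by
    have : Continuous (fun y : Euc n => ‖y‖ + b * ‖y‖ ^ 2 - ε) := by fun_prop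
    simpa using this.tendsto 0
  filter_upwards [h.eventually (gt_mem_nhds (neg_lt_zero.2 hε))] with y hy
  have : radialProfile b ε y ≤ 0 := div_nonpos_of_nonpos_of_nonneg hy.le (norm_nonneg y)
  simp [subTest, cubePos, max_eq_right this]

lemma contDiff_subTest (b : ℝ) {ε : ℝ} (hε : 0 < ε) : ContDiff ℝ 2 (subTest b ε : Euc n → ℝ) := by
  refine contDiff_iff_contDiffAt.2 fun y => ?_
  by_cases hy : y = 0
  · subst hy
    exact contDiffAt_const.congr_of_eventuallyEq (subTest_eventually_zero b hε)
  · exact contDiff_cubePos.contDiffAt.comp y (contDiffAt_radialProfile b ε hy)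

lemma subTest_nonneg (b ε : ℝ) (y : Euc n) : 0 ≤ subTest b ε y :=
  pow_nonneg (le_max_right _ _) 3

lemma le_lap_subTest (hn : 3 ≤ n) {b ε : ℝ} (hb : 0 ≤ b) (hε : 0 ≤ ε) {y : Euc n} (hy : y ≠ 0) :
    3 * max (radialProfile b ε y) 0 ^ 2 * (b * ‖y‖⁻¹) ≤ lap (subTest b ε) y := by
  have e : lap (subTest b ε) y = _ :=
    lap_comp contDiff_cubePos.contDiffAt (contDiffAt_radialProfile b ε hy)
  rw [e, deriv_deriv_cubePos, deriv_cubePos]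
  have h1 : 0 ≤ 6 * max (radialProfile b ε y) 0 * ∑ i, pd i (radialProfile b ε) y ^ 2 := by
    have := le_max_right (radialProfile b ε y) 0
    positivity
  have h2 : 3 * max (radialProfile b ε y) 0 ^ 2 * (b * ‖y‖⁻¹)
      ≤ 3 * max (radialProfile b ε y) 0 ^ 2 * lap (radialProfile b ε) y :=
    mul_le_mul_of_nonneg_left (mul_inv_norm_le_lap_radialProfile hn hb hε hy) (by positivity)
  linarith

lemma subTest_le {b ε : ℝ} (hb : 0 ≤ b) (hε : 0 ≤ ε) (y : Euc n) :
    subTest b ε y ≤ (1 + b * ‖y‖) ^ 3 := by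
  have h0 := norm_nonneg y
  refine pow_le_pow_left₀ (le_max_right _ _) (max_le ?_ (by positivity)) 3
  rcases h0.eq_or_lt with h | h
  · simp [radialProfile, ← h]
  · rw [radialProfile, div_le_iff₀ h]
    nlinarith

lemma half_le_radialProfile {b ε : ℝ} {y : Euc n} (hb : 0 ≤ b) (hε : 0 < ε) (h : 2 * ε ≤ ‖y‖) :
    1 / 2 ≤ radialProfile b ε y := by
  have : 0 < ‖y‖ := by linarith
  rw [radialProfile, le_div_iff₀ this]
  have := mul_nonneg hb (sq_nonneg ‖y‖)
  nlinarith

end SubharmonicTest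

section Integrability

variable {n : ℕ}

lemma integrableOn_compl_ball {F : Euc n → ℝ} (hc : HasCompactSupport F)
    (hF : ∀ x, x ≠ 0 → ContinuousAt F x) {r : ℝ} (hr : 0 < r) :
    IntegrableOn F (ball (0 : Euc n) r)ᶜ := by
  have hK : IsCompact (tsupport F ∩ (ball (0 : Euc n) r)ᶜ) :=
    hc.isCompact.inter_right isOpen_ball.isClosed_compl
  have h1 : IntegrableOn F (tsupport F ∩ (ball (0 : Euc n) r)ᶜ) := by
    refine ContinuousOn.integrableOn_compact hK fun x hx => (hF x ?_).continuousWithinAt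
    rintro rfl
    exact hx.2 (mem_ball_self hr)
  refine h1.of_forall_sdiff_eq_zero measurableSet_ball.compl fun x hx => ?_
  by_contra h
  exact hx.2 ⟨subset_tsupport F h, hx.1⟩

lemma aestronglyMeasurable_of_continuousAt [Nontrivial (Euc n)] {F : Euc n → ℝ}
    (hF : ∀ x, x ≠ 0 → ContinuousAt F x) : AEStronglyMeasurable F := by
  have h : ContinuousOn F {0}ᶜ := fun x hx => (hF x hx).continuousWithinAt
  have := h.aestronglyMeasurable (μ := volume) (measurableSet_singleton _).compl
  rwa [restrict_compl_singleton] at this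

lemma ae_ne_zero [Nontrivial (Euc n)] : ∀ᵐ x : Euc n, x ≠ 0 :=
  compl_mem_ae_iff.2 (measure_singleton 0)

variable [Nontrivial (Euc n)] {w : Euc n → ℝ}

/-- A priori integrability of a nonnegative function that is superharmonic in the punctured unit
ball. -/
lemma integrable_div_norm_and_lap (hn : 3 ≤ n) (hw : ∀ x, x ≠ 0 → ContDiffAt ℝ 2 w x)
    (hc : HasCompactSupport w) (hw0 : ∀ x, 0 ≤ w x)
    (hs : ∀ x ∈ ball (0 : Euc n) 1, x ≠ 0 → lap w x ≤ 0) :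
    Integrable (fun x => w x * ‖x‖⁻¹) ∧ Integrable (lap w) := by
  set B := ball (0 : Euc n) 1
  have hB : MeasurableSet B := measurableSet_ball
  have cw : ∀ x, x ≠ 0 → ContinuousAt w x := fun x hx => (hw x hx).continuousAt
  have cl : ∀ x, x ≠ 0 → ContinuousAt (lap w) x := fun x hx => continuousAt_lap (hw x hx)
  have cn : ∀ x : Euc n, x ≠ 0 → ContinuousAt (fun x : Euc n => ‖x‖⁻¹) x := fun x hx =>
    continuousAt_id.norm.inv₀ (norm_ne_zero_iff.2 hx)
  set G : Euc n → ℝ := fun x => w x * ‖x‖⁻¹ + B.indicator (fun x => - lap w x) x with hG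
  have hG0 : ∀ x, x ≠ 0 → 0 ≤ G x := fun x hx => by
    have h1 : 0 ≤ w x * ‖x‖⁻¹ := mul_nonneg (hw0 x) (inv_nonneg.2 (norm_nonneg x))
    have h2 : 0 ≤ B.indicator (fun x => - lap w x) x := by
      by_cases hx1 : x ∈ B
      · simpa [hx1] using hs x hx1 hx
      · simp [hx1]
    exact add_nonneg h1 h2
  have hiw : ∀ r : ℝ, 0 < r → IntegrableOn (fun x => w x * ‖x‖⁻¹) (ball (0 : Euc n) r)ᶜ :=
    fun r hr => integrableOn_compl_ball hc.mul_right (fun x hx => (cw x hx).mul (cn x hx)) hr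
  have hil : ∀ r : ℝ, 0 < r → IntegrableOn (lap w) (ball (0 : Euc n) r)ᶜ :=
    fun r hr => integrableOn_compl_ball hc.lap cl hr
  have hiG : ∀ r : ℝ, 0 < r → IntegrableOn G (ball (0 : Euc n) r)ᶜ :=
    fun r hr => (hiw r hr).add ((hil r hr).neg.indicator hB)
  have hiM : IntegrableOn (fun x => |lap w x| * (1 + ‖x‖) ^ 3) Bᶜ :=
    integrableOn_compl_ball hc.lap.abs.mul_right
      (fun x hx => (cl x hx).abs.mul (by fun_prop)) one_pos
  set M := ∫ x in Bᶜ, |lap w x| * (1 + ‖x‖) ^ 3 with hM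
  have key : ∀ r : ℝ, 0 < r → ∫ x in (ball (0 : Euc n) r)ᶜ, G x ≤ 8 * M := by
    intro r hr
    set ε := r / 2 with hε
    have hε0 : 0 < ε := by positivity
    set φ : Euc n → ℝ := subTest 1 ε
    have hφ : ContDiff ℝ 2 φ := contDiff_subTest 1 hε0
    have hφ0 := subTest_eventually_zero (n := n) 1 hε0
    have hlφ0 : lap φ =ᶠ[𝓝 0] fun _ => 0 := by
      filter_upwards [hφ0.eventuallyEq_nhds] with y hy
      rw [lap_congr hy, lap_const]
    have i1 : Integrable (fun x => w x * lap φ x) :=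
      integrable_of_continuousAt_of_eventually_zero hc.mul_right
        (fun x hx => (cw x hx).mul (continuousAt_lap hφ.contDiffAt))
        (by filter_upwards [hlφ0] with y hy; simp [hy])
    have i2 : Integrable (fun x => lap w x * φ x) :=
      integrable_of_continuousAt_of_eventually_zero hc.lap.mul_right
        (fun x hx => (cl x hx).mul hφ.continuous.continuousAt)
        (by filter_upwards [hφ0] with y hy; simp [φ, hy])
    set H : Euc n → ℝ := fun x => w x * lap φ x + B.indicator (fun x => - (lap w x * φ x)) x
    have iH : Integrable H := i1.add (i2.neg.indicator hB)
    have hH0 : ∀ x, x ≠ 0 → 0 ≤ H x := fun x hx => by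
      have h1 : 0 ≤ w x * lap φ x := mul_nonneg (hw0 x) (le_trans (by positivity)
        (le_lap_subTest hn zero_le_one hε0.le hx))
      have h2 : 0 ≤ B.indicator (fun x => - (lap w x * φ x)) x := by
        by_cases hx1 : x ∈ B
        · have := mul_nonpos_of_nonpos_of_nonneg (hs x hx1 hx) (subTest_nonneg 1 ε x)
          simpa [hx1] using this
        · simp [hx1]
      exact add_nonneg h1 h2
    have hGH : ∀ x ∈ (ball (0 : Euc n) r)ᶜ, G x ≤ 8 * H x := fun x hx => by
      have hxr : r ≤ ‖x‖ := by simpa using hx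
      have hx0 : x ≠ 0 := norm_pos_iff.1 (hr.trans_le hxr)
      have ha : 1 / 2 ≤ max (radialProfile 1 ε x) 0 :=
        (half_le_radialProfile zero_le_one hε0 (by rw [hε]; linarith)).trans (le_max_left _ _)
      have hi : 0 < ‖x‖⁻¹ := inv_pos.2 (norm_pos_iff.2 hx0)
      have h1 : w x * ‖x‖⁻¹ ≤ 8 * (w x * lap φ x) := by
        have h3 : ‖x‖⁻¹ ≤ 8 * lap φ x := by
          have h4 := le_lap_subTest hn zero_le_one hε0.le hx0
          have h5 : 3 * (1 / 2 : ℝ) ^ 2 * ‖x‖⁻¹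
            ≤ 3 * max (radialProfile 1 ε x) 0 ^ 2 * ‖x‖⁻¹ := by gcongr
          rw [one_mul] at h4
          change _ ≤ lap φ x at h4
          linarith
        nlinarith [hw0 x]
      have h2 : B.indicator (fun x => - lap w x) x
          ≤ 8 * B.indicator (fun x => - (lap w x * φ x)) x := by
        by_cases hx1 : x ∈ B
        · have h3 := hs x hx1 hx0
          have h4 : (1 / 2 : ℝ) ^ 3 ≤ φ x := pow_le_pow_left₀ (by norm_num) ha 3
          simp only [hx1, indicator_of_mem]
          nlinarith
        · simp [hx1]
      simp only [hG, H]
      linarith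
    have hG_le : ∫ x in (ball (0 : Euc n) r)ᶜ, G x ≤ ∫ x in (ball (0 : Euc n) r)ᶜ, 8 * H x :=
      setIntegral_mono_on (hiG r hr) (iH.const_mul 8).integrableOn measurableSet_ball.compl hGH
    have hH_compl : ∫ x in (ball (0 : Euc n) r)ᶜ, 8 * H x ≤ ∫ x, 8 * H x :=
      setIntegral_le_integral (iH.const_mul 8)
        (by filter_upwards [ae_ne_zero] with x hx using mul_nonneg (by norm_num) (hH0 x hx))
    have hH_eq : ∫ x, H x = ∫ x in Bᶜ, lap w x * φ x := by
      have e : ∫ x, H x = (∫ x, w x * lap φ x) + ∫ x, B.indicator (fun x => - (lap w x * φ x)) x :=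
        integral_add i1 (i2.neg.indicator hB)
      rw [e, integral_mul_lap_eq hw hc hφ hφ0,
        integral_indicator hB, integral_neg, ← integral_add_compl hB i2]
      ring
    have hH_bound : ∫ x in Bᶜ, lap w x * φ x ≤ M := by
      refine setIntegral_mono_on i2.integrableOn hiM hB.compl fun x _ => ?_
      calc lap w x * φ x ≤ |lap w x| * φ x :=
            mul_le_mul_of_nonneg_right (le_abs_self _) (subTest_nonneg 1 ε x)
        _ ≤ _ := mul_le_mul_of_nonneg_left (by simpa using subTest_le zero_le_one hε0.le x) (abs_nonneg _)
    rw [integral_const_mul (r := 8) (f := H) (μ := volume)] at hH_compl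
    linarith
  have hcov : AECover (volume : Measure (Euc n)) atTop
      (fun k : ℕ => (ball (0 : Euc n) (1 / ((k : ℝ) + 1)))ᶜ) := by
    refine ⟨?_, fun k => measurableSet_ball.compl⟩
    filter_upwards [ae_ne_zero] with x hx
    have := (tendsto_one_div_add_atTop_nhds_zero_nat (𝕜 := ℝ)).eventually
      (gt_mem_nhds (norm_pos_iff.2 hx))
    filter_upwards [this] with k hk
    simpa using hk.le
  have hGint : Integrable G :=
    hcov.integrable_of_integral_bounded_of_nonneg_ae (8 * M)
      (fun k => hiG _ (by positivity)) (by filter_upwards [ae_ne_zero] with x hx using hG0 x hx)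
      (Eventually.of_forall fun k => key _ (by positivity))
  have hmw : AEStronglyMeasurable (fun x => w x * ‖x‖⁻¹) :=
    aestronglyMeasurable_of_continuousAt fun x hx => (cw x hx).mul (cn x hx)
  have I1 : Integrable (fun x => w x * ‖x‖⁻¹) := by
    refine hGint.mono' hmw ?_
    filter_upwards [ae_ne_zero] with x hx
    have h1 : 0 ≤ w x * ‖x‖⁻¹ := mul_nonneg (hw0 x) (inv_nonneg.2 (norm_nonneg x))
    rw [Real.norm_of_nonneg h1]
    have h2 : 0 ≤ B.indicator (fun x => - lap w x) x := by
      by_cases hx1 : x ∈ B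
      · simpa [hx1] using hs x hx1 hx
      · simp [hx1]
    simp only [hG]
    linarith
  refine ⟨I1, ?_⟩
  have I2 : IntegrableOn (lap w) B := by
    have : Integrable (B.indicator fun x => - lap w x) := by
      have := hGint.sub I1
      refine this.congr (ae_of_all _ fun x => ?_)
      simp [hG]
    have := (integrable_indicator_iff hB).1 this
    exact integrable_neg_iff.1 this
  rw [← integrableOn_univ, ← union_compl_self B]
  exact I2.union (hil 1 one_pos)

end Integrability

section Pairing

variable {n : ℕ}

lemma pd_comp_const_smul {θ : Euc n → ℝ} (i : Fin n) (k : ℝ) {y : Euc n}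
    (hθ : DifferentiableAt ℝ θ (k • y)) :
    pd i (fun y => θ (k • y)) y = k * pd i θ (k • y) := by
  have h := (hθ.hasFDerivAt.comp y ((hasFDerivAt_id y).const_smul k)).fderiv
  simp only [Function.comp_def] at h
  simp [pd, h]

lemma lap_comp_const_smul {θ : Euc n → ℝ} (hθ : ContDiff ℝ 2 θ) (k : ℝ) (y : Euc n) :
    lap (fun y => θ (k • y)) y = k ^ 2 * lap θ (k • y) := by
  have h : ContDiffAt ℝ 2 (fun y => θ (k • y)) y :=
    (hθ.comp (contDiff_const_smul k)).contDiffAt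
  rw [lap_eq_sum_pd h, lap_eq_sum_pd hθ.contDiffAt, Finset.mul_sum]
  refine Finset.sum_congr rfl fun i _ => ?_
  have e : pd i (fun y => θ (k • y)) = fun y => k * pd i θ (k • y) := by
    ext y
    exact pd_comp_const_smul i k (hθ.differentiable (by norm_num) _)
  have hd := differentiableAt_pd i (hθ.contDiffAt (x := k • y))
  have hd' : DifferentiableAt ℝ (fun y => pd i θ (k • y)) y :=
    hd.comp y (differentiableAt_id.const_smul k)
  rw [e, pd_mul i (differentiableAt_const k) hd', pd_comp_const_smul i k hd]
  simp [pd]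
  ring

lemma lap_add_const {φ : Euc n → ℝ} {y : Euc n} (c : ℝ)
    (hφ : ContDiffAt ℝ 2 φ y) : lap (fun y => φ y + c) y = lap φ y := by
  rw [lap_add hφ contDiffAt_const, lap_const, add_zero]

lemma exists_norm_mul_abs_le {F : Euc n → ℝ} (hF : Continuous F) (hc : HasCompactSupport F)
    (k : ℕ) : ∃ C, 0 ≤ C ∧ ∀ z, ‖z‖ ^ k * |F z| ≤ C := by
  obtain ⟨C, hC⟩ := (hc.mul_left (f := fun z : Euc n => ‖z‖ ^ k)).exists_bound_of_continuous
    (by fun_prop)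
  refine ⟨C, (norm_nonneg _).trans (hC 0), fun z => ?_⟩
  have := hC z
  simpa [abs_mul] using this

variable [Nontrivial (Euc n)] {w : Euc n → ℝ}

/-- The distributional Laplacian of a singular function, up to a multiple of the Dirac mass. -/
lemma integral_mul_lap_eq_sub (hw : ∀ x, x ≠ 0 → ContDiffAt ℝ 2 w x)
    (hc : HasCompactSupport w) (hi : Integrable (fun x => w x * ‖x‖⁻¹))
    (hl : Integrable (lap w)) {φ : Euc n → ℝ} (hφ : ContDiff ℝ 2 φ) :
    ∫ x, w x * lap φ x = (∫ x, lap w x * φ x) - φ 0 * ∫ x, lap w x := by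
  obtain ⟨R, hR0, hR⟩ : ∃ R : ℝ, 0 < R ∧ tsupport w ⊆ closedBall 0 R := by
    obtain ⟨R, hR⟩ := hc.isCompact.isBounded.subset_closedBall 0
    exact ⟨max R 1, by positivity, hR.trans (closedBall_subset_closedBall (le_max_left _ _))⟩
  have hKc : IsCompact (closedBall (0 : Euc n) R) := isCompact_closedBall 0 R
  set ψ : Euc n → ℝ := fun y => φ y + (-φ 0) with hψdef
  have hψ : ContDiff ℝ 2 ψ := hφ.add contDiff_const
  have hlψ : ∀ y, lap ψ y = lap φ y := fun y =>
    lap_add_const _ hφ.contDiffAt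
  -- bounds for the test function on a ball containing the support
  obtain ⟨L, hL⟩ : ∃ L, ∀ y ∈ closedBall (0 : Euc n) R, ‖fderiv ℝ ψ y‖ ≤ L :=
    hKc.exists_bound_of_continuousOn (hψ.continuous_fderiv (by norm_num)).continuousOn
  have hL0 : 0 ≤ L := (norm_nonneg _).trans (hL 0 (mem_closedBall_self hR0.le))
  have hψL : ∀ y ∈ closedBall (0 : Euc n) R, |ψ y| ≤ L * ‖y‖ := fun y hy => by
    have := (convex_closedBall (0 : Euc n) R).norm_image_sub_le_of_norm_fderiv_le (𝕜 := ℝ)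
      (fun z _ => hψ.differentiable (by norm_num) z) hL (mem_closedBall_self hR0.le) hy
    simpa [hψdef] using this
  have hpL : ∀ i, ∀ y ∈ closedBall (0 : Euc n) R, |pd i ψ y| ≤ L := fun i y hy => by
    have := (fderiv ℝ ψ y).le_opNorm (EuclideanSpace.single i 1)
    rw [PiLp.norm_single, norm_one, mul_one] at this
    exact this.trans (hL y hy)
  have hlapc : Continuous (lap φ) := continuous_iff_continuousAt.2 fun y =>
    continuousAt_lap hφ.contDiffAt
  obtain ⟨P, hP⟩ : ∃ P, ∀ y ∈ closedBall (0 : Euc n) R, ‖lap φ y‖ ≤ P :=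
    hKc.exists_bound_of_continuousOn hlapc.continuousOn
  have hP0 : 0 ≤ P := (norm_nonneg _).trans (hP 0 (mem_closedBall_self hR0.le))
  -- the cutoff
  let θ : ContDiffBump (0 : Euc n) := ⟨1, 2, one_pos, one_lt_two⟩
  have hθ : ContDiff ℝ 2 (θ : Euc n → ℝ) := θ.contDiff
  have hθc : HasCompactSupport (θ : Euc n → ℝ) := θ.hasCompactSupport
  choose D hD0 hD using fun i : Fin n => exists_norm_mul_abs_le
    (F := pd i θ) (continuous_iff_continuousAt.2 fun y => continuousAt_pd i
      (hθ.contDiffAt.of_le (by norm_num))) (hθc.pd i) 1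
  obtain ⟨Q, hQ0, hQ⟩ := exists_norm_mul_abs_le
    (F := lap θ) (continuous_iff_continuousAt.2 fun y => continuousAt_lap hθ.contDiffAt)
      hθc.lap 2
  let k : ℕ → ℝ := fun j => (j : ℝ) + 1
  have hk : ∀ j, 0 < k j := fun j => by positivity
  have hktop : Tendsto k atTop atTop := tendsto_atTop_add_const_right _ _ tendsto_natCast_atTop_atTop
  let η : ℕ → Euc n → ℝ := fun j y => 1 + (-1) * θ (k j • y)
  have hη : ∀ j, ContDiff ℝ 2 (η j) := fun j =>
    contDiff_const.add (contDiff_const.mul (hθ.comp (contDiff_const_smul (k j))))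
  have hη01 : ∀ j y, |η j y| ≤ 1 := fun j y => by
    have h1 := θ.nonneg (x := k j • y)
    have h2 := θ.le_one (x := k j • y)
    rw [abs_le]
    constructor <;> simp only [η] <;> linarith
  have hη0 : ∀ j, η j =ᶠ[𝓝 0] fun _ => 0 := fun j => by
    have hcont : Tendsto (fun y : Euc n => k j • y) (𝓝 0) (𝓝 0) := by
      have : Continuous fun y : Euc n => k j • y := by fun_prop
      simpa using this.tendsto 0
    filter_upwards [hcont.eventually θ.eventuallyEq_one] with y hy
    simp [η, hy]
  have hη1 : ∀ y : Euc n, y ≠ 0 → ∀ᶠ j in atTop, η j =ᶠ[𝓝 y] fun _ => 1 := fun y hy => by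
    have hy' := norm_pos_iff.2 hy
    filter_upwards [hktop.eventually_gt_atTop (2 / ‖y‖)] with j hj
    have hgt : 2 < ‖k j • y‖ := by
      rw [norm_smul, Real.norm_of_nonneg (hk j).le]
      rwa [div_lt_iff₀ hy'] at hj
    have hcont : Continuous fun y : Euc n => ‖k j • y‖ := by fun_prop
    filter_upwards [hcont.continuousAt.eventually (lt_mem_nhds hgt)] with z hz
    have : θ (k j • z) = 0 := θ.zero_of_le_dist (by simpa using hz.le)
    simp [η, this]
  have hpη : ∀ j i y, pd i (η j) y = - (k j * pd i θ (k j • y)) := fun j i y => by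
    have hd : DifferentiableAt ℝ (fun y => θ (k j • y)) y :=
      (hθ.comp (contDiff_const_smul (k j))).differentiable (by norm_num) y
    have hd' : DifferentiableAt ℝ (fun y => -1 * θ (k j • y)) y := hd.const_mul _
    simp only [η]
    rw [pd_add i (differentiableAt_const _) hd',
      pd_mul i (differentiableAt_const _) hd,
      pd_comp_const_smul i _ (hθ.differentiable (by norm_num) _)]
    simp [pd]
  have hlη : ∀ j y, lap (η j) y = - (k j ^ 2 * lap θ (k j • y)) := fun j y => by
    have hd : ContDiffAt ℝ 2 (fun y => θ (k j • y)) y :=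
      (hθ.comp (contDiff_const_smul (k j))).contDiffAt
    have hd' : ContDiffAt ℝ 2 (fun y => -1 * θ (k j • y)) y := contDiffAt_const.mul hd
    simp only [η]
    rw [lap_add contDiffAt_const hd', lap_const, lap_const_mul _ hd,
      lap_comp_const_smul hθ]
    ring
  have bpη : ∀ j i y, y ≠ 0 → |pd i (η j) y| ≤ D i * ‖y‖⁻¹ := fun j i y hy => by
    have hy' := norm_pos_iff.2 hy
    have h1 := hD i (k j • y)
    rw [hpη, abs_neg, abs_mul, abs_of_pos (hk j), ← div_eq_mul_inv, le_div_iff₀ hy']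
    rw [pow_one, norm_smul, Real.norm_of_nonneg (hk j).le] at h1
    linarith
  have blη : ∀ j y, y ≠ 0 → |lap (η j) y| ≤ Q * ‖y‖⁻¹ ^ 2 := fun j y hy => by
    have hy' := norm_pos_iff.2 hy
    have h1 := hQ (k j • y)
    rw [hlη, abs_neg, abs_mul, abs_of_pos (pow_pos (hk j) 2), inv_pow, ← div_eq_mul_inv,
      le_div_iff₀ (by positivity)]
    rw [norm_smul, Real.norm_of_nonneg (hk j).le] at h1
    linarith
  -- the test functions vanishing near the origin
  let Φ : ℕ → Euc n → ℝ := fun j y => η j y * ψ y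
  have hΦ : ∀ j, ContDiff ℝ 2 (Φ j) := fun j => (hη j).mul hψ
  have hΦ0 : ∀ j, Φ j =ᶠ[𝓝 0] fun _ => 0 := fun j => by
    filter_upwards [hη0 j] with y hy
    simp [Φ, hy]
  have hgreen : ∀ j, ∫ x, w x * lap (Φ j) x = ∫ x, lap w x * Φ j x := fun j =>
    integral_mul_lap_eq hw hc (hΦ j) (hΦ0 j)
  have hzero : ∀ y, y ∉ closedBall (0 : Euc n) R → w y = 0 := fun y hy =>
    image_eq_zero_of_notMem_tsupport fun h => hy (hR h)
  have hzero' : ∀ y, y ∉ closedBall (0 : Euc n) R → lap w y = 0 := fun y hy => by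
    have h0 : w =ᶠ[𝓝 y] fun _ => 0 := notMem_tsupport_iff_eventuallyEq.1 fun h => hy (hR h)
    rw [lap_congr h0, lap_const]
  have lim1 : Tendsto (fun j => ∫ x, w x * lap (Φ j) x) atTop (𝓝 (∫ x, w x * lap φ x)) := by
    refine tendsto_integral_of_dominated_convergence
      (fun x => (P * R + 2 * (∑ i, D i * L) + L * Q) * |w x * ‖x‖⁻¹|) ?_ (hi.abs.const_mul _) ?_ ?_
    · intro j
      exact aestronglyMeasurable_of_continuousAt fun x hx =>
        (hw x hx).continuousAt.mul (continuousAt_lap (hΦ j).contDiffAt)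
    · intro j
      filter_upwards [ae_ne_zero] with y hy
      by_cases hyR : y ∈ closedBall (0 : Euc n) R
      · have hy' := norm_pos_iff.2 hy
        have hyR' : ‖y‖ ≤ R := by simpa using hyR
        have e : lap (Φ j) y = _ := lap_mul (hη j).contDiffAt hψ.contDiffAt
        have hb : |lap (Φ j) y| ≤ (P * R + 2 * (∑ i, D i * L) + L * Q) * ‖y‖⁻¹ := by
          rw [e]
          have t1 : |η j y * lap ψ y| ≤ P * R * ‖y‖⁻¹ := by
            rw [abs_mul, hlψ]
            calc |η j y| * |lap φ y| ≤ 1 * P :=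
                  mul_le_mul (hη01 j y) (hP y hyR) (abs_nonneg _) zero_le_one
              _ ≤ P * R * ‖y‖⁻¹ := by
                  rw [one_mul, ← div_eq_mul_inv, le_div_iff₀ hy']
                  exact mul_le_mul_of_nonneg_left hyR' hP0
          have t2 : |2 * ∑ i, pd i (η j) y * pd i ψ y| ≤ 2 * (∑ i, D i * L) * ‖y‖⁻¹ := by
            rw [abs_mul, abs_two, mul_assoc]
            refine mul_le_mul_of_nonneg_left ?_ zero_le_two
            rw [Finset.sum_mul]
            refine (Finset.abs_sum_le_sum_abs _ _).trans (Finset.sum_le_sum fun i _ => ?_)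
            rw [abs_mul]
            calc |pd i (η j) y| * |pd i ψ y| ≤ (D i * ‖y‖⁻¹) * L :=
                  mul_le_mul (bpη j i y hy) (hpL i y hyR) (abs_nonneg _)
                    (mul_nonneg (hD0 i) (by positivity))
              _ = _ := by ring
          have t3 : |ψ y * lap (η j) y| ≤ L * Q * ‖y‖⁻¹ := by
            rw [abs_mul]
            calc |ψ y| * |lap (η j) y| ≤ (L * ‖y‖) * (Q * ‖y‖⁻¹ ^ 2) :=
                  mul_le_mul (hψL y hyR) (blη j y hy) (abs_nonneg _) (by positivity)
              _ = _ := by field_simp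
          have := abs_add_le (η j y * lap ψ y + 2 * ∑ i, pd i (η j) y * pd i ψ y)
            (ψ y * lap (η j) y)
          have := abs_add_le (η j y * lap ψ y) (2 * ∑ i, pd i (η j) y * pd i ψ y)
          linarith
        rw [Real.norm_eq_abs, abs_mul, abs_mul, abs_of_nonneg (inv_nonneg.2 hy'.le)]
        have := mul_le_mul_of_nonneg_left hb (abs_nonneg (w y))
        linarith
      · simp [hzero y hyR]
    · filter_upwards [ae_ne_zero] with y hy
      refine tendsto_const_nhds.congr' ?_
      filter_upwards [hη1 y hy] with j hj
      have : Φ j =ᶠ[𝓝 y] ψ := by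
        filter_upwards [hj] with z hz
        simp [Φ, hz]
      rw [lap_congr this, hlψ]
  have lim2 : Tendsto (fun j => ∫ x, lap w x * Φ j x) atTop (𝓝 (∫ x, lap w x * ψ x)) := by
    refine tendsto_integral_of_dominated_convergence
      (fun x => L * R * |lap w x|) ?_ (hl.abs.const_mul _) ?_ ?_
    · intro j
      exact hl.aestronglyMeasurable.mul (hΦ j).continuous.aestronglyMeasurable
    · refine fun j => ae_of_all _ fun y => ?_
      by_cases hyR : y ∈ closedBall (0 : Euc n) R
      · have hyR' : ‖y‖ ≤ R := by simpa using hyR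
        have : |Φ j y| ≤ L * R := by
          simp only [Φ, abs_mul]
          calc |η j y| * |ψ y| ≤ 1 * (L * R) :=
                mul_le_mul (hη01 j y) ((hψL y hyR).trans (by gcongr)) (abs_nonneg _) zero_le_one
            _ = _ := one_mul _
        rw [Real.norm_eq_abs, abs_mul]
        have := mul_le_mul_of_nonneg_left this (abs_nonneg (lap w y))
        linarith
      · simp [hzero' y hyR]
    · filter_upwards [ae_ne_zero] with y hy
      refine tendsto_const_nhds.congr' ?_
      filter_upwards [hη1 y hy] with j hj
      simp [Φ, hj.eq_of_nhds]
  have hfin := tendsto_nhds_unique lim1 (lim2.congr fun j => (hgreen j).symm)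
  rw [hfin]
  have i1 : Integrable (fun x => lap w x * φ x) := by
    obtain ⟨B, hB⟩ : ∃ B, ∀ y ∈ closedBall (0 : Euc n) R, ‖φ y‖ ≤ B :=
      hKc.exists_bound_of_continuousOn hφ.continuous.continuousOn
    refine (hl.abs.const_mul B).mono'
      (hl.aestronglyMeasurable.mul hφ.continuous.aestronglyMeasurable) (ae_of_all _ fun y => ?_)
    by_cases hyR : y ∈ closedBall (0 : Euc n) R
    · rw [Real.norm_eq_abs, abs_mul]
      have := mul_le_mul_of_nonneg_left (hB y hyR) (abs_nonneg (lap w y))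
      rw [Real.norm_eq_abs] at this
      linarith
    · simp [hzero' y hyR]
  rw [← integral_const_mul, ← integral_sub i1 (hl.const_mul _)]
  refine integral_congr_ae (ae_of_all _ fun y => ?_)
  simp only [hψdef]
  ring

lemma integral_lap_nonneg (hn : 3 ≤ n) (hw : ∀ x, x ≠ 0 → ContDiffAt ℝ 2 w x)
    (hc : HasCompactSupport w) (hw0 : ∀ x, 0 ≤ w x) (hl : Integrable (lap w)) :
    0 ≤ ∫ x, lap w x := by
  let ε : ℕ → ℝ := fun j => 1 / ((j : ℝ) + 1)
  have hε : ∀ j, 0 < ε j := fun j => by positivity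
  have hlim : Tendsto (fun j => ∫ x, lap w x * subTest 0 (ε j) x) atTop (𝓝 (∫ x, lap w x)) := by
    refine tendsto_integral_of_dominated_convergence (fun x => |lap w x|) ?_ hl.abs ?_ ?_
    · exact fun j => hl.aestronglyMeasurable.mul
        (contDiff_subTest 0 (hε j)).continuous.aestronglyMeasurable
    · refine fun j => ae_of_all _ fun y => ?_
      have h1 := subTest_nonneg 0 (ε j) y
      have h2 : subTest 0 (ε j) y ≤ 1 := by
        simpa using subTest_le (b := 0) le_rfl (hε j).le y
      rw [Real.norm_eq_abs, abs_mul, abs_of_nonneg h1]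
      exact mul_le_of_le_one_right (abs_nonneg _) h2
    · filter_upwards [ae_ne_zero] with y hy
      have hy' := norm_pos_iff.2 hy
      have h0 : Tendsto ε atTop (𝓝 0) := tendsto_one_div_add_atTop_nhds_zero_nat
      have h1 : Tendsto (fun j => subTest 0 (ε j) y) atTop (𝓝 1) := by
        have hcont : Continuous fun e : ℝ => subTest 0 e y := by
          unfold subTest radialProfile cubePos
          fun_prop
        have := (hcont.tendsto 0).comp h0
        have e : subTest 0 0 y = 1 := by
          simp [subTest, radialProfile, cubePos, hy]
        rwa [e] at this
      simpa using h1.const_mul (lap w y)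
  refine ge_of_tendsto' hlim fun j => ?_
  rw [← integral_mul_lap_eq hw hc (contDiff_subTest 0 (hε j)) (subTest_eventually_zero 0 (hε j))]
  refine integral_nonneg_of_ae ?_
  filter_upwards [ae_ne_zero] with y hy
  exact mul_nonneg (hw0 y) (le_trans (by simp) (le_lap_subTest hn le_rfl (hε j).le hy))

end Pairing

section RieszKernel

variable {n : ℕ} {s : ℝ}

lemma locallyIntegrable_rpow_neg_norm (hn : 1 ≤ n) (hs : s < n) :
    LocallyIntegrable (fun z : Euc n => ‖z‖ ^ (-s)) := by
  refine locallyIntegrable_of_norm_le_rpow (C := 1) (α := s) (by simpa using hn) (by simpa using hs)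
    (ae_of_all _ fun z => ?_) (measurable_norm.pow_const _).aestronglyMeasurable
  rw [one_mul, Real.norm_of_nonneg (by positivity)]

lemma integrableOn_ball_rpow_neg_norm (hn : 1 ≤ n) (hs : s < n) (r : ℝ) :
    IntegrableOn (fun z : Euc n => ‖z‖ ^ (-s)) (ball 0 r) :=
  ((locallyIntegrable_rpow_neg_norm hn hs).integrableOn_isCompact
    (isCompact_closedBall 0 r)).mono_set ball_subset_closedBall

lemma integrableOn_ball_rpow_neg_norm_sub (hn : 1 ≤ n) (hs : s < n) (x : Euc n) (r : ℝ) :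
    IntegrableOn (fun y : Euc n => ‖x - y‖ ^ (-s)) (ball x r) := by
  have h := ((volume.measurePreserving_sub_left x).integrableOn_comp_preimage
    (MeasurableEquiv.subLeft x).measurableEmbedding).2 (integrableOn_ball_rpow_neg_norm hn hs r)
  have e : (fun y => x - y) ⁻¹' ball (0 : Euc n) r = ball x r := by
    ext y
    simp [dist_eq_norm, norm_sub_rev]
  rwa [e] at h

lemma integrableOn_ball_zero_rpow_neg_norm_sub (hn : 1 ≤ n) (hs : s < n) (x : Euc n) (r : ℝ) :
    IntegrableOn (fun y : Euc n => ‖x - y‖ ^ (-s)) (ball 0 r) := by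
  refine (integrableOn_ball_rpow_neg_norm_sub hn hs x (r + ‖x‖)).mono_set fun y hy => ?_
  rw [mem_ball_zero_iff] at hy
  rw [mem_ball, dist_eq_norm]
  exact (norm_sub_le y x).trans_lt (by linarith)

lemma setIntegral_rpow_neg_norm_sub_le (hn : 1 ≤ n) (hs : s < n) {x : Euc n} {r R : ℝ}
    (hx : ‖x‖ ≤ R) :
    ∫ y in ball (0 : Euc n) r, ‖x - y‖ ^ (-s) ≤ ∫ z in ball (0 : Euc n) (r + R), ‖z‖ ^ (-s) := by
  have h := (volume.measurePreserving_sub_left x).setIntegral_preimage_emb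
    (MeasurableEquiv.subLeft x).measurableEmbedding (fun z => ‖z‖ ^ (-s)) (ball (0 : Euc n) (r + R))
  rw [← h]
  have e : (fun y => x - y) ⁻¹' ball (0 : Euc n) (r + R) = ball x (r + R) := by
    ext y
    simp [dist_eq_norm, norm_sub_rev]
  rw [e]
  refine setIntegral_mono_set (integrableOn_ball_rpow_neg_norm_sub hn hs x _)
    (ae_of_all _ fun y => by positivity) (Eventually.of_forall fun y hy => ?_)
  replace hy : ‖y‖ < r := mem_ball_zero_iff.1 hy
  change dist y x < _
  rw [dist_eq_norm]
  exact (norm_sub_le y x).trans_lt (by linarith)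

lemma integrable_mul_rpow_neg_norm_sub (hn : 1 ≤ n) (hs0 : 0 ≤ s) (hs : s < n) {F : Euc n → ℝ}
    (hF : Integrable F) {x : Euc n} {r C : ℝ} (hr : 0 < r) (hC : ∀ y ∈ ball x r, |F y| ≤ C) :
    Integrable (fun y => F y * ‖x - y‖ ^ (-s)) := by
  have hm : AEStronglyMeasurable (fun y => F y * ‖x - y‖ ^ (-s)) :=
    hF.aestronglyMeasurable.mul
      ((measurable_const.sub measurable_id).norm.pow_const _).aestronglyMeasurable
  rw [← integrableOn_univ, ← union_compl_self (ball x r)]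
  refine IntegrableOn.union ?_ ?_
  · refine ((integrableOn_ball_rpow_neg_norm_sub hn hs x r).const_mul C).mono' hm.restrict ?_
    filter_upwards [ae_restrict_mem measurableSet_ball] with y hy
    rw [norm_mul, Real.norm_of_nonneg (by positivity : 0 ≤ ‖x - y‖ ^ (-s))]
    exact mul_le_mul_of_nonneg_right (hC y hy) (by positivity)
  · refine (hF.abs.integrableOn.const_mul (r ^ (-s))).mono' hm.restrict ?_
    filter_upwards [ae_restrict_mem measurableSet_ball.compl] with y hy
    have hy' : r ≤ ‖x - y‖ := by simpa [dist_eq_norm, norm_sub_rev] using hy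
    rw [norm_mul, Real.norm_of_nonneg (by positivity : 0 ≤ ‖x - y‖ ^ (-s)), mul_comm]
    exact mul_le_mul_of_nonneg_right
      (Real.rpow_le_rpow_of_nonpos hr hy' (by linarith)) (abs_nonneg _)

end RieszKernel

section Newton

variable {n : ℕ} {w : Euc n → ℝ}

/-- The mass of the profile whose rescalings approximate the Dirac mass. -/
noncomputable def peakMass (n : ℕ) : ℝ := ∫ z : Euc n, (1 + ‖z‖ ^ 2) ^ (-((n : ℝ) + 2) / 2)

lemma integrable_peak : Integrable fun z : Euc n => (1 + ‖z‖ ^ 2) ^ (-((n : ℝ) + 2) / 2) :=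
  integrable_rpow_neg_one_add_norm_sq (by simp)

lemma peakMass_pos : 0 < peakMass n := by
  rw [peakMass, integral_pos_iff_support_of_nonneg (fun z => by positivity) integrable_peak]
  have : Function.support (fun z : Euc n => (1 + ‖z‖ ^ 2) ^ (-((n : ℝ) + 2) / 2)) = univ := by
    ext z
    simp only [Function.mem_support, mem_univ, iff_true]
    positivity
  rw [this]
  exact Measure.measure_univ_pos.2 (NeZero.ne _)

/-- The normalizing constant of the Newtonian potential. -/
noncomputable def newtonConst (n : ℕ) : ℝ := n * (n - 2) * peakMass n

lemma newtonConst_pos (hn : 3 ≤ n) : 0 < newtonConst n := by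
  have h3 : (3 : ℝ) ≤ n := by exact_mod_cast hn
  have := peakMass_pos (n := n)
  unfold newtonConst
  have : 0 < (n : ℝ) - 2 := by linarith
  positivity

lemma tendsto_integral_peak {x : Euc n} (hwi : Integrable w) (hwx : ContinuousAt w x) :
    Tendsto (fun c : ℝ => ∫ y, w y *
      ((c ^ 2)⁻¹ * (‖y - x‖ ^ 2 + (c ^ 2)⁻¹) ^ (-((n : ℝ) + 2) / 2))) atTop
      (𝓝 (peakMass n * w x)) := by
  have hM := peakMass_pos (n := n)
  have h := tendsto_integral_comp_smul_smul_of_integrable' (μ := volume) (x₀ := x) (g := w)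
    (φ := fun z : Euc n => (peakMass n)⁻¹ * (1 + ‖z‖ ^ 2) ^ (-((n : ℝ) + 2) / 2))
    (fun z => by positivity)
    (by rw [integral_const_mul, ← peakMass, inv_mul_cancel₀ hM.ne']) ?_ hwi hwx
  · refine (h.const_mul (peakMass n)).congr' ?_
    filter_upwards [eventually_gt_atTop 0] with c hc
    rw [← integral_const_mul]
    refine integral_congr_ae (ae_of_all _ fun y => ?_)
    have e : 1 + ‖c • (x - y)‖ ^ 2 = c ^ 2 * (‖y - x‖ ^ 2 + (c ^ 2)⁻¹) := by
      rw [norm_smul, Real.norm_of_nonneg hc.le, norm_sub_rev]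
      field_simp
      ring
    have e2 : (c ^ 2) ^ (-((n : ℝ) + 2) / 2) = (c ^ n)⁻¹ * (c ^ 2)⁻¹ := by
      rw [← Real.rpow_natCast c 2, ← Real.rpow_mul hc.le, ← Real.rpow_natCast c n,
        ← Real.rpow_neg hc.le, ← Real.rpow_neg hc.le, ← Real.rpow_add hc]
      congr 1
      push_cast
      ring
    simp only [smul_eq_mul, finrank_euclideanSpace, Fintype.card_fin]
    rw [e, Real.mul_rpow (by positivity) (by positivity), e2]
    field_simp
  · have h1 : Tendsto (fun z : Euc n => (peakMass n)⁻¹ * ‖z‖ ^ (-2 : ℝ)) (Bornology.cobounded _)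
        (𝓝 0) := by
      have := (tendsto_rpow_neg_atTop (y := 2) two_pos).comp
        (tendsto_norm_cobounded_atTop (E := Euc n))
      simpa using this.const_mul (peakMass n)⁻¹
    refine squeeze_zero' (Eventually.of_forall fun z => by positivity) ?_ h1
    filter_upwards [tendsto_norm_cobounded_atTop.eventually_gt_atTop 0] with z hz
    simp only [finrank_euclideanSpace, Fintype.card_fin]
    rw [mul_left_comm]
    refine mul_le_mul_of_nonneg_left ?_ (by positivity)
    have h2 : (1 + ‖z‖ ^ 2) ^ (-((n : ℝ) + 2) / 2) ≤ (‖z‖ ^ 2) ^ (-((n : ℝ) + 2) / 2) :=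
      Real.rpow_le_rpow_of_nonpos (by positivity) (by linarith)
        (by have : (0 : ℝ) ≤ n := n.cast_nonneg
            linarith)
    calc ‖z‖ ^ n * (1 + ‖z‖ ^ 2) ^ (-((n : ℝ) + 2) / 2)
        ≤ ‖z‖ ^ n * (‖z‖ ^ 2) ^ (-((n : ℝ) + 2) / 2) := by gcongr
      _ = ‖z‖ ^ (-2 : ℝ) := by
        rw [← Real.rpow_natCast _ 2, ← Real.rpow_mul hz.le, ← Real.rpow_natCast _ n,
          ← Real.rpow_add hz]
        congr 1
        push_cast
        ring

variable [Nontrivial (Euc n)]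

lemma ae_ne (x : Euc n) : ∀ᵐ y : Euc n, y ≠ x :=
  compl_mem_ae_iff.2 (measure_singleton x)

lemma integrable_of_integrable_div_norm (hw : ∀ x, x ≠ 0 → ContDiffAt ℝ 2 w x)
    (hc : HasCompactSupport w) (hi : Integrable (fun x => w x * ‖x‖⁻¹)) : Integrable w := by
  obtain ⟨R, hR⟩ := hc.isCompact.isBounded.subset_closedBall 0
  refine (hi.abs.const_mul R).mono'
    (aestronglyMeasurable_of_continuousAt fun x hx => (hw x hx).continuousAt) ?_
  filter_upwards [ae_ne_zero] with y hy
  have hy' := norm_pos_iff.2 hy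
  by_cases h : y ∈ tsupport w
  · have hyR : ‖y‖ ≤ R := by simpa using hR h
    rw [Real.norm_eq_abs, abs_mul, abs_of_nonneg (inv_nonneg.2 hy'.le), mul_left_comm]
    refine le_mul_of_one_le_right (abs_nonneg _) ?_
    rwa [← div_eq_mul_inv, one_le_div hy']
  · simp [image_eq_zero_of_notMem_tsupport h]

/-- Newtonian representation of a compactly supported function with a singularity at `0`. -/
lemma newtonConst_mul_eq (hn : 3 ≤ n) (hw : ∀ x, x ≠ 0 → ContDiffAt ℝ 2 w x)
    (hc : HasCompactSupport w) (hi : Integrable (fun x => w x * ‖x‖⁻¹))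
    (hl : Integrable (lap w)) {x : Euc n} (hx : x ≠ 0)
    (hk : Integrable fun y => lap w y * ‖x - y‖ ^ (-((n : ℝ) - 2))) :
    newtonConst n * w x = ‖x‖ ^ (-((n : ℝ) - 2)) * (∫ y, lap w y) -
      ∫ y, lap w y * ‖x - y‖ ^ (-((n : ℝ) - 2)) := by
  have h3 : (3 : ℝ) ≤ n := by exact_mod_cast hn
  let p : ℝ := 1 - (n : ℝ) / 2
  have hp : p ≤ 0 := by simp only [p]; linarith
  have hwi := integrable_of_integrable_div_norm hw hc hi
  have h0 : Tendsto (fun c : ℝ => (c ^ 2)⁻¹) atTop (𝓝 0) :=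
    tendsto_inv_atTop_zero.comp (tendsto_pow_atTop two_ne_zero)
  have hkey : ∀ z : Euc n, (‖z‖ ^ 2) ^ p = ‖z‖ ^ (-((n : ℝ) - 2)) := fun z => by
    rw [← Real.rpow_natCast _ 2, ← Real.rpow_mul (norm_nonneg _)]
    congr 1
    simp only [p]
    push_cast
    ring
  have hpt : ∀ y, y ≠ x → Tendsto (fun c : ℝ => (‖y - x‖ ^ 2 + (c ^ 2)⁻¹) ^ p) atTop
      (𝓝 (‖x - y‖ ^ (-((n : ℝ) - 2)))) := fun y hy => by
    have hy' : 0 < ‖y - x‖ := norm_pos_iff.2 (sub_ne_zero.2 hy)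
    have h1 := (h0.const_add (‖y - x‖ ^ 2)).rpow_const (p := p) (Or.inl (by positivity))
    rw [add_zero, hkey] at h1
    rwa [norm_sub_rev x y]
  have hcontD : ∀ c : ℝ, 0 < c → ContDiff ℝ 2 fun y : Euc n => (‖y - x‖ ^ 2 + (c ^ 2)⁻¹) ^ p :=
    fun c hc => contDiff_iff_contDiffAt.2 fun y =>
      contDiffAt_rpow_norm_sub_sq_add x y _ p (by positivity)
  have lim1 := (tendsto_integral_peak hwi (hw x hx).continuousAt).const_mul (2 * p * n)
  have lim2 : Tendsto (fun c : ℝ => ∫ y, lap w y * (‖y - x‖ ^ 2 + (c ^ 2)⁻¹) ^ p) atTop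
      (𝓝 (∫ y, lap w y * ‖x - y‖ ^ (-((n : ℝ) - 2)))) := by
    refine tendsto_integral_filter_of_dominated_convergence _ ?_ ?_ hk.abs ?_
    · filter_upwards [eventually_gt_atTop 0] with c hc
      exact hl.aestronglyMeasurable.mul (hcontD c hc).continuous.aestronglyMeasurable
    · filter_upwards [eventually_gt_atTop 0] with c hc
      filter_upwards [ae_ne x] with y hy
      have hy' : 0 < ‖y - x‖ := norm_pos_iff.2 (sub_ne_zero.2 hy)
      rw [Real.norm_eq_abs, abs_mul, abs_mul]
      refine mul_le_mul_of_nonneg_left ?_ (abs_nonneg _)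
      rw [abs_of_nonneg (by positivity), abs_of_nonneg (by positivity), ← hkey, norm_sub_rev x y]
      have : 0 < (c ^ 2)⁻¹ := by positivity
      exact Real.rpow_le_rpow_of_nonpos (by positivity) (by linarith) hp
    · filter_upwards [ae_ne x] with y hy
      exact (hpt y hy).const_mul _
  have lim3 := (hpt 0 hx.symm).mul_const (∫ y, lap w y)
  have heq := tendsto_nhds_unique (lim1.congr' ?_) (lim2.sub lim3)
  · rw [sub_zero] at heq
    have : 2 * p * n * (peakMass n * w x) = - (newtonConst n * w x) := by
      simp only [p, newtonConst]
      ring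
    linarith
  · filter_upwards [eventually_gt_atTop 0] with c hc'
    rw [← integral_const_mul]
    have := integral_mul_lap_eq_sub hw hc hi hl (hcontD c hc')
    rw [← this]
    refine integral_congr_ae (ae_of_all _ fun y => ?_)
    have hpos : 0 < ‖y - x‖ ^ 2 + (c ^ 2)⁻¹ := by positivity
    simp only
    rw [lap_rpow_norm_sub_sq_add x y _ p hpos]
    have e : p - 2 = -((n : ℝ) + 2) / 2 := by simp only [p]; ring
    rw [e]
    simp only [p]
    ring

end Newton

section HarmonicPart

variable {n : ℕ} {F G : Euc n → ℝ}

lemma contDiff_pd (i : Fin n) (hG : ContDiff ℝ 2 G) : ContDiff ℝ 1 (pd i G) :=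
  contDiff_iff_contDiffAt.2 fun _ => contDiffAt_pd i hG.contDiffAt

lemma contDiff_integral_mul_comp_sub (hF : Integrable F) (hG : ContDiff ℝ 2 G)
    (hc : HasCompactSupport G) : ContDiff ℝ 2 fun x => ∫ y, F y * G (x - y) :=
  hc.contDiff_convolution_right (ContinuousLinearMap.mul ℝ ℝ) hF.locallyIntegrable hG

lemma integrable_mul_comp_sub (hF : Integrable F) (hG : Continuous G)
    (hc : HasCompactSupport G) (x : Euc n) : Integrable fun y => F y * G (x - y) :=
  hc.convolutionExists_right (ContinuousLinearMap.mul ℝ ℝ) hF.locallyIntegrable hG x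

lemma pd_integral_mul_comp_sub (i : Fin n) (hF : Integrable F) (hG : ContDiff ℝ 1 G)
    (hc : HasCompactSupport G) :
    pd i (fun x => ∫ y, F y * G (x - y)) = fun x => ∫ y, F y * pd i G (x - y) := by
  ext x
  have h := (hc.hasFDerivAt_convolution_right (ContinuousLinearMap.mul ℝ ℝ)
    hF.locallyIntegrable hG x).fderiv
  have h2 := convolution_precompR_apply (ContinuousLinearMap.mul ℝ ℝ) hF.locallyIntegrable
    (hc.fderiv ℝ) (hG.continuous_fderiv one_ne_zero) x (EuclideanSpace.single i 1)
  rw [← h] at h2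
  exact h2

lemma lap_integral_mul_comp_sub (hF : Integrable F) (hG : ContDiff ℝ 2 G)
    (hc : HasCompactSupport G) (x : Euc n) :
    lap (fun x => ∫ y, F y * G (x - y)) x = ∫ y, F y * lap G (x - y) := by
  rw [lap_eq_sum_pd (contDiff_integral_mul_comp_sub hF hG hc).contDiffAt]
  simp_rw [fun z => lap_eq_sum_pd (hG.contDiffAt (x := z)), Finset.mul_sum]
  rw [integral_finsetSum]
  · refine Finset.sum_congr rfl fun i _ => ?_
    rw [pd_integral_mul_comp_sub i hF (hG.of_le (by norm_num)) hc,
      pd_integral_mul_comp_sub i hF (contDiff_pd i hG) (hc.pd i)]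
  · intro i _
    exact integrable_mul_comp_sub hF (continuous_iff_continuousAt.2 fun z =>
      continuousAt_pd i (contDiff_pd i hG).contDiffAt) ((hc.pd i).pd i) x

lemma rpow_neg_norm_eq (z : Euc n) :
    ‖z‖ ^ (-((n : ℝ) - 2)) = (‖z - 0‖ ^ 2 + 0) ^ (1 - (n : ℝ) / 2) := by
  rw [sub_zero, add_zero, ← Real.rpow_natCast _ 2, ← Real.rpow_mul (norm_nonneg _)]
  congr 1
  push_cast
  ring

lemma contDiffAt_rpow_neg_norm {z : Euc n} (hz : z ≠ 0) :
    ContDiffAt ℝ 2 (fun z : Euc n => ‖z‖ ^ (-((n : ℝ) - 2))) z := by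
  have hz' := norm_pos_iff.2 hz
  simp_rw [rpow_neg_norm_eq]
  exact contDiffAt_rpow_norm_sub_sq_add 0 z 0 _ (by rw [sub_zero]; positivity)

lemma lap_rpow_neg_norm {z : Euc n} (hz : z ≠ 0) :
    lap (fun z : Euc n => ‖z‖ ^ (-((n : ℝ) - 2))) z = 0 := by
  have hz' := norm_pos_iff.2 hz
  simp_rw [rpow_neg_norm_eq]
  rw [lap_rpow_norm_sub_sq_add 0 z 0 _ (by rw [sub_zero]; positivity)]
  ring

lemma exists_truncated_kernel {ε R : ℝ} (hε : 0 < ε) (hR : ε < R) :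
    ∃ G : Euc n → ℝ, ContDiff ℝ 2 G ∧ HasCompactSupport G ∧
      ∀ z, ε < ‖z‖ → ‖z‖ < R → G =ᶠ[𝓝 z] fun z => ‖z‖ ^ (-((n : ℝ) - 2)) := by
  let θ : ContDiffBump (0 : Euc n) := ⟨ε / 2, ε, by positivity, by linarith⟩
  let χ : ContDiffBump (0 : Euc n) := ⟨R, R + 1, by linarith, by linarith⟩
  refine ⟨fun z => χ z * ((1 - θ z) * ‖z‖ ^ (-((n : ℝ) - 2))), ?_, χ.hasCompactSupport.mul_right, ?_⟩
  · refine χ.contDiff.mul (contDiff_iff_contDiffAt.2 fun z => ?_)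
    by_cases hz : z = 0
    · subst hz
      refine (contDiffAt_const (c := (0 : ℝ))).congr_of_eventuallyEq ?_
      filter_upwards [θ.eventuallyEq_one] with y hy
      simp [hy]
    · exact (contDiffAt_const.sub θ.contDiffAt).mul (contDiffAt_rpow_neg_norm hz)
  · intro z hz1 hz2
    filter_upwards [continuous_norm.continuousAt.eventually (lt_mem_nhds hz1),
      continuous_norm.continuousAt.eventually (gt_mem_nhds hz2)] with y hy1 hy2
    have h1 : θ y = 0 := θ.zero_of_le_dist (by simpa using hy1.le)
    have h2 : χ y = 1 := χ.one_of_mem_closedBall (by simpa using hy2.le)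
    simp [h1, h2]

/-- The Newtonian potential of a compactly supported density vanishing on the unit ball is harmonic
there. -/
lemma harmonic_potential (hF : Integrable F) (hc : HasCompactSupport F)
    (h0 : ∀ y ∈ ball (0 : Euc n) 1, F y = 0) {x : Euc n} (hx : x ∈ ball (0 : Euc n) 1) :
    ContDiffAt ℝ 2 (fun x => ∫ y, F y * ‖x - y‖ ^ (-((n : ℝ) - 2))) x ∧
      lap (fun x => ∫ y, F y * ‖x - y‖ ^ (-((n : ℝ) - 2))) x = 0 := by
  obtain ⟨R, hR0, hR⟩ : ∃ R : ℝ, 0 < R ∧ tsupport F ⊆ closedBall 0 R := by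
    obtain ⟨R, hR⟩ := hc.isCompact.isBounded.subset_closedBall 0
    exact ⟨max R 1, by positivity, hR.trans (closedBall_subset_closedBall (le_max_left _ _))⟩
  have hx1 : ‖x‖ < 1 := mem_ball_zero_iff.1 hx
  let ε : ℝ := (1 - ‖x‖) / 2
  have hε : 0 < ε := by simp only [ε]; linarith
  obtain ⟨G, hG, hGc, hGe⟩ := exists_truncated_kernel (n := n) (R := R + 1) hε
    (by have := norm_nonneg x; simp only [ε]; linarith)
  have hdist : ∀ x' : Euc n, ‖x'‖ < 1 - ε → ∀ y, F y ≠ 0 → ε < ‖x' - y‖ ∧ ‖x' - y‖ < R + 1 := by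
    intro x' hx' y hy
    have h1 : 1 ≤ ‖y‖ := by
      by_contra h
      exact hy (h0 y (by simpa using h))
    have h2 : ‖y‖ ≤ R := by simpa using hR (subset_tsupport F hy)
    have h3 := norm_sub_norm_le y x'
    have h4 := norm_sub_le x' y
    rw [norm_sub_rev] at h3
    exact ⟨by linarith, by linarith⟩
  have hxε : ‖x‖ < 1 - ε := by simp only [ε]; linarith
  have heq : (fun x => ∫ y, F y * ‖x - y‖ ^ (-((n : ℝ) - 2))) =ᶠ[𝓝 x]
      fun x => ∫ y, F y * G (x - y) := by
    filter_upwards [continuous_norm.continuousAt.eventually (gt_mem_nhds hxε)] with x' hx'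
    refine integral_congr_ae (ae_of_all _ fun y => ?_)
    by_cases hy : F y = 0
    · simp [hy]
    · obtain ⟨h1, h2⟩ := hdist x' hx' y hy
      simp [(hGe _ h1 h2).eq_of_nhds]
  refine ⟨(contDiff_integral_mul_comp_sub hF hG hGc).contDiffAt.congr_of_eventuallyEq heq, ?_⟩
  rw [lap_congr heq, lap_integral_mul_comp_sub hF hG hGc]
  refine integral_eq_zero_of_ae (ae_of_all _ fun y => ?_)
  by_cases hy : F y = 0
  · simp [hy]
  · obtain ⟨h1, h2⟩ := hdist x hxε y hy
    have : x - y ≠ 0 := norm_pos_iff.1 (hε.trans h1)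
    change F y * lap G (x - y) = 0
    rw [lap_congr (hGe _ h1 h2), lap_rpow_neg_norm this, mul_zero]

lemma exists_bound_potential (hn : 3 ≤ n) (hc : HasCompactSupport F) {B : ℝ} (hB0 : 0 ≤ B)
    (hB : ∀ y, |F y| ≤ B) :
    ∃ M, ∀ x ∈ ball (0 : Euc n) 1, |∫ y, F y * ‖x - y‖ ^ (-((n : ℝ) - 2))| ≤ M := by
  obtain ⟨R, hR⟩ := hc.isCompact.isBounded.subset_closedBall 0
  have hs : (n : ℝ) - 2 < n := by linarith
  refine ⟨B * ∫ z in ball (0 : Euc n) (R + 1 + 1), ‖z‖ ^ (-((n : ℝ) - 2)), fun x hx => ?_⟩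
  have hx1 : ‖x‖ ≤ 1 := (mem_ball_zero_iff.1 hx).le
  have h1 := setIntegral_rpow_neg_norm_sub_le (r := R + 1) (by omega) hs hx1
  have e : ∫ y, F y * ‖x - y‖ ^ (-((n : ℝ) - 2)) =
      ∫ y in ball 0 (R + 1), F y * ‖x - y‖ ^ (-((n : ℝ) - 2)) := by
    refine (setIntegral_eq_integral_of_forall_compl_eq_zero fun y hy => ?_).symm
    have : F y = 0 := image_eq_zero_of_notMem_tsupport fun h => hy ?_
    · simp [this]
    · have := hR h
      rw [mem_closedBall_zero_iff] at this
      rw [mem_ball_zero_iff]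
      linarith
  rw [e, ← Real.norm_eq_abs]
  refine (norm_integral_le_of_norm_le
    ((integrableOn_ball_zero_rpow_neg_norm_sub (by omega) hs x (R + 1)).const_mul B)
    (ae_of_all _ fun y => ?_)).trans ?_
  · rw [norm_mul, Real.norm_of_nonneg (by positivity : 0 ≤ ‖x - y‖ ^ (-((n : ℝ) - 2)))]
    exact mul_le_mul_of_nonneg_right (hB y) (by positivity)
  · rw [integral_const_mul]
    exact mul_le_mul_of_nonneg_left h1 hB0

end HarmonicPart

section Representation

variable {n : ℕ} {v : Euc n → ℝ}

lemma exists_abs_le_of_continuousAt {F : Euc n → ℝ} {K : Set (Euc n)} (hK : IsCompact K)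
    (hF : ∀ x ∈ K, ContinuousAt F x) : ∃ B, 0 ≤ B ∧ ∀ x ∈ K, |F x| ≤ B := by
  obtain ⟨B, hB⟩ := hK.exists_bound_of_continuousOn
    (fun x hx => (hF x hx).continuousWithinAt : ContinuousOn F K)
  exact ⟨max B 0, le_max_right _ _, fun x hx => (hB x hx).trans (le_max_left _ _)⟩

/-- A nonnegative function that is superharmonic in the punctured unit ball has integrable Laplacian
and is the sum of a multiple of the fundamental solution, a bounded harmonic function and a
Newtonian potential. -/
lemma exists_representation [Nontrivial (Euc n)] (hn : 3 ≤ n)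
    (hv : ∀ x, x ≠ 0 → ContDiffAt ℝ 2 v x) (hv0 : ∀ x, 0 ≤ v x)
    (hs : ∀ x ∈ ball (0 : Euc n) 1, x ≠ 0 → lap v x ≤ 0) :
    IntegrableOn (lap v) (ball 0 1) ∧
    ∃ m : ℝ, 0 ≤ m ∧ ∃ h : Euc n → ℝ,
      (∀ x ∈ ball (0 : Euc n) 1, ContDiffAt ℝ 2 h x ∧ lap h x = 0) ∧
      (∃ M : ℝ, ∀ x ∈ ball (0 : Euc n) 1, |h x| ≤ M) ∧
      ∀ x : Euc n, x ≠ 0 → ‖x‖ < 1 →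
        v x = m * ‖x‖ ^ (-((n : ℝ) - 2)) + h x +
          (newtonConst n)⁻¹ * ∫ y in ball (0 : Euc n) 1, -lap v y * ‖x - y‖ ^ (-((n : ℝ) - 2)) := by
  have h3 : (3 : ℝ) ≤ n := by exact_mod_cast hn
  have hA := newtonConst_pos hn
  let χ : ContDiffBump (0 : Euc n) := ⟨1, 2, one_pos, one_lt_two⟩
  let w : Euc n → ℝ := fun x => χ x * v x
  have hw : ∀ x, x ≠ 0 → ContDiffAt ℝ 2 w x := fun x hx => χ.contDiffAt.mul (hv x hx)
  have hc : HasCompactSupport w := χ.hasCompactSupport.mul_right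
  have hw0 : ∀ x, 0 ≤ w x := fun x => mul_nonneg χ.nonneg (hv0 x)
  have hwv : ∀ x ∈ ball (0 : Euc n) 1, w =ᶠ[𝓝 x] v := fun x hx => by
    filter_upwards [isOpen_ball.mem_nhds hx] with y hy
    simp [w, χ.one_of_mem_closedBall (ball_subset_closedBall hy)]
  have hlw : ∀ x ∈ ball (0 : Euc n) 1, lap w x = lap v x := fun x hx => lap_congr (hwv x hx)
  obtain ⟨hi, hl⟩ := integrable_div_norm_and_lap hn hw hc hw0 fun x hx hx0 => by
    rw [hlw x hx]
    exact hs x hx hx0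
  let F : Euc n → ℝ := (ball (0 : Euc n) 1)ᶜ.indicator fun y => -lap w y
  have hF : Integrable F := hl.neg.indicator measurableSet_ball.compl
  have hFc : HasCompactSupport F := by
    refine hc.lap.mono fun y hy => ?_
    by_contra h
    exact hy (by simp [F, indicator, Function.notMem_support.1 h])
  have hF0 : ∀ y ∈ ball (0 : Euc n) 1, F y = 0 := fun y hy => by simp [F, hy]
  obtain ⟨B, hB0, hB⟩ := exists_abs_le_of_continuousAt (F := lap w)
    (hc.isCompact.inter_right (isOpen_ball (x := (0 : Euc n)) (ε := 1)).isClosed_compl)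
    fun x hx => continuousAt_lap (hw x (by rintro rfl; exact hx.2 (mem_ball_self one_pos)))
  have hFB : ∀ y, |F y| ≤ B := fun y => by
    by_cases hy : y ∈ ball (0 : Euc n) 1
    · simpa [hF0 y hy] using hB0
    · by_cases hy2 : y ∈ tsupport w
      · have e : F y = -lap w y := indicator_of_mem hy _
        rw [e, abs_neg]
        exact hB y ⟨hy2, hy⟩
      · have e : lap w y = 0 := by
          rw [lap_congr (notMem_tsupport_iff_eventuallyEq.1 hy2), Pi.zero_def, lap_const]
        simpa [F, indicator, e] using hB0
  obtain ⟨M, hM⟩ := exists_bound_potential hn hFc hB0 hFB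
  refine ⟨(hl.integrableOn (s := ball 0 1)).congr_fun hlw measurableSet_ball,
    (newtonConst n)⁻¹ * ∫ y, lap w y,
    mul_nonneg (inv_nonneg.2 hA.le) (integral_lap_nonneg hn hw hc hw0 hl),
    fun x => (newtonConst n)⁻¹ * ∫ y, F y * ‖x - y‖ ^ (-((n : ℝ) - 2)), fun x hx => ?_,
    ⟨(newtonConst n)⁻¹ * M, fun x hx => ?_⟩, fun x hx hx1 => ?_⟩
  · obtain ⟨h1, h2⟩ := harmonic_potential hF hFc hF0 hx
    refine ⟨contDiffAt_const.mul h1, ?_⟩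
    rw [lap_const_mul _ h1, h2, mul_zero]
  · rw [abs_mul, abs_of_pos (inv_pos.2 hA)]
    exact mul_le_mul_of_nonneg_left (hM x hx) (inv_nonneg.2 hA.le)
  · have hx' := norm_pos_iff.2 hx
    obtain ⟨B', -, hB'⟩ := exists_abs_le_of_continuousAt (F := lap w)
      (isCompact_closedBall x (‖x‖ / 2)) fun y hy => continuousAt_lap (hw y (by
        rintro rfl
        rw [mem_closedBall, dist_zero_left] at hy
        linarith))
    have hk : Integrable fun y => lap w y * ‖x - y‖ ^ (-((n : ℝ) - 2)) :=
      integrable_mul_rpow_neg_norm_sub (by omega) (by linarith) (by linarith) hl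
        (half_pos hx') fun y hy => hB' y (ball_subset_closedBall hy)
    have hrep := newtonConst_mul_eq hn hw hc hi hl hx hk
    have e1 : w x = v x := (hwv x (by simpa using hx1)).eq_of_nhds
    have e2 := integral_add_compl (measurableSet_ball (x := (0 : Euc n)) (ε := 1)) hk
    have e3 : ∫ y in ball (0 : Euc n) 1, -lap v y * ‖x - y‖ ^ (-((n : ℝ) - 2)) =
        -∫ y in ball (0 : Euc n) 1, lap w y * ‖x - y‖ ^ (-((n : ℝ) - 2)) := by
      rw [← integral_neg]
      refine setIntegral_congr_fun measurableSet_ball fun y hy => ?_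
      simp only [hlw y hy, neg_mul]
    have e4 : ∫ y, F y * ‖x - y‖ ^ (-((n : ℝ) - 2)) =
        -∫ y in (ball (0 : Euc n) 1)ᶜ, lap w y * ‖x - y‖ ^ (-((n : ℝ) - 2)) := by
      rw [← integral_neg, ← integral_indicator measurableSet_ball.compl]
      refine integral_congr_ae (ae_of_all _ fun y => ?_)
      by_cases hy : y ∈ (ball (0 : Euc n) 1)ᶜ <;> simp only [F, indicator, hy, if_true, if_false] <;> ring
    beta_reduce
    rw [e3, e4]
    rw [← e2, e1] at hrep
    field_simp
    linarith

end Representation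

section PotentialIntegrability

variable {n : ℕ} {f : Euc n → ℝ} {s μ : ℝ}

lemma memLp_rpow_neg_norm (hn : 1 ≤ n) (hμ : 1 ≤ μ) (hsμ : s * μ < n) :
    MemLp (fun x : Euc n => ‖x‖ ^ (-s)) (ENNReal.ofReal μ) (volume.restrict (ball 0 1)) := by
  have hm : AEStronglyMeasurable (fun x : Euc n => ‖x‖ ^ (-s)) (volume.restrict (ball 0 1)) :=
    (measurable_norm.pow_const _).aestronglyMeasurable
  rw [← integrable_norm_rpow_iff hm (by simp; linarith) ENNReal.ofReal_ne_top,
    ENNReal.toReal_ofReal (by linarith)]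
  refine (integrableOn_ball_rpow_neg_norm hn hsμ 1).congr (ae_of_all _ fun x => ?_)
  simp only
  rw [Real.norm_of_nonneg (by positivity), ← Real.rpow_mul (norm_nonneg _), neg_mul]

lemma lintegral_ball_enorm_rpow_neg_norm_sub_le (hn : 1 ≤ n) (hs : s < n) {y : Euc n}
    (hy : y ∈ ball (0 : Euc n) 1) :
    ∫⁻ x in ball (0 : Euc n) 1, ENNReal.ofReal (‖x - y‖ ^ (-s)) ≤
      ENNReal.ofReal (∫ z in ball (0 : Euc n) (1 + 1), ‖z‖ ^ (-s)) := by
  have h := integrableOn_ball_zero_rpow_neg_norm_sub hn hs y 1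
  simp_rw [norm_sub_rev _ y]
  rw [← ofReal_integral_eq_lintegral_ofReal h (ae_of_all _ fun x => by positivity)]
  exact ENNReal.ofReal_le_ofReal
    (setIntegral_rpow_neg_norm_sub_le hn hs (mem_ball_zero_iff.1 hy).le)

lemma lintegral_rpow_le_of_finite {ν : Measure (Euc n)} {k : Euc n → ℝ} (hk : Measurable k)
    (hμ : 1 ≤ μ) : (∫⁻ y, ‖k y‖ₑ ∂ν) ^ μ ≤ ν univ ^ (μ - 1) * ∫⁻ y, ‖k y‖ₑ ^ μ ∂ν := by
  have h := eLpNorm'_le_eLpNorm'_mul_rpow_measure_univ one_pos hμ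
    (hk.aestronglyMeasurable (μ := ν))
  have h0 : 0 < μ := by linarith
  rw [eLpNorm'_eq_lintegral_enorm, eLpNorm'_eq_lintegral_enorm] at h
  simp only [ENNReal.rpow_one, div_one] at h
  refine (ENNReal.rpow_le_rpow h h0.le).trans_eq ?_
  rw [ENNReal.mul_rpow_of_nonneg _ _ h0.le, ← ENNReal.rpow_mul, ← ENNReal.rpow_mul, mul_comm]
  congr 2
  · field_simp
  · rw [one_div_mul_cancel h0.ne', ENNReal.rpow_one]

lemma memLp_potential (hn : 1 ≤ n) (hf : IntegrableOn f (ball 0 1)) (hμ : 1 ≤ μ)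
    (hsμ : s * μ < n) :
    MemLp (fun x => ∫ y in ball (0 : Euc n) 1, f y * ‖x - y‖ ^ (-s)) (ENNReal.ofReal μ)
      (volume.restrict (ball 0 1)) := by
  have hkm : Measurable fun p : Euc n × Euc n => ‖p.1 - p.2‖ ^ (-s) :=
    (measurable_fst.sub measurable_snd).norm.pow_const _
  have h0 : 0 < μ := by linarith
  have hm : AEStronglyMeasurable (fun x => ∫ y in ball (0 : Euc n) 1, f y * ‖x - y‖ ^ (-s))
      (volume.restrict (ball 0 1)) :=
    AEStronglyMeasurable.integral_prod_right' (f := fun p : Euc n × Euc n =>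
      f p.2 * ‖p.1 - p.2‖ ^ (-s)) (hf.aestronglyMeasurable.comp_snd.mul hkm.aestronglyMeasurable)
  refine ⟨hm, ?_⟩
  rw [eLpNorm_lt_top_iff_lintegral_rpow_enorm_lt_top (by simpa using h0) ENNReal.ofReal_ne_top,
    ENNReal.toReal_ofReal h0.le]
  set ν : Measure (Euc n) := (volume.restrict (ball 0 1)).withDensity fun y => ‖f y‖ₑ with hν
  have : IsFiniteMeasure ν := isFiniteMeasure_withDensity hf.hasFiniteIntegral.ne
  set I : ENNReal := ENNReal.ofReal (∫ z in ball (0 : Euc n) (1 + 1), ‖z‖ ^ (-(s * μ)))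
  have hpt : ∀ x, ‖∫ y in ball (0 : Euc n) 1, f y * ‖x - y‖ ^ (-s)‖ₑ ^ μ ≤
      ν univ ^ (μ - 1) * ∫⁻ y, ENNReal.ofReal (‖x - y‖ ^ (-(s * μ))) ∂ν := fun x => by
    have hk : Measurable fun y : Euc n => ‖x - y‖ ^ (-s) :=
      (measurable_const.sub measurable_id).norm.pow_const _
    have h1 : ‖∫ y in ball (0 : Euc n) 1, f y * ‖x - y‖ ^ (-s)‖ₑ ≤
        ∫⁻ y, ‖‖x - y‖ ^ (-s)‖ₑ ∂ν := by
      refine (enorm_integral_le_lintegral_enorm _).trans_eq ?_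
      rw [hν, lintegral_withDensity_eq_lintegral_mul₀ hf.aestronglyMeasurable.enorm
        hk.enorm.aemeasurable]
      simp [enorm_mul]
    refine (ENNReal.rpow_le_rpow h1 h0.le).trans ((lintegral_rpow_le_of_finite hk hμ).trans_eq ?_)
    congr 2
    ext y
    rw [Real.enorm_of_nonneg (by positivity), ENNReal.ofReal_rpow_of_nonneg (by positivity) h0.le,
      ← Real.rpow_mul (norm_nonneg _), neg_mul]
  have hswap : ∫⁻ x in ball (0 : Euc n) 1, ∫⁻ y, ENNReal.ofReal (‖x - y‖ ^ (-(s * μ))) ∂ν ≤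
      I * ν univ := by
    rw [lintegral_lintegral_swap]
    · rw [← lintegral_const]
      refine lintegral_mono_ae ?_
      have hB : ∀ᵐ y ∂ν, y ∈ ball (0 : Euc n) 1 :=
        (withDensity_absolutelyContinuous _ _).ae_le (ae_restrict_mem measurableSet_ball)
      filter_upwards [hB] with y hy
      exact lintegral_ball_enorm_rpow_neg_norm_sub_le hn hsμ hy
    · exact ((measurable_fst.sub measurable_snd).norm.pow_const _).ennreal_ofReal.aemeasurable
  refine (lintegral_mono hpt).trans_lt ?_
  have hfin : ν univ ^ (μ - 1) ≠ ⊤ :=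
    ENNReal.rpow_ne_top_of_nonneg (by linarith) (measure_ne_top _ _)
  rw [lintegral_const_mul' _ _ hfin]
  refine ENNReal.mul_lt_top hfin.lt_top (hswap.trans_lt ?_)
  exact ENNReal.mul_lt_top ENNReal.ofReal_lt_top (measure_lt_top _ _)

end PotentialIntegrability

section PowerIntegrability

variable {n : ℕ} {v h : Euc n → ℝ} {A m M μ : ℝ}

lemma integrableOn_rpow_of_representation [Nontrivial (Euc n)] (hn : 3 ≤ n) (hv0 : ∀ x, 0 ≤ v x)
    (hl : IntegrableOn (lap v) (ball 0 1)) (hh : ∀ x ∈ ball (0 : Euc n) 1, ContinuousAt h x)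
    (hM : ∀ x ∈ ball (0 : Euc n) 1, |h x| ≤ M)
    (hrep : ∀ x : Euc n, x ≠ 0 → ‖x‖ < 1 → v x = m * ‖x‖ ^ (-((n : ℝ) - 2)) + h x +
      A * ∫ y in ball (0 : Euc n) 1, -lap v y * ‖x - y‖ ^ (-((n : ℝ) - 2)))
    (hμ : 1 ≤ μ) (hμn : μ < (n : ℝ) / ((n : ℝ) - 2)) :
    IntegrableOn (fun y => v y ^ μ) (ball (0 : Euc n) 1) := by
  have h3 : (3 : ℝ) ≤ n := by exact_mod_cast hn
  have hsμ : ((n : ℝ) - 2) * μ < n := by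
    rw [lt_div_iff₀ (by linarith)] at hμn
    linarith
  have : IsFiniteMeasure (volume.restrict (ball (0 : Euc n) 1)) :=
    isFiniteMeasure_restrict.2 measure_ball_lt_top.ne
  have hhm : MemLp h (ENNReal.ofReal μ) (volume.restrict (ball 0 1)) :=
    MemLp.of_bound (ContinuousOn.aestronglyMeasurable
      (fun x hx => (hh x hx).continuousWithinAt) measurableSet_ball) M
      ((ae_restrict_mem measurableSet_ball).mono hM)
  have hsum := (((memLp_rpow_neg_norm (by omega) hμ hsμ).const_mul m).add hhm).add
    ((memLp_potential (by omega) hl.neg hμ hsμ).const_mul A)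
  have hv : MemLp v (ENNReal.ofReal μ) (volume.restrict (ball 0 1)) := by
    refine hsum.ae_eq ?_
    filter_upwards [ae_restrict_mem measurableSet_ball, ae_restrict_of_ae ae_ne_zero] with x hx hx0
    exact (hrep x hx0 (by simpa using hx)).symm
  have := hv.integrable_norm_rpow (by simp; linarith) ENNReal.ofReal_ne_top
  rw [ENNReal.toReal_ofReal (by linarith)] at this
  refine this.congr (ae_of_all _ fun x => ?_)
  simp only [Real.norm_of_nonneg (hv0 x)]

end PowerIntegrability

section NonlocalBound

variable {n : ℕ} {u v : Euc n → ℝ} {α lam : ℝ}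

lemma add_one_rpow_le {t : ℝ} (ht : 0 ≤ t) (hlam : 0 ≤ lam) :
    (t + 1) ^ lam ≤ 2 ^ lam * (t ^ lam + 1) := by
  have h1 : t + 1 ≤ 2 * max t 1 := by linarith [le_max_left t 1, le_max_right t 1]
  have h2 : max t 1 ^ lam ≤ t ^ lam + 1 := by
    rcases max_choice t 1 with h | h <;> rw [h]
    · linarith
    · rw [Real.one_rpow]
      linarith [Real.rpow_nonneg ht lam]
  calc (t + 1) ^ lam ≤ (2 * max t 1) ^ lam := Real.rpow_le_rpow (by positivity) h1 hlam
    _ = 2 ^ lam * max t 1 ^ lam := Real.mul_rpow two_pos.le (by positivity)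
    _ ≤ _ := by gcongr

lemma continuousAt_add_one_rpow (hu0 : ∀ x, 0 ≤ u x) {x : Euc n} (hu : ContinuousAt u x)
    (lam : ℝ) : ContinuousAt (fun y => (u y + 1) ^ lam) x := by
  have h : ContinuousAt (fun y => u y + 1) x := hu.add continuousAt_const
  exact h.rpow_const (Or.inl (by linarith [hu0 x]))

lemma integrableOn_add_one_rpow [Nontrivial (Euc n)] (hu0 : ∀ x, 0 ≤ u x)
    (hu : ∀ x, x ≠ 0 → ContinuousAt u x) (hlam : 0 ≤ lam) (hi : Integrable fun y => u y ^ lam)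
    (r : ℝ) : IntegrableOn (fun y => (u y + 1) ^ lam) (ball (0 : Euc n) r) := by
  have hm : AEStronglyMeasurable fun y : Euc n => (u y + 1) ^ lam :=
    aestronglyMeasurable_of_continuousAt fun x hx => continuousAt_add_one_rpow hu0 (hu x hx) lam
  have h1 : IntegrableOn (fun _ => (1 : ℝ)) (ball (0 : Euc n) r) :=
    integrableOn_const measure_ball_lt_top.ne
  refine ((hi.integrableOn.add h1).const_mul (2 ^ lam)).mono' hm.restrict (ae_of_all _ fun y => ?_)
  have := hu0 y
  rw [Real.norm_of_nonneg (by positivity)]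
  exact add_one_rpow_le this hlam

/-- The nonlocal term is controlled by its restriction to the unit ball, once the density is bounded
from below. -/
lemma exists_integral_le_mul_setIntegral [Nontrivial (Euc n)] (hn : 1 ≤ n) (hα0 : 0 < α)
    (hαn : α < n) (hlam : 0 ≤ lam) (hu0 : ∀ x, 0 ≤ u x) (hu : ∀ x, x ≠ 0 → ContinuousAt u x)
    (hi : Integrable fun y => u y ^ lam) :
    ∃ C > (0 : ℝ), ∀ x ∈ ball (0 : Euc n) 2 \ {0}, ∫ y, ‖x - y‖ ^ (-α) * u y ^ lam ≤
      C * ∫ y in ball (0 : Euc n) 1, (u y + 1) ^ lam * ‖x - y‖ ^ (-α) := by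
  have hK : IsCompact (closedBall (0 : Euc n) 3 ∩ (ball 0 1)ᶜ) :=
    (isCompact_closedBall _ _).inter_right isOpen_ball.isClosed_compl
  obtain ⟨M, hM0, hM⟩ := exists_abs_le_of_continuousAt (F := u) hK fun x hx => hu x (by
    rintro rfl
    exact hx.2 (mem_ball_self one_pos))
  set D : ℝ := M ^ lam * (∫ z in ball (0 : Euc n) (3 + 2), ‖z‖ ^ (-α)) + ∫ y, u y ^ lam with hD
  have hD0 : 0 ≤ D := by
    have h1 : 0 ≤ ∫ z in ball (0 : Euc n) (3 + 2), ‖z‖ ^ (-α) :=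
      integral_nonneg fun z => by positivity
    have h2 : 0 ≤ ∫ y, u y ^ lam := integral_nonneg fun y => Real.rpow_nonneg (hu0 y) _
    positivity
  set c : ℝ := volume.real (ball (0 : Euc n) 1) * 3 ^ (-α) with hcdef
  have hc : 0 < c := by
    have : 0 < volume.real (ball (0 : Euc n) 1) :=
      ENNReal.toReal_pos (measure_ball_pos _ _ one_pos).ne' measure_ball_lt_top.ne
    positivity
  refine ⟨1 + D / c, by positivity, fun x hx => ?_⟩
  have hx2 : ‖x‖ < 2 := mem_ball_zero_iff.1 hx.1
  have hx0 : x ≠ 0 := hx.2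
  have hx' := norm_pos_iff.2 hx0
  have hne : ∀ y ∈ closedBall x (‖x‖ / 2), y ≠ 0 := by
    rintro y hy rfl
    rw [mem_closedBall, dist_zero_left] at hy
    linarith
  have hv0 : ∀ y, 0 ≤ (u y + 1) ^ lam := fun y => Real.rpow_nonneg (by linarith [hu0 y]) _
  have hule : ∀ y, u y ^ lam ≤ (u y + 1) ^ lam := fun y =>
    Real.rpow_le_rpow (hu0 y) (by linarith) hlam
  obtain ⟨B, hB0, hB⟩ := exists_abs_le_of_continuousAt (F := fun y => (u y + 1) ^ lam)
    (isCompact_closedBall x (‖x‖ / 2)) fun y hy =>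
      continuousAt_add_one_rpow hu0 (hu y (hne y hy)) lam
  have hJ : Integrable fun y => u y ^ lam * ‖x - y‖ ^ (-α) :=
    integrable_mul_rpow_neg_norm_sub hn hα0.le hαn hi (half_pos hx') fun y hy => by
      rw [abs_of_nonneg (Real.rpow_nonneg (hu0 y) _)]
      exact (hule y).trans ((le_abs_self _).trans (hB y (ball_subset_closedBall hy)))
  have hP : IntegrableOn (fun y => (u y + 1) ^ lam * ‖x - y‖ ^ (-α)) (ball (0 : Euc n) 1) := by
    have h1 : Integrable ((ball (0 : Euc n) 1).indicator fun y => (u y + 1) ^ lam) :=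
      (integrableOn_add_one_rpow hu0 hu hlam hi 1).integrable_indicator measurableSet_ball
    have h2 := integrable_mul_rpow_neg_norm_sub hn hα0.le hαn h1 (half_pos hx') (C := B)
      fun y hy => by
        refine le_trans ?_ (hB y (ball_subset_closedBall hy))
        by_cases hy1 : y ∈ ball (0 : Euc n) 1
        · rw [indicator_of_mem hy1]
        · rw [indicator_of_notMem hy1, abs_zero]
          exact abs_nonneg _
    rw [← integrable_indicator_iff measurableSet_ball]
    refine h2.congr (ae_of_all _ fun y => ?_)
    by_cases hy1 : y ∈ ball (0 : Euc n) 1 <;> simp [indicator, hy1]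
  set P : ℝ := ∫ y in ball (0 : Euc n) 1, (u y + 1) ^ lam * ‖x - y‖ ^ (-α) with hPdef
  have hcP : c ≤ P := by
    have h1 : c = ∫ _ in ball (0 : Euc n) 1, (3 : ℝ) ^ (-α) := by
      rw [setIntegral_const, smul_eq_mul]
    rw [h1]
    refine setIntegral_mono_on_ae (integrableOn_const measure_ball_lt_top.ne) hP
      measurableSet_ball ?_
    filter_upwards [ae_ne x] with y hy hy1
    have hy1' : ‖y‖ < 1 := mem_ball_zero_iff.1 hy1
    have h2 : 0 < ‖x - y‖ := norm_pos_iff.2 (sub_ne_zero.2 hy.symm)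
    have h3 : ‖x - y‖ ≤ 3 := (norm_sub_le x y).trans (by linarith)
    have h4 : (3 : ℝ) ^ (-α) ≤ ‖x - y‖ ^ (-α) :=
      Real.rpow_le_rpow_of_nonpos h2 h3 (by linarith)
    have h5 : 1 ≤ (u y + 1) ^ lam := Real.one_le_rpow (by linarith [hu0 y]) hlam
    exact h4.trans (le_mul_of_one_le_left (by positivity) h5)
  have hnear : ∫ y in ball (0 : Euc n) 1, u y ^ lam * ‖x - y‖ ^ (-α) ≤ P :=
    setIntegral_mono hJ.integrableOn hP fun y =>
      mul_le_mul_of_nonneg_right (hule y) (by positivity)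
  have hfar : ∫ y in (ball (0 : Euc n) 1)ᶜ, u y ^ lam * ‖x - y‖ ^ (-α) ≤ D := by
    have hk := integrableOn_ball_zero_rpow_neg_norm_sub hn hαn x 3
    have hk' : Integrable ((ball (0 : Euc n) 3).indicator fun y => M ^ lam * ‖x - y‖ ^ (-α)) :=
      IntegrableOn.integrable_indicator (hk.const_mul _) measurableSet_ball
    have h0 : ∀ y, 0 ≤ (ball (0 : Euc n) 3).indicator (fun y => M ^ lam * ‖x - y‖ ^ (-α)) y :=
      fun y => indicator_nonneg (fun y _ => by positivity) y
    have h1 : ∫ y in (ball (0 : Euc n) 1)ᶜ, u y ^ lam * ‖x - y‖ ^ (-α) ≤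
        ∫ y in (ball (0 : Euc n) 1)ᶜ,
          ((ball (0 : Euc n) 3).indicator (fun y => M ^ lam * ‖x - y‖ ^ (-α)) y + u y ^ lam) := by
      refine setIntegral_mono_on hJ.integrableOn (hk'.add hi).integrableOn
        measurableSet_ball.compl fun y hy => ?_
      by_cases hy3 : y ∈ ball (0 : Euc n) 3
      · rw [indicator_of_mem hy3]
        have h2 : u y ≤ M := (le_abs_self _).trans (hM y ⟨ball_subset_closedBall hy3, hy⟩)
        have h3 : u y ^ lam ≤ M ^ lam := Real.rpow_le_rpow (hu0 y) h2 hlam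
        have h4 := mul_le_mul_of_nonneg_right h3 (by positivity : 0 ≤ ‖x - y‖ ^ (-α))
        linarith [Real.rpow_nonneg (hu0 y) lam]
      · rw [indicator_of_notMem hy3, zero_add]
        have h2 : 3 ≤ ‖y‖ := by simpa using hy3
        have h3 : 1 ≤ ‖x - y‖ := by
          have := norm_sub_norm_le y x
          rw [norm_sub_rev] at this
          linarith
        exact mul_le_of_le_one_right (Real.rpow_nonneg (hu0 y) _)
          (Real.rpow_le_one_of_one_le_of_nonpos h3 (by linarith))
    have h2 := setIntegral_le_integral (s := (ball (0 : Euc n) 1)ᶜ) (hk'.add hi)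
      (ae_of_all _ fun y => add_nonneg (h0 y) (Real.rpow_nonneg (hu0 y) _))
    refine h1.trans (h2.trans ?_)
    have h3 := integral_add hk' hi
    have h4 := setIntegral_rpow_neg_norm_sub_le (r := 3) hn hαn hx2.le
    rw [integral_indicator measurableSet_ball, integral_const_mul] at h3
    have h5 := mul_le_mul_of_nonneg_left h4 (by positivity : 0 ≤ M ^ lam)
    simp only [Pi.add_apply]
    rw [h3, hD]
    linarith
  have hsplit := integral_add_compl (measurableSet_ball (x := (0 : Euc n)) (ε := 1)) hJ
  have hDP : D ≤ D / c * P := by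
    rw [div_mul_eq_mul_div, le_div_iff₀ hc]
    exact mul_le_mul_of_nonneg_left hcP hD0
  simp_rw [mul_comm (‖x - _‖ ^ (-α)) (u _ ^ lam)]
  rw [← hsplit]
  linarith

end NonlocalBound

theorem stmt5 (n : ℕ) (hn : 3 ≤ n) (α lam sig : ℝ)
    (hα0 : 0 < α) (hαn : α < n) (hlam : 0 < lam) (hsig : 0 ≤ sig)
    (u : Euc n → ℝ) (hu : IsCPSolution n α lam sig u)
    (v : Euc n → ℝ) (hv : ∀ x, v x = u x + 1) :
    (ContDiffOn ℝ 2 v {0}ᶜ ∧ IntegrableOn (fun y => v y ^ lam) (ball (0 : Euc n) 2)) ∧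
    (∃ C > (0:ℝ), ∀ x ∈ ball (0 : Euc n) 2 \ {0},
      (0 ≤ -lap v x ∧
        -lap v x ≤ C * (∫ y in ball (0 : Euc n) 1, v y ^ lam / ‖x - y‖ ^ α) * v x ^ sig) ∧
      1 ≤ v x) ∧
    (IntegrableOn (fun y => -lap v y) (ball (0 : Euc n) 1) ∧
      ∀ μ : ℝ, 1 ≤ μ → μ < (n : ℝ) / ((n : ℝ) - 2) →
        IntegrableOn (fun y => v y ^ μ) (ball (0 : Euc n) 1)) ∧
    (∃ m : ℝ, 0 ≤ m ∧ ∃ C' > (0:ℝ), ∃ h : Euc n → ℝ,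
      ContDiffOn ℝ 2 h (ball (0 : Euc n) 1) ∧
      (∀ x ∈ ball (0 : Euc n) 1, lap h x = 0) ∧
      (∃ M : ℝ, ∀ x ∈ ball (0 : Euc n) 1, |h x| ≤ M) ∧
      ∀ x : Euc n, x ≠ 0 → ‖x‖ < 1 →
        v x = m * ‖x‖ ^ (-((n : ℝ) - 2)) + h x +
          C' * ∫ y in ball (0 : Euc n) 1, (-lap v y) / ‖x - y‖ ^ ((n : ℝ) - 2)) := by
  obtain ⟨hu0, hu2, hui, hineq⟩ := hu
  have : Nontrivial (Euc n) :=
    Module.nontrivial_of_finrank_pos (R := ℝ) (by rw [finrank_euclideanSpace_fin]; omega)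
  have huc : ∀ x, x ≠ 0 → ContDiffAt ℝ 2 u x := fun x hx =>
    hu2.contDiffAt (isOpen_compl_singleton.mem_nhds hx)
  obtain rfl : v = fun x => u x + 1 := funext hv
  have hvc : ∀ x, x ≠ 0 → ContDiffAt ℝ 2 (fun x => u x + 1) x := fun x hx =>
    (huc x hx).add contDiffAt_const
  have hlap : ∀ x, x ≠ 0 → lap (fun x => u x + 1) x = lap u x := fun x hx =>
    lap_add_const 1 (huc x hx)
  have hv0 : ∀ x, 0 ≤ u x + 1 := fun x => by linarith [hu0 x]
  have hdiv : ∀ (a b s : ℝ), 0 ≤ b → a / b ^ s = a * b ^ (-s) := fun a b s hb => by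
    rw [Real.rpow_neg hb, div_eq_mul_inv]
  obtain ⟨hl, m, hm, h, hh, ⟨M, hM⟩, hrep⟩ := exists_representation hn hvc hv0
    fun x hx hx0 => by
      have := (hineq x ⟨ball_subset_ball one_le_two hx, hx0⟩).1
      rw [hlap x hx0]
      linarith
  obtain ⟨C, hC, hCle⟩ := exists_integral_le_mul_setIntegral (by omega) hα0 hαn hlam.le hu0
    (fun x hx => (huc x hx).continuousAt) hui
  refine ⟨⟨hu2.add contDiffOn_const, integrableOn_add_one_rpow hu0
      (fun x hx => (huc x hx).continuousAt) hlam.le hui 2⟩,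
    ⟨C, hC, fun x hx => ⟨?_, by linarith [hu0 x]⟩⟩,
    ⟨hl.neg, fun μ hμ hμn => integrableOn_rpow_of_representation hn hv0 hl
      (fun x hx => (hh x hx).1.continuousAt) hM hrep hμ hμn⟩,
    m, hm, (newtonConst n)⁻¹, inv_pos.2 (newtonConst_pos hn), h,
    fun x hx => (hh x hx).1.contDiffWithinAt, fun x hx => (hh x hx).2, ⟨M, hM⟩,
    fun x hx hx1 => ?_⟩
  · rw [hlap x hx.2]
    refine ⟨(hineq x hx).1, (hineq x hx).2.trans ?_⟩
    simp_rw [fun y => hdiv ((u y + 1) ^ lam) ‖x - y‖ α (norm_nonneg _)]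
    have h1 : u x ^ sig ≤ (u x + 1) ^ sig := Real.rpow_le_rpow (hu0 x) (by linarith) hsig
    have h2 : 0 ≤ ∫ y in ball (0 : Euc n) 1, (u y + 1) ^ lam * ‖x - y‖ ^ (-α) :=
      integral_nonneg fun y => mul_nonneg (Real.rpow_nonneg (hv0 y) _) (by positivity)
    exact mul_le_mul (hCle x hx) h1 (Real.rpow_nonneg (hu0 x) _) (by positivity)
  · simp_rw [fun y => hdiv (-lap (fun x => u x + 1) y) ‖x - y‖ ((n : ℝ) - 2) (norm_nonneg _)]
    exact hrep x hx hx1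
end

section
/- Suppose n ≥ 3, α ∈ (0,n), λ > 0, σ ≥ 0, u is a nonnegative solution of the Choquard–Pekar inequality problem, and u(x) = O(1) as x → 0 (i.e., u is bounded in some punctured neighborhood of the origin). Then u has a C¹ extension to the origin; that is, u = w restricted to ℝⁿ\{0} for some function w ∈ C¹(ℝⁿ). -/
open MeasureTheory Metric Filter Set Asymptotics Topology

lemma lap_eq_sum_fderiv_fderiv {n : ℕ} {f : Euc n → ℝ} {x : Euc n} (hf : ContDiffAt ℝ 2 f x) :
    lap f x = ∑ i : Fin n, fderiv ℝ (fun y => fderiv ℝ f y (EuclideanSpace.single i 1)) x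
      (EuclideanSpace.single i 1) := by
  have hd : DifferentiableAt ℝ (fderiv ℝ f) x :=
    (hf.fderiv_right (m := 1) (by norm_num)).differentiableAt (by norm_num)
  refine Finset.sum_congr rfl fun i _ => ?_
  rw [iteratedFDeriv_two_apply, fderiv_clm_apply hd (differentiableAt_const _)]
  simp

lemma abs_lap_le {n : ℕ} (f : Euc n → ℝ) (x : Euc n) :
    |lap f x| ≤ n * ‖iteratedFDeriv ℝ 2 f x‖ := by
  refine (Finset.abs_sum_le_sum_abs _ _).trans ?_
  calc _ ≤ ∑ _i : Fin n, ‖iteratedFDeriv ℝ 2 f x‖ := by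
        refine Finset.sum_le_sum fun i _ => ?_
        have := (iteratedFDeriv ℝ 2 f x).le_opNorm
          ![EuclideanSpace.single i 1, EuclideanSpace.single i 1]
        simpa [Fin.prod_univ_two] using this
    _ = _ := by simp

lemma lap_congr_of_eventuallyEq {n : ℕ} {f g : Euc n → ℝ} {x : Euc n} (h : f =ᶠ[𝓝 x] g) :
    lap f x = lap g x := by
  simp only [lap, (Filter.EventuallyEq.iteratedFDeriv ℝ h 2).eq_of_nhds]

lemma continuousOn_lap {n : ℕ} {f : Euc n → ℝ} {s : Set (Euc n)} (hs : IsOpen s)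
    (hf : ContDiffOn ℝ 2 f s) : ContinuousOn (lap f) s := by
  have h : ContinuousOn (iteratedFDeriv ℝ 2 f) s :=
    (hf.continuousOn_iteratedFDerivWithin (m := 2) le_rfl hs.uniqueDiffOn).congr
      fun x hx => (iteratedFDerivWithin_of_isOpen 2 hs hx).symm
  refine continuousOn_finsetSum _ fun i _ => ?_
  exact (ContinuousEval.continuous_eval.comp_continuousOn (h.prodMk continuousOn_const))

lemma aestronglyMeasurable_of_continuousOn_compl_zero {n : ℕ} (hn : 1 ≤ n) {f : Euc n → ℝ}
    (hf : ContinuousOn f {0}ᶜ) : AEStronglyMeasurable f := by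
  have : Nonempty (Fin n) := ⟨⟨0, hn⟩⟩
  have h := hf.aestronglyMeasurable (μ := volume) isOpen_compl_singleton.measurableSet
  rwa [restrict_compl_singleton] at h

lemma integrable_mul_of_zero_notMem_tsupport {n : ℕ} {f h : Euc n → ℝ}
    (hf : ContinuousOn f {0}ᶜ) (hfc : HasCompactSupport f) (hh : Continuous h)
    (h0 : (0 : Euc n) ∉ tsupport h) : Integrable (fun x => f x * h x) := by
  refine Continuous.integrable_of_hasCompactSupport ?_ hfc.mul_right
  rw [continuous_iff_continuousAt]
  intro x
  rcases eq_or_ne x 0 with rfl | hx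
  · have : (fun x => f x * h x) =ᶠ[𝓝 0] fun _ => 0 := by
      filter_upwards [notMem_tsupport_iff_eventuallyEq.1 h0] with y hy
      simp [hy]
    exact continuousAt_const.congr this.symm
  · exact (hf.continuousAt (isOpen_compl_singleton.mem_nhds hx)).mul hh.continuousAt

/-- Green's second identity for a function that is `C²` off the origin, tested against a function
supported away from the origin. -/
lemma integral_mul_lap_of_zero_notMem_tsupport {n : ℕ} {v ζ : Euc n → ℝ}
    (hv : ContDiffOn ℝ 2 v {0}ᶜ) (hvc : HasCompactSupport v) (hζ : ContDiff ℝ 2 ζ)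
    (h0 : (0 : Euc n) ∉ tsupport ζ) :
    ∫ x, v x * lap ζ x = ∫ x, lap v x * ζ x := by
  have hopen : IsOpen ({0}ᶜ : Set (Euc n)) := isOpen_compl_singleton
  let e : Fin n → Euc n := fun i => EuclideanSpace.single i 1
  have hdv : ∀ i, ContDiffOn ℝ 1 (fun y => fderiv ℝ v y (e i)) {0}ᶜ := fun i =>
    (hv.fderiv_of_isOpen hopen (m := 1) (by norm_num)).clm_apply contDiffOn_const
  have hdζ : ∀ i, ContDiff ℝ 1 (fun y => fderiv ℝ ζ y (e i)) := fun i =>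
    (hζ.fderiv_right (m := 1) (by norm_num)).clm_apply contDiff_const
  have hsub : ∀ i, tsupport (fun y => fderiv ℝ ζ y (e i)) ⊆ tsupport ζ := fun i =>
    tsupport_fderiv_apply_subset ℝ (e i)
  have hsub2 : ∀ i, tsupport (fun y => fderiv ℝ (fun y => fderiv ℝ ζ y (e i)) y (e i)) ⊆
      tsupport ζ := fun i => (tsupport_fderiv_apply_subset ℝ (e i)).trans (hsub i)
  have hcv : ∀ i, HasCompactSupport (fun y => fderiv ℝ v y (e i)) := fun i =>
    hvc.fderiv_apply ℝ (e i)
  have hcv2 : ∀ i, HasCompactSupport (fun y => fderiv ℝ (fun y => fderiv ℝ v y (e i)) y (e i)) :=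
    fun i => (hcv i).fderiv_apply ℝ (e i)
  have c2ζ : ∀ i, Continuous (fun y => fderiv ℝ (fun y => fderiv ℝ ζ y (e i)) y (e i)) := fun i =>
    ((hdζ i).continuous_fderiv (by norm_num)).clm_apply continuous_const
  have c2v : ∀ i, ContinuousOn (fun y => fderiv ℝ (fun y => fderiv ℝ v y (e i)) y (e i)) {0}ᶜ :=
    fun i => ((hdv i).continuousOn_fderiv_of_isOpen hopen (by norm_num)).clm_apply
      continuousOn_const
  have i1 : ∀ i, Integrable (fun y => v y * fderiv ℝ (fun y => fderiv ℝ ζ y (e i)) y (e i)) :=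
    fun i => integrable_mul_of_zero_notMem_tsupport hv.continuousOn hvc (c2ζ i)
      fun h => h0 (hsub2 i h)
  have i2 : ∀ i, Integrable (fun y => fderiv ℝ v y (e i) * fderiv ℝ ζ y (e i)) :=
    fun i => integrable_mul_of_zero_notMem_tsupport (hdv i).continuousOn (hcv i)
      (hdζ i).continuous fun h => h0 (hsub i h)
  have i3 : ∀ i, Integrable (fun y => v y * fderiv ℝ ζ y (e i)) :=
    fun i => integrable_mul_of_zero_notMem_tsupport hv.continuousOn hvc
      (hdζ i).continuous fun h => h0 (hsub i h)
  have i4 : ∀ i, Integrable (fun y => fderiv ℝ v y (e i) * ζ y) :=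
    fun i => integrable_mul_of_zero_notMem_tsupport (hdv i).continuousOn (hcv i)
      hζ.continuous h0
  have i5 : ∀ i, Integrable (fun y => fderiv ℝ (fun y => fderiv ℝ v y (e i)) y (e i) * ζ y) :=
    fun i => integrable_mul_of_zero_notMem_tsupport (c2v i) (hcv2 i) hζ.continuous h0
  have key : ∀ i, ∫ y, v y * fderiv ℝ (fun y => fderiv ℝ ζ y (e i)) y (e i) =
      ∫ y, fderiv ℝ (fun y => fderiv ℝ v y (e i)) y (e i) * ζ y := by
    intro i
    rw [integral_mul_fderiv_eq_neg_fderiv_mul_of_integrable (i2 i) (i1 i) (i3 i)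
        (fun x hx => ((hv.differentiableOn (by norm_num)).differentiableAt
          (hopen.mem_nhds fun h => h0 (hsub i (h ▸ hx)))))
        (fun x _ => (hdζ i).differentiable (by norm_num) x),
      integral_mul_fderiv_eq_neg_fderiv_mul_of_integrable (i5 i) (i2 i) (i4 i)
        (fun x hx => (((hdv i).differentiableOn (by norm_num)).differentiableAt
          (hopen.mem_nhds fun h => h0 (h ▸ hx))))
        (fun x _ => hζ.differentiable (by norm_num) x), neg_neg]
  calc ∫ x, v x * lap ζ x
      = ∫ x, ∑ i, v x * fderiv ℝ (fun y => fderiv ℝ ζ y (e i)) x (e i) := by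
        refine integral_congr_ae (.of_forall fun x => ?_)
        simp only [lap_eq_sum_fderiv_fderiv hζ.contDiffAt, Finset.mul_sum, e]
    _ = ∫ x, ∑ i, fderiv ℝ (fun y => fderiv ℝ v y (e i)) x (e i) * ζ x := by
        rw [integral_finsetSum _ fun i _ => i1 i, integral_finsetSum _ fun i _ => i5 i]
        exact Finset.sum_congr rfl fun i _ => key i
    _ = ∫ x, lap v x * ζ x := by
        refine integral_congr_ae (.of_forall fun x => ?_)
        rcases eq_or_ne x 0 with rfl | hx
        · simp [image_eq_zero_of_notMem_tsupport h0]
        · simp only [lap_eq_sum_fderiv_fderiv (hv.contDiffAt (hopen.mem_nhds hx)),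
            Finset.sum_mul, e]

/-- A cutoff vanishing near the origin, equal to `1` far away, with scale-invariant derivative
bounds. -/
lemma exists_cutoff_away_from_zero (n : ℕ) : ∃ η : Euc n → ℝ, ContDiff ℝ 2 η ∧ η =ᶠ[𝓝 0] 0 ∧
    (∀ z, 2 < ‖z‖ → η =ᶠ[𝓝 z] 1) ∧ (∀ z, |η z| ≤ 1) ∧
    ∃ C : ℝ, 0 ≤ C ∧ ∀ i ≤ 2, ∀ z, ‖z‖ ^ i * ‖iteratedFDeriv ℝ i η z‖ ≤ C := by
  let b : ContDiffBump (0 : Euc n) := ⟨1, 2, one_pos, one_lt_two⟩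
  let η : Euc n → ℝ := fun z => 1 - b z
  have hη : ContDiff ℝ 2 η := contDiff_const.sub b.contDiff
  have hone : ∀ z, 2 < ‖z‖ → η =ᶠ[𝓝 z] 1 := by
    intro z hz
    filter_upwards [(isOpen_lt continuous_const continuous_norm).mem_nhds hz] with y hy
    have : b y = 0 := b.zero_of_le_dist (by simpa using le_of_lt hy)
    simp [η, this]
  have habs : ∀ z, |η z| ≤ 1 := fun z => by
    have h0 := b.nonneg (x := z)
    have h1 := b.le_one (x := z)
    rw [abs_le]
    constructor <;> simp only [η] <;> linarith
  refine ⟨η, hη, ?_, hone, habs, ?_⟩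
  · filter_upwards [b.eventuallyEq_one] with y hy
    simp [η, hy]
  · have hbd : ∀ i ≤ 2, ∃ C, ∀ z, ‖z‖ ^ i * ‖iteratedFDeriv ℝ i η z‖ ≤ C := by
      intro i hi
      have hc : Continuous fun z => ‖z‖ ^ i * ‖iteratedFDeriv ℝ i η z‖ :=
        (continuous_norm.pow i).mul
          (hη.continuous_iteratedFDeriv (m := i) (by exact_mod_cast hi)).norm
      obtain ⟨C, hC⟩ := (isCompact_closedBall (0 : Euc n) 2).bddAbove_image hc.continuousOn
      refine ⟨max C 1, fun z => ?_⟩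
      by_cases hz : ‖z‖ ≤ 2
      · exact (hC ⟨z, by simpa using hz, rfl⟩).trans (le_max_left _ _)
      · rcases Nat.eq_zero_or_pos i with rfl | hi0
        · simpa using Or.inr (habs z)
        · have h := (Filter.EventuallyEq.iteratedFDeriv ℝ (hone z (not_le.1 hz)) i).eq_of_nhds
          rw [h, show (1 : Euc n → ℝ) = fun _ => 1 from rfl,
            iteratedFDeriv_const_of_ne hi0.ne']
          simp
    choose! C hC using hbd
    refine ⟨max (max (C 0) (C 1)) (C 2), ?_, ?_⟩
    · have := hC 0 (by norm_num) 0
      exact le_trans (by positivity) (this.trans ((le_max_left _ _).trans (le_max_left _ _)))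
    · intro i hi z
      refine (hC i hi z).trans ?_
      interval_cases i <;> simp

lemma integrableOn_ball_norm_rpow {n : ℕ} (hn : 1 ≤ n) {s : ℝ} (hs : s < n) (R : ℝ) :
    IntegrableOn (fun z : Euc n => ‖z‖ ^ (-s)) (ball 0 R) := by
  refine integrableOn_ball_of_norm_le_rpow (C := 1) (α := s) (by simpa using hn)
    (by simpa using hs) (.of_forall fun x => ?_) ?_
  · rw [Real.norm_of_nonneg (by positivity), one_mul]
  · exact (measurable_norm.pow_const _).aestronglyMeasurable

lemma norm_iteratedFDeriv_two_cutoff_mul_le {n : ℕ} {η ψ : Euc n → ℝ} {C D R c : ℝ}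
    (hη : ContDiff ℝ 2 η) (hψ : ContDiff ℝ 2 ψ) (hC : 0 ≤ C) (hR : 1 ≤ R)
    (hηC : ∀ i ≤ 2, ∀ z, ‖z‖ ^ i * ‖iteratedFDeriv ℝ i η z‖ ≤ C) (hc : 0 < c)
    {y : Euc n} (hψD : ∀ i ≤ 2, ‖iteratedFDeriv ℝ i ψ y‖ ≤ D) (hy0 : y ≠ 0) (hyR : ‖y‖ ≤ R) :
    ‖iteratedFDeriv ℝ 2 (fun z => η (c • z) * ψ z) y‖ ≤ 4 * C * D * R ^ 2 * ‖y‖ ^ (-2 : ℝ) := by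
  have hy : 0 < ‖y‖ := norm_pos_iff.2 hy0
  have hηc : ContDiff ℝ 2 fun z => η (c • z) := hη.comp (contDiff_const_smul c)
  have hD : 0 ≤ D := (norm_nonneg _).trans (hψD 0 (by norm_num))
  have hfac : ∀ i ≤ 2, ‖iteratedFDeriv ℝ i (fun z => η (c • z)) y‖ ≤
      C * R ^ 2 * ‖y‖ ^ (-2 : ℝ) := by
    intro i hi
    rw [iteratedFDeriv_comp_const_smul c (hη.of_le (by exact_mod_cast hi))]
    have h1 := hηC i hi (c • y)
    rw [norm_smul, Real.norm_of_nonneg hc.le, mul_pow] at h1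
    have h2 : ‖y‖ ^ (2 - i) ≤ R ^ 2 :=
      (pow_le_pow_left₀ hy.le hyR _).trans (pow_le_pow_right₀ hR (by omega))
    rw [norm_smul, norm_pow, Real.norm_of_nonneg hc.le, Real.rpow_neg hy.le, ← div_eq_mul_inv,
      le_div_iff₀ (by positivity)]
    have h3 : ‖y‖ ^ (2 : ℝ) = ‖y‖ ^ i * ‖y‖ ^ (2 - i) := by
      rw [← pow_add, Nat.add_sub_cancel' hi]; exact_mod_cast Real.rpow_natCast ‖y‖ 2
    rw [h3]
    calc _ = (c ^ i * ‖y‖ ^ i * ‖iteratedFDeriv ℝ i η (c • y)‖) * ‖y‖ ^ (2 - i) := by ring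
      _ ≤ C * R ^ 2 := mul_le_mul h1 h2 (by positivity) hC
  refine (norm_iteratedFDeriv_mul_le hηc hψ y (n := 2) le_rfl).trans ?_
  calc _ ≤ ∑ i ∈ Finset.range 3, (Nat.choose 2 i : ℝ) * (C * R ^ 2 * ‖y‖ ^ (-2 : ℝ)) * D := by
        refine Finset.sum_le_sum fun i hi => ?_
        have hi2 : i ≤ 2 := by simpa [Nat.lt_succ_iff] using hi
        have := hfac i hi2
        have := hψD (2 - i) (by omega)
        gcongr
    _ = _ := by
        simp only [Finset.sum_range_succ, Finset.sum_range_zero]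
        norm_num [Nat.choose]
        ring

/-- Bounded singularities are removable for the Laplacian in the sense of distributions. -/
lemma integral_mul_lap_eq_of_bounded {n : ℕ} (hn : 3 ≤ n) {v ψ : Euc n → ℝ} {M : ℝ}
    (hv : ContDiffOn ℝ 2 v {0}ᶜ) (hvc : HasCompactSupport v) (hvM : ∀ x ≠ 0, |v x| ≤ M)
    (hlM : ∀ x ≠ 0, |lap v x| ≤ M) (hψ : ContDiff ℝ 2 ψ) :
    ∫ x, v x * lap ψ x = ∫ x, lap v x * ψ x := by
  obtain ⟨η, hη, hη0, hη1, hηabs, C, hC, hηC⟩ := exists_cutoff_away_from_zero n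
  have : Nontrivial (Euc n) := by
    have : Nonempty (Fin n) := ⟨⟨0, by omega⟩⟩
    infer_instance
  have hM : 0 ≤ M := by
    obtain ⟨x, hx⟩ := exists_ne (0 : Euc n)
    exact (abs_nonneg _).trans (hvM x hx)
  obtain ⟨R, hR1, hR⟩ : ∃ R : ℝ, 1 ≤ R ∧ tsupport v ⊆ ball 0 R := by
    obtain ⟨R, hR⟩ := hvc.isBounded.subset_ball (0 : Euc n)
    exact ⟨max R 1, le_max_right _ _, hR.trans (ball_subset_ball (le_max_left _ _))⟩
  have hne : ∀ᵐ x : Euc n, x ≠ 0 := by simp [ae_iff]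
  have hopen : IsOpen ({0}ᶜ : Set (Euc n)) := isOpen_compl_singleton
  have hv0 : ∀ x ∉ ball (0 : Euc n) R, v x = 0 := fun x hx =>
    image_eq_zero_of_notMem_tsupport fun h => hx (hR h)
  have hl0 : ∀ x ∉ ball (0 : Euc n) R, lap v x = 0 := fun x hx => by
    have h1 := (Filter.EventuallyEq.iteratedFDeriv ℝ
      (notMem_tsupport_iff_eventuallyEq.1 fun h => hx (hR h)) 2).eq_of_nhds
    simp only [lap, h1]
    simp [show (0 : Euc n → ℝ) = fun _ => 0 from rfl]
  have hmeas : ∀ {f : Euc n → ℝ}, ContinuousOn f {0}ᶜ → AEStronglyMeasurable f :=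
    aestronglyMeasurable_of_continuousOn_compl_zero (by omega)
  have hvmeas := hmeas hv.continuousOn
  have hlmeas := hmeas (continuousOn_lap hopen hv)
  obtain ⟨D, hD⟩ : ∃ D, ∀ i ≤ 2, ∀ y ∈ closedBall (0 : Euc n) R, ‖iteratedFDeriv ℝ i ψ y‖ ≤ D := by
    have : ∀ i ≤ 2, ∃ D, ∀ y ∈ closedBall (0 : Euc n) R, ‖iteratedFDeriv ℝ i ψ y‖ ≤ D := by
      intro i hi
      exact (isCompact_closedBall (0 : Euc n) R).exists_bound_of_continuousOn
        (hψ.continuous_iteratedFDeriv (m := i) (by exact_mod_cast hi)).continuousOn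
    choose! D hD using this
    refine ⟨max (max (D 0) (D 1)) (D 2), fun i hi y hy => (hD i hi y hy).trans ?_⟩
    interval_cases i <;> simp
  let c : ℕ → ℝ := fun k => k + 1
  have hc : ∀ k, 0 < c k := fun k => by positivity
  have hctop : Tendsto c atTop atTop :=
    tendsto_atTop_add_const_right _ _ tendsto_natCast_atTop_atTop
  let ζ : ℕ → Euc n → ℝ := fun k y => η (c k • y) * ψ y
  have hηc : ∀ k, ContDiff ℝ 2 fun z => η (c k • z) := fun k => hη.comp (contDiff_const_smul _)
  have hζ : ∀ k, ContDiff ℝ 2 (ζ k) := fun k => (hηc k).mul hψ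
  have hζ0 : ∀ k, (0 : Euc n) ∉ tsupport (ζ k) := fun k => by
    rw [notMem_tsupport_iff_eventuallyEq]
    have h : Tendsto (fun y : Euc n => c k • y) (𝓝 0) (𝓝 0) := by
      simpa using (continuous_const_smul (c k)).tendsto (0 : Euc n)
    filter_upwards [h.eventually hη0] with y hy
    simp [ζ, hy]
  have hev : ∀ y ≠ 0, ∀ᶠ k in atTop, ζ k =ᶠ[𝓝 y] ψ := fun y hy => by
    have hpos : 0 < ‖y‖ := norm_pos_iff.2 hy
    filter_upwards [hctop.eventually_gt_atTop (2 / ‖y‖)] with k hk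
    have h2 : 2 < ‖c k • y‖ := by
      rw [norm_smul, Real.norm_of_nonneg (hc k).le]
      rwa [div_lt_iff₀ hpos] at hk
    filter_upwards [((continuous_const_smul (c k)).tendsto y).eventually (hη1 _ h2)] with z hz
    simp [ζ, hz]
  have key : ∀ k, ∫ x, v x * lap (ζ k) x = ∫ x, lap v x * ζ k x := fun k =>
    integral_mul_lap_of_zero_notMem_tsupport hv hvc (hζ k) (hζ0 k)
  have lim1 : Tendsto (fun k => ∫ x, v x * lap (ζ k) x) atTop (𝓝 (∫ x, v x * lap ψ x)) := by
    refine tendsto_integral_of_dominated_convergence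
      ((ball (0 : Euc n) R).indicator
        fun y => M * (n * (4 * C * D * R ^ 2)) * ‖y‖ ^ (-2 : ℝ)) ?_ ?_ ?_ ?_
    · intro k
      have : Continuous (lap (ζ k)) := by
        rw [← continuousOn_univ]; exact continuousOn_lap isOpen_univ (hζ k).contDiffOn
      exact hvmeas.mul this.aestronglyMeasurable
    · rw [integrable_indicator_iff measurableSet_ball]
      exact (integrableOn_ball_norm_rpow (by omega)
        (by exact_mod_cast (by omega : 2 < n)) R).const_mul _
    · intro k
      filter_upwards [hne] with y hy
      by_cases hyR : y ∈ ball (0 : Euc n) R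
      · rw [indicator_of_mem hyR, norm_mul, Real.norm_eq_abs, Real.norm_eq_abs, mul_assoc]
        have hb := norm_iteratedFDeriv_two_cutoff_mul_le hη hψ hC hR1 hηC (hc k)
          (fun i hi => hD i hi y (ball_subset_closedBall hyR)) hy
          (by simpa using (mem_ball_zero_iff.1 hyR).le)
        refine mul_le_mul (hvM y hy) ((abs_lap_le _ _).trans ?_) (abs_nonneg _) hM
        rw [mul_assoc]
        exact mul_le_mul_of_nonneg_left hb (by positivity)
      · simp [hv0 y hyR, hyR]
    · filter_upwards [hne] with y hy
      refine tendsto_const_nhds.congr' ?_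
      filter_upwards [hev y hy] with k hk
      rw [lap_congr_of_eventuallyEq hk]
  have lim2 : Tendsto (fun k => ∫ x, lap v x * ζ k x) atTop (𝓝 (∫ x, lap v x * ψ x)) := by
    refine tendsto_integral_of_dominated_convergence
      ((ball (0 : Euc n) R).indicator fun _ => M * D) ?_ ?_ ?_ ?_
    · exact fun k => hlmeas.mul (hζ k).continuous.aestronglyMeasurable
    · rw [integrable_indicator_iff measurableSet_ball]
      exact integrableOn_const measure_ball_lt_top.ne
    · intro k
      filter_upwards [hne] with y hy
      by_cases hyR : y ∈ ball (0 : Euc n) R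
      · rw [indicator_of_mem hyR, norm_mul, Real.norm_eq_abs, Real.norm_eq_abs]
        have hb := hD 0 (by norm_num) y (ball_subset_closedBall hyR)
        rw [norm_iteratedFDeriv_zero, Real.norm_eq_abs] at hb
        refine mul_le_mul (hlM y hy) ?_ (abs_nonneg _) hM
        rw [abs_mul]
        exact (mul_le_of_le_one_left (abs_nonneg _) (hηabs _)).trans hb
      · simp [hl0 y hyR, hyR]
    · filter_upwards [hne] with y hy
      refine tendsto_const_nhds.congr' ?_
      filter_upwards [hev y hy] with k hk
      rw [hk.eq_of_nhds]
  simp only [key] at lim1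
  exact tendsto_nhds_unique lim1 lim2

/-- The regularized fundamental solution `(|z|² + ε²)^(1 - n/2)`, up to normalization. -/
noncomputable def regKernel (n : ℕ) (ε : ℝ) (z : Euc n) : ℝ :=
  (‖z‖ ^ 2 + ε ^ 2) ^ (1 - (n : ℝ) / 2)

/-- The gradient of `regKernel`. -/
noncomputable def regKernelGrad (n : ℕ) (ε : ℝ) (z : Euc n) : Euc n →L[ℝ] ℝ :=
  ((2 - n) * (‖z‖ ^ 2 + ε ^ 2) ^ (-((n : ℝ) / 2))) • innerSL ℝ z

lemma normSq_add_sq_pos {n : ℕ} {ε : ℝ} (hε : ε ≠ 0) (z : Euc n) : 0 < ‖z‖ ^ 2 + ε ^ 2 := by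
  positivity

lemma hasFDerivAt_normSq_add_sq_rpow {n : ℕ} {ε : ℝ} (hε : ε ≠ 0) (p : ℝ) (x y : Euc n) :
    HasFDerivAt (fun y : Euc n => (‖y - x‖ ^ 2 + ε ^ 2) ^ p)
      ((2 * p * (‖y - x‖ ^ 2 + ε ^ 2) ^ (p - 1)) • innerSL ℝ (y - x)) y := by
  have h1 : HasFDerivAt (fun y : Euc n => ‖y - x‖ ^ 2 + ε ^ 2) ((2 : ℝ) • innerSL ℝ (y - x)) y := by
    have := ((hasFDerivAt_id (𝕜 := ℝ) y).sub_const x).norm_sq.add_const (ε ^ 2)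
    refine this.congr_fderiv ?_
    ext z
    simp
  refine (h1.rpow_const (p := p) (Or.inl (normSq_add_sq_pos hε _).ne')).congr_fderiv ?_
  rw [smul_smul]
  ring_nf

lemma hasFDerivAt_regKernel_sub {n : ℕ} {ε : ℝ} (hε : ε ≠ 0) (x y : Euc n) :
    HasFDerivAt (fun y => regKernel n ε (y - x)) (regKernelGrad n ε (y - x)) y := by
  have h := hasFDerivAt_normSq_add_sq_rpow hε (1 - (n : ℝ) / 2) x y
  refine h.congr_fderiv ?_
  rw [regKernelGrad]
  ring_nf

lemma contDiff_regKernel_sub {n : ℕ} {ε : ℝ} (hε : ε ≠ 0) (x : Euc n) :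
    ContDiff ℝ 2 (fun y => regKernel n ε (y - x)) := by
  refine ContDiff.rpow_const_of_ne ?_ fun y => (normSq_add_sq_pos hε (y - x)).ne'
  exact ((contDiff_id.sub contDiff_const).norm_sq ℝ).add contDiff_const

lemma lap_regKernel_sub {n : ℕ} {ε : ℝ} (hε : ε ≠ 0) (x y : Euc n) :
    lap (fun y => regKernel n ε (y - x)) y =
      -(n * (n - 2) * ε ^ 2 * (‖y - x‖ ^ 2 + ε ^ 2) ^ (-((n : ℝ) + 2) / 2)) := by
  rw [lap_eq_sum_fderiv_fderiv (contDiff_regKernel_sub hε x).contDiffAt]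
  have hS := normSq_add_sq_pos hε (y - x)
  have hpow : (‖y - x‖ ^ 2 + ε ^ 2) ^ (-((n : ℝ) / 2)) =
      (‖y - x‖ ^ 2 + ε ^ 2) ^ (-((n : ℝ) + 2) / 2) * (‖y - x‖ ^ 2 + ε ^ 2) := by
    rw [← Real.rpow_add_one hS.ne']
    ring_nf
  have hi : ∀ i : Fin n, fderiv ℝ (fun z => fderiv ℝ (fun y => regKernel n ε (y - x)) z
      (EuclideanSpace.single i 1)) y (EuclideanSpace.single i 1) =
      (2 - n) * (‖y - x‖ ^ 2 + ε ^ 2) ^ (-((n : ℝ) / 2)) -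
        (2 - n) * n * (‖y - x‖ ^ 2 + ε ^ 2) ^ (-((n : ℝ) + 2) / 2) * ((y - x) i) ^ 2 := by
    intro i
    have h1 : (fun z => fderiv ℝ (fun y => regKernel n ε (y - x)) z (EuclideanSpace.single i 1)) =
        fun z => ((2 - n) * (‖z - x‖ ^ 2 + ε ^ 2) ^ (-((n : ℝ) / 2))) *
          inner ℝ (EuclideanSpace.single i 1) (z - x) := by
      ext z
      rw [(hasFDerivAt_regKernel_sub hε x z).fderiv, regKernelGrad]
      simp [EuclideanSpace.inner_single_left, EuclideanSpace.inner_single_right]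
    have h2 := (hasFDerivAt_normSq_add_sq_rpow hε (-((n : ℝ) / 2)) x y).const_mul (2 - (n : ℝ))
    have h3 : HasFDerivAt (fun z : Euc n => inner ℝ (EuclideanSpace.single i (1 : ℝ)) (z - x))
        (innerSL ℝ (EuclideanSpace.single i (1 : ℝ))) y :=
      (innerSL ℝ (EuclideanSpace.single i (1 : ℝ))).hasFDerivAt.comp y
        ((hasFDerivAt_id (𝕜 := ℝ) y).sub_const x)
    have h4 := (h2.mul h3).fderiv
    simp only [Pi.mul_def] at h4
    rw [h1, h4]
    simp [EuclideanSpace.inner_single_left, EuclideanSpace.inner_single_right]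
    rw [show -((n : ℝ) / 2) - 1 = -((n : ℝ) + 2) / 2 by ring]
    ring_nf
  have hsum : ∑ i, ((y - x) i) ^ 2 = ‖y - x‖ ^ 2 := (EuclideanSpace.real_norm_sq_eq _).symm
  simp only [hi, Finset.sum_sub_distrib, ← Finset.mul_sum, hsum, Finset.sum_const,
    Finset.card_univ, Fintype.card_fin, nsmul_eq_mul, hpow]
  ring

/-- The Laplacians of the regularized kernels form an approximate identity. -/
lemma tendsto_integral_mul_lap_regKernel {n : ℕ} {v : Euc n → ℝ} {M : ℝ}
    (hvm : AEStronglyMeasurable v) (hvM : ∀ᵐ x, |v x| ≤ M) {ε : ℕ → ℝ}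
    (hε : ∀ k, 0 < ε k) (hε0 : Tendsto ε atTop (𝓝 0)) {x : Euc n} (hx : ContinuousAt v x) :
    Tendsto (fun k => ∫ y, v y * lap (fun y => regKernel n (ε k) (y - x)) y) atTop
      (𝓝 (-(n * (n - 2) * ∫ z : Euc n, (1 + ‖z‖ ^ 2) ^ (-((n : ℝ) + 2) / 2)) * v x)) := by
  have hint : Integrable fun z : Euc n => (1 + ‖z‖ ^ 2) ^ (-((n : ℝ) + 2) / 2) :=
    integrable_rpow_neg_one_add_norm_sq (by simp)
  have hmp : ∀ k, Measure.QuasiMeasurePreserving (fun z : Euc n => x + ε k • z) := fun k =>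
    (measurePreserving_add_left volume x).quasiMeasurePreserving.comp
      (Measure.quasiMeasurePreserving_smul volume (hε k).ne')
  have hscale : ∀ k, ∫ y, v y * lap (fun y => regKernel n (ε k) (y - x)) y =
      ∫ z, -(n * (n - 2)) * (v (x + ε k • z) * (1 + ‖z‖ ^ 2) ^ (-((n : ℝ) + 2) / 2)) := by
    intro k
    have hk := hε k
    rw [← integral_add_left_eq_self _ x]
    have h := Measure.integral_comp_smul_of_nonneg (volume : Measure (Euc n))
      (fun y => v (x + y) * lap (fun y => regKernel n (ε k) (y - x)) (x + y)) (ε k) (hR := hk.le)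
    rw [eq_inv_smul_iff₀ (by positivity), finrank_euclideanSpace_fin, smul_eq_mul,
      ← integral_const_mul] at h
    rw [← h]
    refine integral_congr_ae (.of_forall fun z => ?_)
    have hpos : 0 < 1 + ‖z‖ ^ 2 := by positivity
    have h1 : ‖ε k • z‖ ^ 2 + ε k ^ 2 = ε k ^ 2 * (1 + ‖z‖ ^ 2) := by
      rw [norm_smul, Real.norm_of_nonneg hk.le]
      ring
    have h2 : (ε k ^ 2) ^ (-((n : ℝ) + 2) / 2) = (ε k ^ n * ε k ^ 2)⁻¹ := by
      rw [← Real.rpow_natCast_mul hk.le, ← pow_add, ← Real.rpow_natCast, ← Real.rpow_neg hk.le]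
      push_cast
      ring_nf
    simp only [lap_regKernel_sub hk.ne', add_sub_cancel_left]
    rw [h1, Real.mul_rpow (by positivity) hpos.le, h2]
    field_simp
  simp only [hscale]
  have : -(n * (n - 2) * ∫ z : Euc n, (1 + ‖z‖ ^ 2) ^ (-((n : ℝ) + 2) / 2)) * v x =
      ∫ z : Euc n, -(n * (n - 2)) * (v x * (1 + ‖z‖ ^ 2) ^ (-((n : ℝ) + 2) / 2)) := by
    rw [integral_const_mul, integral_const_mul]
    ring
  rw [this]
  refine tendsto_integral_of_dominated_convergence
    (fun z => |(n : ℝ) * (n - 2)| * (M * (1 + ‖z‖ ^ 2) ^ (-((n : ℝ) + 2) / 2))) ?_ ?_ ?_ ?_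
  · exact fun k => ((hvm.comp_quasiMeasurePreserving (hmp k)).mul
      hint.aestronglyMeasurable).const_mul _
  · exact (hint.const_mul _).const_mul _
  · intro k
    filter_upwards [(hmp k).ae hvM] with z hz
    rw [norm_mul, norm_neg, Real.norm_eq_abs, norm_mul, Real.norm_eq_abs,
      Real.norm_of_nonneg (by positivity)]
    gcongr
  · refine .of_forall fun z => ?_
    have h1 : Tendsto (fun k => x + ε k • z) atTop (𝓝 x) := by
      simpa using tendsto_const_nhds.add (hε0.smul_const z)
    exact ((hx.tendsto.comp h1).mul_const _).const_mul _

lemma abs_regKernel_le {n : ℕ} (hn : 2 ≤ n) (ε : ℝ) {z : Euc n} (hz : z ≠ 0) :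
    |regKernel n ε z| ≤ ‖z‖ ^ (-((n : ℝ) - 2)) := by
  have hz' : 0 < ‖z‖ := norm_pos_iff.2 hz
  have hn' : (2 : ℝ) ≤ n := by exact_mod_cast hn
  rw [regKernel, abs_of_nonneg (by positivity)]
  refine (Real.rpow_le_rpow_of_nonpos (by positivity)
    (le_add_of_nonneg_right (sq_nonneg ε)) (by linarith)).trans_eq ?_
  rw [← Real.rpow_natCast_mul hz'.le]
  push_cast
  ring_nf

lemma norm_regKernelGrad_eq {n : ℕ} (hn : 2 ≤ n) (ε : ℝ) (z : Euc n) :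
    ‖regKernelGrad n ε z‖ = (n - 2) * ((‖z‖ ^ 2 + ε ^ 2) ^ (-((n : ℝ) / 2)) * ‖z‖) := by
  have hn' : (2 : ℝ) ≤ n := by exact_mod_cast hn
  rw [regKernelGrad, norm_smul, innerSL_apply_norm, norm_mul,
    Real.norm_of_nonneg (by positivity : 0 ≤ (‖z‖ ^ 2 + ε ^ 2) ^ (-((n : ℝ) / 2))),
    Real.norm_of_nonpos (by linarith)]
  ring

lemma norm_regKernelGrad_le {n : ℕ} (hn : 2 ≤ n) (ε : ℝ) {z : Euc n} (hz : z ≠ 0) :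
    ‖regKernelGrad n ε z‖ ≤ (n - 2) * ‖z‖ ^ (-((n : ℝ) - 1)) := by
  have hz' : 0 < ‖z‖ := norm_pos_iff.2 hz
  have hn' : (2 : ℝ) ≤ n := by exact_mod_cast hn
  rw [norm_regKernelGrad_eq hn]
  have h1 : (‖z‖ ^ 2 + ε ^ 2) ^ (-((n : ℝ) / 2)) ≤ (‖z‖ ^ 2) ^ (-((n : ℝ) / 2)) :=
    Real.rpow_le_rpow_of_nonpos (by positivity)
      (le_add_of_nonneg_right (sq_nonneg ε)) (by linarith)
  have h2 : ‖z‖ ^ (-((n : ℝ) - 1)) = (‖z‖ ^ 2) ^ (-((n : ℝ) / 2)) * ‖z‖ := by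
    rw [← Real.rpow_natCast_mul hz'.le, ← Real.rpow_add_one hz'.ne']
    push_cast
    ring_nf
  rw [h2]
  have : (0 : ℝ) ≤ n - 2 := by linarith
  gcongr

lemma abs_regKernel_le_const {n : ℕ} (hn : 2 ≤ n) {ε : ℝ} (hε : ε ≠ 0) (z : Euc n) :
    |regKernel n ε z| ≤ (ε ^ 2) ^ (1 - (n : ℝ) / 2) := by
  have hn' : (2 : ℝ) ≤ n := by exact_mod_cast hn
  rw [regKernel, abs_of_nonneg (by positivity)]
  exact Real.rpow_le_rpow_of_nonpos (by positivity)
    (le_add_of_nonneg_left (sq_nonneg ‖z‖)) (by linarith)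

lemma norm_regKernelGrad_le_const {n : ℕ} (hn : 2 ≤ n) {ε : ℝ} (hε : ε ≠ 0) (z : Euc n) :
    ‖regKernelGrad n ε z‖ ≤ (n - 2) * (ε ^ 2) ^ (1 / 2 - (n : ℝ) / 2) := by
  have hn' : (2 : ℝ) ≤ n := by exact_mod_cast hn
  have hS := normSq_add_sq_pos hε z
  rw [norm_regKernelGrad_eq hn]
  refine mul_le_mul_of_nonneg_left ?_ (by linarith)
  have h1 : ‖z‖ ≤ (‖z‖ ^ 2 + ε ^ 2) ^ (1 / 2 : ℝ) := by
    rw [← Real.sqrt_eq_rpow]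
    exact Real.le_sqrt_of_sq_le (le_add_of_nonneg_right (sq_nonneg ε))
  calc _ ≤ (‖z‖ ^ 2 + ε ^ 2) ^ (-((n : ℝ) / 2)) * (‖z‖ ^ 2 + ε ^ 2) ^ (1 / 2 : ℝ) := by gcongr
    _ = (‖z‖ ^ 2 + ε ^ 2) ^ (1 / 2 - (n : ℝ) / 2) := by
      rw [← Real.rpow_add hS]
      ring_nf
    _ ≤ _ := Real.rpow_le_rpow_of_nonpos (by positivity)
      (le_add_of_nonneg_left (sq_nonneg ‖z‖)) (by linarith)

lemma measurable_regKernel (n : ℕ) (ε : ℝ) : Measurable (regKernel n ε) :=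
  ((measurable_norm.pow_const 2).add_const _).pow_const _

lemma stronglyMeasurable_regKernelGrad (n : ℕ) (ε : ℝ) :
    StronglyMeasurable (regKernelGrad n ε) :=
  ((((measurable_norm.pow_const 2).add_const _).pow_const _).const_mul _).stronglyMeasurable.smul
    (innerSL ℝ).continuous.stronglyMeasurable

lemma continuous_regKernelGrad {n : ℕ} {ε : ℝ} (hε : ε ≠ 0) : Continuous (regKernelGrad n ε) :=
  (continuous_const.mul (((continuous_norm.pow 2).add continuous_const).rpow_const
    fun z => Or.inl (normSq_add_sq_pos hε z).ne')).smul (innerSL ℝ).continuous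

lemma tendsto_normSq_add_sq_rpow {n : ℕ} {ε : ℕ → ℝ} (hε0 : Tendsto ε atTop (𝓝 0)) {z : Euc n}
    (hz : z ≠ 0) (p : ℝ) :
    Tendsto (fun k => (‖z‖ ^ 2 + ε k ^ 2) ^ p) atTop (𝓝 ((‖z‖ ^ 2 + (0 : ℝ) ^ 2) ^ p)) := by
  refine ((hε0.pow 2).const_add _).rpow_const (Or.inl ?_)
  have := norm_pos_iff.2 hz
  positivity

lemma tendsto_regKernel {n : ℕ} {ε : ℕ → ℝ} (hε0 : Tendsto ε atTop (𝓝 0)) {z : Euc n}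
    (hz : z ≠ 0) : Tendsto (fun k => regKernel n (ε k) z) atTop (𝓝 (regKernel n 0 z)) :=
  tendsto_normSq_add_sq_rpow hε0 hz _

lemma tendsto_regKernelGrad {n : ℕ} {ε : ℕ → ℝ} (hε0 : Tendsto ε atTop (𝓝 0)) {z : Euc n}
    (hz : z ≠ 0) : Tendsto (fun k => regKernelGrad n (ε k) z) atTop (𝓝 (regKernelGrad n 0 z)) :=
  ((tendsto_normSq_add_sq_rpow hε0 hz _).const_mul _).smul_const _

lemma hasFDerivAt_regKernel_const_sub {n : ℕ} {ε : ℝ} (hε : ε ≠ 0) (x y : Euc n) :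
    HasFDerivAt (fun x => regKernel n ε (y - x)) (-regKernelGrad n ε (y - x)) x := by
  have h := hasFDerivAt_regKernel_sub hε y x
  have h1 : (fun x => regKernel n ε (y - x)) = fun x => regKernel n ε (x - y) := by
    ext x
    rw [regKernel, regKernel, norm_sub_rev]
  rw [h1]
  refine h.congr_fderiv ?_
  rw [regKernelGrad, regKernelGrad, norm_sub_rev]
  ext z
  simp only [FunLike.coe_smul, FunLike.coe_neg, Pi.smul_apply, Pi.neg_apply,
    innerSL_apply_apply, ← neg_sub y x, inner_neg_left, smul_neg]

lemma integrableOn_ball_comp_sub {n : ℕ} {F : Type*} [NormedAddCommGroup F] {h : Euc n → F}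
    {R R' : ℝ} {x : Euc n} (hh : IntegrableOn h (ball 0 R')) (hx : R + ‖x‖ ≤ R') :
    IntegrableOn (fun y => h (y - x)) (ball 0 R) := by
  have h1 := ((integrable_indicator_iff measurableSet_ball).2 hh).comp_sub_right x
  refine (h1.integrableOn (s := ball 0 R)).congr_fun (fun y hy => ?_) measurableSet_ball
  refine indicator_of_mem ?_ _
  rw [mem_ball_zero_iff] at hy ⊢
  linarith [norm_sub_le y x]

lemma setIntegral_ball_comp_sub_le {n : ℕ} {h : Euc n → ℝ} {R R' : ℝ} {x : Euc n}
    (h0 : ∀ z, 0 ≤ h z) (hh : IntegrableOn h (ball 0 R')) (hx : R + ‖x‖ ≤ R') :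
    ∫ y in ball 0 R, h (y - x) ≤ ∫ z in ball 0 R', h z := by
  have h1 := (integrable_indicator_iff measurableSet_ball).2 hh
  calc ∫ y in ball 0 R, h (y - x) = ∫ y in ball 0 R, (ball 0 R').indicator h (y - x) := by
        refine setIntegral_congr_fun measurableSet_ball fun y hy => (indicator_of_mem ?_ _).symm
        rw [mem_ball_zero_iff] at hy ⊢
        linarith [norm_sub_le y x]
    _ ≤ ∫ y, (ball 0 R').indicator h (y - x) :=
        setIntegral_le_integral (h1.comp_sub_right x)
          (.of_forall fun y => indicator_nonneg (fun z _ => h0 z) _)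
    _ = ∫ z in ball 0 R', h z := by
        rw [integral_sub_right_eq_self, integral_indicator measurableSet_ball]

lemma integrableOn_ball_norm_sub_rpow {n : ℕ} (hn : 1 ≤ n) {s : ℝ} (hs : s < n) (R : ℝ)
    (x : Euc n) : IntegrableOn (fun y : Euc n => ‖y - x‖ ^ (-s)) (ball 0 R) :=
  integrableOn_ball_comp_sub (integrableOn_ball_norm_rpow hn hs (R + ‖x‖)) le_rfl

/-- The Newtonian potential of a bounded density is the limit of its regularizations. -/
lemma tendsto_integral_mul_regKernel {n : ℕ} (hn : 2 ≤ n) {g : Euc n → ℝ} {C R : ℝ}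
    (hgm : AEStronglyMeasurable g)
    (hg : ∀ᵐ y, |g y| ≤ (ball (0 : Euc n) R).indicator (fun _ => C) y)
    {ε : ℕ → ℝ} (hε0 : Tendsto ε atTop (𝓝 0)) (x : Euc n) :
    Tendsto (fun k => ∫ y, g y * regKernel n (ε k) (y - x)) atTop
      (𝓝 (∫ y, g y * regKernel n 0 (y - x))) := by
  have : Nonempty (Fin n) := ⟨⟨0, by omega⟩⟩
  have hne : ∀ᵐ y : Euc n, y ≠ x := by simp [ae_iff]
  refine tendsto_integral_of_dominated_convergence
    ((ball (0 : Euc n) R).indicator fun y => C * ‖y - x‖ ^ (-((n : ℝ) - 2))) ?_ ?_ ?_ ?_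
  · exact fun k => hgm.mul
      ((measurable_regKernel n (ε k)).comp (measurable_id.sub_const x)).aestronglyMeasurable
  · rw [integrable_indicator_iff measurableSet_ball]
    exact (integrableOn_ball_norm_sub_rpow (by omega) (by linarith) R x).const_mul _
  · intro k
    filter_upwards [hg, hne] with y hy hyx
    rw [norm_mul, Real.norm_eq_abs, Real.norm_eq_abs]
    by_cases hyR : y ∈ ball (0 : Euc n) R
    · rw [indicator_of_mem hyR] at hy ⊢
      exact mul_le_mul hy (abs_regKernel_le hn _ (sub_ne_zero.2 hyx)) (abs_nonneg _)
        ((abs_nonneg _).trans hy)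
    · rw [indicator_of_notMem hyR] at hy ⊢
      rw [le_antisymm hy (abs_nonneg _), zero_mul]
  · filter_upwards [hne] with y hyx
    exact (tendsto_regKernel hε0 (sub_ne_zero.2 hyx)).const_mul _

lemma hasFDerivAt_integral_mul_regKernel {n : ℕ} (hn : 2 ≤ n) {g : Euc n → ℝ}
    (hg : Integrable g) {ε : ℝ} (hε : ε ≠ 0) (x : Euc n) :
    HasFDerivAt (fun x => ∫ y, g y * regKernel n ε (y - x))
      (∫ y, g y • -regKernelGrad n ε (y - x)) x := by
  refine hasFDerivAt_integral_of_dominated_of_fderiv_le (s := univ)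
    (F := fun x y => g y * regKernel n ε (y - x))
    (F' := fun x y => g y • -regKernelGrad n ε (y - x))
    (bound := fun y => |g y| * ((n - 2) * (ε ^ 2) ^ (1 / 2 - (n : ℝ) / 2)))
    univ_mem (.of_forall fun x => ?_) ?_ ?_ ?_ ?_ ?_
  · exact hg.aestronglyMeasurable.mul
      ((measurable_regKernel n ε).comp (measurable_id.sub_const x)).aestronglyMeasurable
  · refine hg.mul_bdd (c := (ε ^ 2) ^ (1 - (n : ℝ) / 2))
      ((measurable_regKernel n ε).comp (measurable_id.sub_const x)).aestronglyMeasurable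
      (.of_forall fun y => abs_regKernel_le_const hn hε _)
  · exact hg.aestronglyMeasurable.smul
      ((continuous_regKernelGrad hε).comp
        (continuous_id.sub continuous_const)).neg.aestronglyMeasurable
  · refine .of_forall fun y x _ => ?_
    rw [norm_smul, norm_neg, Real.norm_eq_abs]
    exact mul_le_mul_of_nonneg_left (norm_regKernelGrad_le_const hn hε _) (abs_nonneg _)
  · exact hg.abs.mul_const _
  · exact .of_forall fun y x _ => (hasFDerivAt_regKernel_const_sub hε x y).const_mul (g y)

lemma continuous_integral_smul_regKernelGrad {n : ℕ} (hn : 2 ≤ n) {g : Euc n → ℝ}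
    (hg : Integrable g) {ε : ℝ} (hε : ε ≠ 0) :
    Continuous fun x => ∫ y, g y • -regKernelGrad n ε (y - x) := by
  refine continuous_of_dominated
    (bound := fun y => |g y| * ((n - 2) * (ε ^ 2) ^ (1 / 2 - (n : ℝ) / 2))) ?_ ?_ ?_ ?_
  · exact fun x => hg.aestronglyMeasurable.smul
      ((continuous_regKernelGrad hε).comp
        (continuous_id.sub continuous_const)).neg.aestronglyMeasurable
  · refine fun x => .of_forall fun y => ?_
    rw [norm_smul, norm_neg, Real.norm_eq_abs]
    exact mul_le_mul_of_nonneg_left (norm_regKernelGrad_le_const hn hε _) (abs_nonneg _)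
  · exact hg.abs.mul_const _
  · exact .of_forall fun y => (((continuous_regKernelGrad hε).comp
      (continuous_const.sub continuous_id)).neg).const_smul (g y)

lemma integrableOn_ball_regKernelGrad {n : ℕ} (hn : 2 ≤ n) (ε R : ℝ) :
    IntegrableOn (regKernelGrad n ε) (ball 0 R) := by
  have : Nonempty (Fin n) := ⟨⟨0, by omega⟩⟩
  have hne : ∀ᵐ y : Euc n, y ≠ 0 := by simp [ae_iff]
  refine ((integrableOn_ball_norm_rpow (s := (n : ℝ) - 1) (by omega) (by linarith) R).const_mul
    ((n : ℝ) - 2)).mono' (stronglyMeasurable_regKernelGrad n ε).aestronglyMeasurable ?_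
  exact ae_restrict_of_ae (hne.mono fun y hy => norm_regKernelGrad_le hn ε hy)

lemma tendsto_setIntegral_norm_regKernelGrad_sub {n : ℕ} (hn : 2 ≤ n) {ε : ℕ → ℝ}
    (hε0 : Tendsto ε atTop (𝓝 0)) (R : ℝ) :
    Tendsto (fun k => ∫ z in ball 0 R, ‖regKernelGrad n (ε k) z - regKernelGrad n 0 z‖) atTop
      (𝓝 0) := by
  have : Nonempty (Fin n) := ⟨⟨0, by omega⟩⟩
  have hne : ∀ᵐ y : Euc n, y ≠ 0 := by simp [ae_iff]
  suffices h : Tendsto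
      (fun k => ∫ z in ball 0 R, ‖regKernelGrad n (ε k) z - regKernelGrad n 0 z‖) atTop
      (𝓝 (∫ z in ball (0 : Euc n) R, (0 : ℝ))) by rwa [integral_zero] at h
  refine tendsto_integral_of_dominated_convergence
    (fun z => 2 * ((n - 2) * ‖z‖ ^ (-((n : ℝ) - 1)))) ?_ ?_ ?_ ?_
  · exact fun k => ((stronglyMeasurable_regKernelGrad n (ε k)).sub
      (stronglyMeasurable_regKernelGrad n 0)).norm.aestronglyMeasurable
  · exact ((integrableOn_ball_norm_rpow (by omega) (by linarith) R).const_mul _).const_mul _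
  · intro k
    refine ae_restrict_of_ae (hne.mono fun z hz => ?_)
    rw [norm_norm]
    refine (norm_sub_le _ _).trans ?_
    rw [two_mul]
    exact add_le_add (norm_regKernelGrad_le hn _ hz) (norm_regKernelGrad_le hn _ hz)
  · refine ae_restrict_of_ae (hne.mono fun z hz => ?_)
    simpa using ((tendsto_regKernelGrad hε0 hz).sub_const (regKernelGrad n 0 z)).norm

/-- The Newtonian potential of a bounded compactly supported density is `C¹`. -/
lemma contDiffOn_newtonPotential {n : ℕ} (hn : 2 ≤ n) {g : Euc n → ℝ} {C R : ℝ} (hC : 0 ≤ C)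
    (hgm : AEStronglyMeasurable g)
    (hg : ∀ᵐ y, |g y| ≤ (ball (0 : Euc n) R).indicator (fun _ => C) y) :
    ContDiffOn ℝ 1 (fun x => ∫ y, g y * regKernel n 0 (y - x)) (ball 0 R) := by
  have hgi : Integrable g := by
    refine Integrable.mono' ?_ hgm hg
    rw [integrable_indicator_iff measurableSet_ball]
    exact integrableOn_const measure_ball_lt_top.ne
  obtain ⟨ε, -, hε, hε0⟩ := exists_seq_strictAnti_tendsto (0 : ℝ)
  have hε' : ∀ k, ε k ≠ 0 := fun k => (hε k).ne'
  let G : ℝ → Euc n → Euc n →L[ℝ] ℝ := fun e x => ∫ y, g y • -regKernelGrad n e (y - x)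
  have hGint : ∀ e, ∀ x ∈ ball (0 : Euc n) R,
      Integrable fun y => g y • -regKernelGrad n e (y - x) := by
    intro e x hx
    have h1 := integrableOn_ball_comp_sub (x := x) (R := R) (R' := R + R)
      (integrableOn_ball_regKernelGrad hn e (R + R))
      (by linarith [mem_ball_zero_iff.1 hx])
    rw [← integrable_indicator_iff measurableSet_ball] at h1
    refine (h1.norm.const_mul C).mono' (hgm.smul
      ((stronglyMeasurable_regKernelGrad n e).comp_measurable
        (measurable_id.sub_const x)).neg.aestronglyMeasurable) ?_
    filter_upwards [hg] with y hy
    rw [norm_smul, norm_neg, Real.norm_eq_abs]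
    by_cases hyR : y ∈ ball (0 : Euc n) R
    · rw [indicator_of_mem hyR] at hy ⊢
      exact mul_le_mul_of_nonneg_right hy (norm_nonneg _)
    · rw [indicator_of_notMem hyR] at hy ⊢
      simp [le_antisymm hy (abs_nonneg _)]
  have hunif : TendstoUniformlyOn (fun k => G (ε k)) (G 0) atTop (ball 0 R) := by
    rw [Metric.tendstoUniformlyOn_iff]
    intro δ hδ
    have hlim := (tendsto_setIntegral_norm_regKernelGrad_sub (n := n) hn hε0 (R + R)).const_mul C
    rw [mul_zero] at hlim
    filter_upwards [hlim.eventually_lt_const hδ] with k hk x hx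
    refine lt_of_le_of_lt ?_ hk
    have hD : IntegrableOn (fun z => ‖regKernelGrad n (ε k) z - regKernelGrad n 0 z‖)
        (ball 0 (R + R)) := ((integrableOn_ball_regKernelGrad hn _ _).sub
          (integrableOn_ball_regKernelGrad hn _ _)).norm
    have hxR : R + ‖x‖ ≤ R + R := by linarith [mem_ball_zero_iff.1 hx]
    have hD' := integrableOn_ball_comp_sub (R := R) hD hxR
    calc dist (G 0 x) (G (ε k) x)
        = ‖∫ y, (g y • -regKernelGrad n (ε k) (y - x) - g y • -regKernelGrad n 0 (y - x))‖ := by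
          rw [dist_comm, dist_eq_norm, integral_sub (hGint _ x hx) (hGint _ x hx)]
      _ ≤ ∫ y, (ball (0 : Euc n) R).indicator
            (fun y => C * ‖regKernelGrad n (ε k) (y - x) - regKernelGrad n 0 (y - x)‖) y := by
          refine norm_integral_le_of_norm_le
            ((integrable_indicator_iff measurableSet_ball).2 (hD'.const_mul C)) ?_
          filter_upwards [hg] with y hy
          have hsub : g y • -regKernelGrad n (ε k) (y - x) - g y • -regKernelGrad n 0 (y - x) =
              (-g y) • (regKernelGrad n (ε k) (y - x) - regKernelGrad n 0 (y - x)) := by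
            ext z
            simp
            ring
          rw [hsub, norm_smul, norm_neg, Real.norm_eq_abs]
          by_cases hyR : y ∈ ball (0 : Euc n) R
          · rw [indicator_of_mem hyR] at hy ⊢
            exact mul_le_mul_of_nonneg_right hy (norm_nonneg _)
          · rw [indicator_of_notMem hyR] at hy ⊢
            simp [le_antisymm hy (abs_nonneg _)]
      _ = C * ∫ y in ball 0 R, ‖regKernelGrad n (ε k) (y - x) - regKernelGrad n 0 (y - x)‖ := by
          rw [integral_indicator measurableSet_ball, integral_const_mul]
      _ ≤ _ := mul_le_mul_of_nonneg_left
          (setIntegral_ball_comp_sub_le (fun _ => norm_nonneg _) hD hxR) hC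
  have hderiv : ∀ x ∈ ball (0 : Euc n) R,
      HasFDerivAt (fun x => ∫ y, g y * regKernel n 0 (y - x)) (G 0 x) x := fun x hx =>
    hasFDerivAt_of_tendstoUniformlyOn isOpen_ball hunif
      (fun k x _ => hasFDerivAt_integral_mul_regKernel hn hgi (hε' k) x)
      (fun x _ => tendsto_integral_mul_regKernel hn hgm hg hε0 x) hx
  have hcont : ContinuousOn (G 0) (ball 0 R) :=
    hunif.continuousOn (Frequently.of_forall fun k =>
      (continuous_integral_smul_regKernelGrad hn hgi (hε' k)).continuousOn)
  have : ContDiffOn ℝ (0 + 1) (fun x => ∫ y, g y * regKernel n 0 (y - x)) (ball 0 R) := by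
    rw [contDiffOn_succ_iff_fderiv_of_isOpen isOpen_ball]
    refine ⟨fun x hx => (hderiv x hx).differentiableAt.differentiableWithinAt, by simp, ?_⟩
    rw [contDiffOn_zero]
    exact hcont.congr fun x hx => (hderiv x hx).fderiv
  simpa using this

/-- The Riesz potential of an integrable function that is bounded near the origin is bounded near
the origin. -/
lemma exists_rieszPotential_le {n : ℕ} (hn : 1 ≤ n) {α lam δ M : ℝ} (hα0 : 0 < α) (hαn : α < n)
    (hlam : 0 < lam) {u : Euc n → ℝ} (hu0 : ∀ x, 0 ≤ u x)
    (hint : Integrable fun y => u y ^ lam) (hδ : 0 < δ)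
    (hM : ∀ x : Euc n, x ≠ 0 → ‖x‖ < δ → u x ≤ M) :
    ∃ K, ∀ x : Euc n, ‖x‖ < δ / 2 → ∫ y, ‖x - y‖ ^ (-α) * u y ^ lam ≤ K := by
  have : Nonempty (Fin n) := ⟨⟨0, by omega⟩⟩
  have hne : ∀ᵐ y : Euc n, y ≠ 0 := by simp [ae_iff]
  have hloc := integrableOn_ball_norm_rpow hn hαn (δ + δ)
  refine ⟨|M| ^ lam * (∫ z in ball (0 : Euc n) (δ + δ), ‖z‖ ^ (-α)) +
    (δ / 2) ^ (-α) * ∫ y, u y ^ lam, fun x hx => ?_⟩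
  have hxδ : δ + ‖x‖ ≤ δ + δ := by linarith
  have i1 : Integrable ((ball (0 : Euc n) δ).indicator fun y => ‖y - x‖ ^ (-α)) :=
    (integrable_indicator_iff measurableSet_ball).2 (integrableOn_ball_comp_sub hloc hxδ)
  calc ∫ y, ‖x - y‖ ^ (-α) * u y ^ lam
      ≤ ∫ y, (|M| ^ lam * (ball (0 : Euc n) δ).indicator (fun y => ‖y - x‖ ^ (-α)) y +
          (δ / 2) ^ (-α) * u y ^ lam) := by
        refine integral_mono_of_nonneg (.of_forall fun y => ?_)
          ((i1.const_mul _).add (hint.const_mul _)) ?_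
        · exact mul_nonneg (by positivity) (Real.rpow_nonneg (hu0 y) _)
        · filter_upwards [hne] with y hy
          have hul : 0 ≤ u y ^ lam := Real.rpow_nonneg (hu0 y) _
          rw [norm_sub_rev x y]
          by_cases hyδ : ‖y‖ < δ
          · rw [indicator_of_mem (mem_ball_zero_iff.2 hyδ), mul_comm]
            refine le_add_of_le_of_nonneg (mul_le_mul_of_nonneg_right ?_ (by positivity))
              (mul_nonneg (by positivity) hul)
            exact Real.rpow_le_rpow (hu0 y) ((hM y hy hyδ).trans (le_abs_self M)) hlam.le
          · rw [indicator_of_notMem fun h => hyδ (mem_ball_zero_iff.1 h), mul_zero, zero_add]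
            refine mul_le_mul_of_nonneg_right ?_ hul
            refine Real.rpow_le_rpow_of_nonpos (by positivity) ?_ (by linarith)
            linarith [norm_sub_norm_le y x]
    _ = |M| ^ lam * (∫ y in ball (0 : Euc n) δ, ‖y - x‖ ^ (-α)) +
          (δ / 2) ^ (-α) * ∫ y, u y ^ lam := by
        rw [integral_add (i1.const_mul _) (hint.const_mul _), integral_const_mul,
          integral_const_mul, integral_indicator measurableSet_ball]
    _ ≤ _ := by
        gcongr
        exact setIntegral_ball_comp_sub_le (h := fun z => ‖z‖ ^ (-α)) (fun z => by positivity)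
          hloc hxδ

lemma integral_one_add_normSq_rpow_pos (n : ℕ) :
    0 < ∫ z : Euc n, (1 + ‖z‖ ^ 2) ^ (-((n : ℝ) + 2) / 2) := by
  have hpos : ∀ z : Euc n, 0 < (1 + ‖z‖ ^ 2) ^ (-((n : ℝ) + 2) / 2) := fun z => by positivity
  rw [integral_pos_iff_support_of_nonneg (fun z => (hpos z).le)
    (integrable_rpow_neg_one_add_norm_sq (by simp))]
  rw [Function.support_eq_univ fun z => (hpos z).ne']
  exact isOpen_univ.measure_pos _ univ_nonempty

/-- A bounded `C²` function on a punctured ball with bounded Laplacian extends to a function that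
is `C¹` near the origin. -/
lemma exists_contDiffAt_extension {n : ℕ} (hn : 3 ≤ n) {u : Euc n → ℝ} {ρ M : ℝ} (hρ : 0 < ρ)
    (hu : ContDiffOn ℝ 2 u {0}ᶜ) (huM : ∀ x ≠ 0, ‖x‖ < ρ → |u x| ≤ M)
    (hlM : ∀ x ≠ 0, ‖x‖ < ρ → |lap u x| ≤ M) :
    ∃ w : Euc n → ℝ, ContDiffAt ℝ 1 w 0 ∧ ∀ᶠ x in 𝓝[≠] 0, u x = w x := by
  have : Nonempty (Fin n) := ⟨⟨0, by omega⟩⟩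
  have hne : ∀ᵐ y : Euc n, y ≠ 0 := by simp [ae_iff]
  have hopen : IsOpen ({0}ᶜ : Set (Euc n)) := isOpen_compl_singleton
  let φ : ContDiffBump (0 : Euc n) := ⟨ρ / 2, ρ, by positivity, by linarith⟩
  let v : Euc n → ℝ := fun x => φ x * u x
  have hv : ContDiffOn ℝ 2 v {0}ᶜ := φ.contDiff.contDiffOn.mul hu
  have hvc : HasCompactSupport v := φ.hasCompactSupport.mul_right
  have hvu : ∀ x, ‖x‖ < ρ / 2 → v =ᶠ[𝓝 x] u := fun x hx => by
    filter_upwards [φ.eventuallyEq_one_of_mem_ball (mem_ball_zero_iff.2 hx)] with y hy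
    simp [v, hy]
  have hv0 : ∀ x, ρ ≤ ‖x‖ → v x = 0 := fun x hx => by
    have : φ x = 0 := φ.zero_of_le_dist (by simpa using hx)
    simp [v, this]
  have hl0 : ∀ x, ρ < ‖x‖ → lap v x = 0 := fun x hx => by
    have h : v =ᶠ[𝓝 x] fun _ => 0 := by
      filter_upwards [(isOpen_lt continuous_const continuous_norm).mem_nhds hx] with y hy
      exact hv0 y (le_of_lt hy)
    rw [lap_congr_of_eventuallyEq h]
    simp [lap]
  obtain ⟨A, hA⟩ : ∃ A, ∀ x ∈ closedBall (0 : Euc n) ρ \ ball 0 (ρ / 2), ‖lap v x‖ ≤ A := by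
    refine ((isCompact_closedBall _ _).diff isOpen_ball).exists_bound_of_continuousOn
      ((continuousOn_lap hopen hv).mono ?_)
    rintro x ⟨-, hx⟩ rfl
    exact hx (mem_ball_self (by positivity))
  let C := max (max M A) 0
  have hvC : ∀ x ≠ 0, |v x| ≤ C := fun x hx => by
    by_cases hxρ : ‖x‖ < ρ
    · have h1 : |φ x| ≤ 1 := by rw [abs_of_nonneg φ.nonneg]; exact φ.le_one
      rw [abs_mul]
      exact (mul_le_of_le_one_left (abs_nonneg _) h1).trans ((huM x hx hxρ).trans (by simp [C]))
    · rw [hv0 x (not_lt.1 hxρ), abs_zero]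
      exact le_max_right _ _
  have hlC : ∀ x ≠ 0, |lap v x| ≤ C := fun x hx => by
    by_cases hx2 : ‖x‖ < ρ / 2
    · rw [lap_congr_of_eventuallyEq (hvu x hx2)]
      exact (hlM x hx (by linarith)).trans (by simp [C])
    · by_cases hxρ : ‖x‖ ≤ ρ
      · exact (hA x ⟨by simpa using hxρ, by simpa using hx2⟩).trans (by simp [C])
      · rw [hl0 x (not_le.1 hxρ), abs_zero]
        exact le_max_right _ _
  have hmeas : ∀ {f : Euc n → ℝ}, ContinuousOn f {0}ᶜ → AEStronglyMeasurable f :=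
    aestronglyMeasurable_of_continuousOn_compl_zero (by omega)
  have hlmeas := hmeas (continuousOn_lap hopen hv)
  have hlind : ∀ᵐ y, |lap v y| ≤ (ball (0 : Euc n) (2 * ρ)).indicator (fun _ => C) y := by
    filter_upwards [hne] with y hy
    by_cases hyR : y ∈ ball (0 : Euc n) (2 * ρ)
    · rw [indicator_of_mem hyR]
      exact hlC y hy
    · rw [indicator_of_notMem hyR, hl0 y, abs_zero]
      have : 2 * ρ ≤ ‖y‖ := by simpa using hyR
      linarith
  let P : Euc n → ℝ := fun x => ∫ y, lap v y * regKernel n 0 (y - x)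
  have hP : ContDiffOn ℝ 1 P (ball 0 (2 * ρ)) :=
    contDiffOn_newtonPotential (by omega) (le_max_right _ _) hlmeas hlind
  obtain ⟨ε, -, hε, hε0⟩ := exists_seq_strictAnti_tendsto (0 : ℝ)
  let c : ℝ := n * (n - 2) * ∫ z : Euc n, (1 + ‖z‖ ^ 2) ^ (-((n : ℝ) + 2) / 2)
  have hc : 0 < c := by
    have : (3 : ℝ) ≤ n := by exact_mod_cast hn
    exact mul_pos (mul_pos (by linarith) (by linarith)) (integral_one_add_normSq_rpow_pos n)
  have hrep : ∀ x ≠ 0, -c * v x = P x := fun x hx => by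
    have l1 := tendsto_integral_mul_lap_regKernel (hmeas hv.continuousOn)
      (hne.mono fun y hy => hvC y hy) hε hε0 (hv.continuousOn.continuousAt (hopen.mem_nhds hx))
    have l2 := tendsto_integral_mul_regKernel (by omega) hlmeas hlind hε0 x
    refine tendsto_nhds_unique l1 (l2.congr fun k => ?_)
    exact (integral_mul_lap_eq_of_bounded hn hv hvc hvC hlC
      (contDiff_regKernel_sub (hε k).ne' x)).symm
  refine ⟨fun x => -c⁻¹ * P x, ?_, ?_⟩
  · exact contDiffAt_const.mul (hP.contDiffAt (ball_mem_nhds _ (by positivity)))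
  · filter_upwards [self_mem_nhdsWithin,
      mem_nhdsWithin_of_mem_nhds (ball_mem_nhds (0 : Euc n) (half_pos hρ))] with x hx hxρ
    rw [← hrep x hx, (hvu x (mem_ball_zero_iff.1 hxρ)).eq_of_nhds]
    field_simp

theorem stmt8 (n : ℕ) (hn : 3 ≤ n) (α lam sig : ℝ)
    (hα0 : 0 < α) (hαn : α < n) (hlam : 0 < lam) (hsig : 0 ≤ sig)
    (u : Euc n → ℝ) (hu : IsCPSolution n α lam sig u)
    (hbd : ∃ δ > (0:ℝ), ∃ M : ℝ, ∀ x : Euc n, x ≠ 0 → ‖x‖ < δ → u x ≤ M) :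
    ∃ w : Euc n → ℝ, ContDiff ℝ 1 w ∧ ∀ x : Euc n, x ≠ 0 → u x = w x := by
  obtain ⟨hu0, hu2, hint, hineq⟩ := hu
  obtain ⟨δ, hδ, M, hM⟩ := hbd
  obtain ⟨K, hK⟩ := exists_rieszPotential_le (by omega) hα0 hαn hlam hu0 hint hδ hM
  have hlap : ∀ x : Euc n, x ≠ 0 → ‖x‖ < min (δ / 2) 2 → |lap u x| ≤ |K| * |M| ^ sig := by
    intro x hx hxρ
    obtain ⟨h1, h2⟩ := hineq x ⟨mem_ball_zero_iff.2 (hxρ.trans_le (min_le_right _ _)), hx⟩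
    have hxδ : ‖x‖ < δ / 2 := hxρ.trans_le (min_le_left _ _)
    rw [← abs_neg, abs_of_nonneg h1]
    refine h2.trans (mul_le_mul ((hK x hxδ).trans (le_abs_self K)) ?_
      (Real.rpow_nonneg (hu0 x) _) (abs_nonneg _))
    exact Real.rpow_le_rpow (hu0 x) ((hM x hx (by linarith)).trans (le_abs_self M)) hsig
  obtain ⟨w, hw, huw⟩ := exists_contDiffAt_extension hn (u := u) (ρ := min (δ / 2) 2)
    (M := max |M| (|K| * |M| ^ sig)) (by positivity) hu2
    (fun x hx hxρ => by
      rw [abs_of_nonneg (hu0 x)]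
      have hxδ : ‖x‖ < δ := by linarith [hxρ.trans_le (min_le_left (δ / 2) 2)]
      exact ((hM x hx hxδ).trans (le_abs_self M)).trans (le_max_left _ _))
    (fun x hx hxρ => (hlap x hx hxρ).trans (le_max_right _ _))
  refine ⟨Function.update u 0 (w 0), ?_, fun x hx => (Function.update_of_ne hx _ _).symm⟩
  rw [contDiff_iff_contDiffAt]
  intro x
  rcases eq_or_ne x 0 with rfl | hx
  · refine hw.congr_of_eventuallyEq ?_
    filter_upwards [eventually_nhdsWithin_iff.1 huw] with y hy
    rcases eq_or_ne y 0 with rfl | hy0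
    · simp
    · rw [Function.update_of_ne hy0, hy hy0]
  · have hn0 : ({0}ᶜ : Set (Euc n)) ∈ 𝓝 x := isOpen_compl_singleton.mem_nhds hx
    refine ((hu2.contDiffAt hn0).of_le (by norm_num)).congr_of_eventuallyEq ?_
    filter_upwards [hn0] with y hy
    exact Function.update_of_ne hy _ _
end
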